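/- (Maynard–Tao) For every integer m ≥ 2 there exists a number k_m with the following property: if (h_1, ..., h_k) is an admissible tuple of distinct nonnegative integers with k ≥ k_m, then for infinitely many n ∈ ℕ the set {n + h_1, ..., n + h_k} contains at least m primes. -/

import Mathlib

/-- A tuple `h : Fin k → ℕ` of distinct nonnegative integers is admissible if
for every prime `p` it avoids at least one residue class mod `p`. -/
def AdmissibleTuple {k : ℕ} (h : Fin k → ℕ) : Prop :=
  Function.Injective h ∧ ∀ p : ℕ, p.Prime → ∃ r : ℕ, ∀ i : Fin k, h i % p ≠ r

section

open MeasureTheory Real Complex in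
/-- frequency factor `1 + 2π i ξ` -/
noncomputable def om (ξ : ℝ) : ℂ := 1 + 2 * Real.pi * ξ * Complex.I

lemma om_re (ξ : ℝ) : (om ξ).re = 1 := by simp [om]

lemma one_le_norm_om (ξ : ℝ) : 1 ≤ ‖om ξ‖ := by
  have := Complex.re_le_norm (om ξ)
  rwa [om_re] at this

lemma om_ne_zero (ξ : ℝ) : om ξ ≠ 0 := by
  intro h
  have := one_le_norm_om ξ
  rw [h, norm_zero] at this
  linarith

@[fun_prop] lemma continuous_om : Continuous om := by unfold om; fun_prop

/-- `φ` represents `f` as a Laplace-Fourier integral. -/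
structure LapRep (f : ℝ → ℝ) (φ : ℝ → ℂ) : Prop where
  cont : Continuous φ
  int : ∀ N : ℕ, MeasureTheory.Integrable (fun ξ => ‖φ ξ‖ * ‖om ξ‖ ^ N)
  eq : ∀ t : ℝ, (f t : ℂ) = ∫ ξ, φ ξ * Complex.exp (-(t * om ξ))

open MeasureTheory FourierTransform SchwartzMap in
lemma exists_rep (f : ℝ → ℝ) (hf : ContDiff ℝ (⊤ : ℕ∞) f) (hc : HasCompactSupport f) :
    ∃ φ, LapRep f φ := by
  set F : ℝ → ℂ := fun t => ((Real.exp t * f t : ℝ) : ℂ) with hF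
  have hF1 : ContDiff ℝ (⊤ : ℕ∞) F := by
    have : ContDiff ℝ (⊤ : ℕ∞) (fun t => Real.exp t * f t) := Real.contDiff_exp.mul hf
    exact Complex.ofRealCLM.contDiff.comp this
  have hF2 : HasCompactSupport F := by
    have : HasCompactSupport (fun t => Real.exp t * f t) := hc.mul_left
    exact this.comp_left (g := fun x : ℝ => (x : ℂ)) (by simp)
  set S : 𝓢(ℝ, ℂ) := hF2.toSchwartzMap hF1 with hS
  have hSF : ∀ t, S t = F t := fun t => rfl
  set G : 𝓢(ℝ, ℂ) := 𝓕⁻ S with hG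
  refine ⟨G, G.continuous, ?_, ?_⟩
  · intro N
    have h1 : Integrable (fun ξ => (8:ℝ)^N * (‖G ξ‖ + ‖ξ‖ ^ N * ‖G ξ‖)) := by
      apply Integrable.const_mul
      exact (G.integrable.norm).add (G.integrable_pow_mul _ N)
    refine h1.mono' (by fun_prop) (Filter.Eventually.of_forall fun ξ => ?_)
    rw [Real.norm_of_nonneg (by positivity)]
    have h2 : ‖om ξ‖ ≤ 8 * max 1 ‖ξ‖ := by
      unfold om
      refine (norm_add_le _ _).trans ?_
      simp only [norm_one, norm_mul, Complex.norm_I, Complex.norm_real, mul_one,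
        Complex.norm_ofNat, Real.norm_of_nonneg Real.pi_pos.le]
      have := Real.pi_lt_d2
      have h3 := le_max_left 1 ‖ξ‖
      have h4 := le_max_right 1 ‖ξ‖
      nlinarith [norm_nonneg ξ, Real.pi_pos]
    have h3 : ‖om ξ‖ ^ N ≤ 8 ^ N * (1 + ‖ξ‖ ^ N) := by
      refine (pow_le_pow_left₀ (norm_nonneg _) h2 N).trans ?_
      rw [mul_pow]
      gcongr
      rcases max_choice 1 ‖ξ‖ with h | h <;> rw [h]
      · simp
      · linarith
    calc ‖G ξ‖ * ‖om ξ‖ ^ N ≤ ‖G ξ‖ * (8 ^ N * (1 + ‖ξ‖ ^ N)) := by gcongr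
      _ = _ := by ring
  · intro t
    have h1 : 𝓕 G = S := by rw [hG]; exact FourierTransform.fourier_fourierInv_eq S
    have h2 : F t = 𝓕 (G : ℝ → ℂ) t := by
      rw [← hSF, ← h1]; rfl
    have h3 : (f t : ℂ) = Complex.exp (-t) * F t := by
      rw [hF]; push_cast
      rw [← mul_assoc, ← Complex.exp_add]; simp
    rw [h3, h2, Real.fourier_real_eq_integral_exp_smul, ← integral_const_mul]
    congr 1; ext ξ
    rw [smul_eq_mul, mul_comm (G ξ), ← mul_assoc, ← Complex.exp_add]
    congr 2
    unfold om; push_cast; ring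

lemma LapRep.integrable {f : ℝ → ℝ} {φ : ℝ → ℂ} (h : LapRep f φ) : MeasureTheory.Integrable φ := by
  have := h.int 0
  simp only [pow_zero, mul_one] at this
  exact (MeasureTheory.integrable_norm_iff h.cont.aestronglyMeasurable).1 this

lemma LapRep.integrable_pow_exp {f : ℝ → ℝ} {φ : ℝ → ℂ} (h : LapRep f φ) (j : ℕ) (t : ℝ) :
    MeasureTheory.Integrable (fun ξ => φ ξ * om ξ ^ j * Complex.exp (-(t * om ξ))) := by
  refine ((h.int j).const_mul (Real.exp (-t))).mono' ?_ (Filter.Eventually.of_forall fun ξ => ?_)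
  · have := h.cont
    fun_prop
  · rw [norm_mul, norm_mul, norm_pow, Complex.norm_exp]
    simp [om_re, mul_comm]

open MeasureTheory in
lemma LapRep.hasDerivAt {f : ℝ → ℝ} {φ : ℝ → ℂ} (h : LapRep f φ) (j : ℕ) (t : ℝ) :
    HasDerivAt (fun t : ℝ => ∫ ξ, φ ξ * om ξ ^ j * Complex.exp (-(t * om ξ)))
      (∫ ξ, -(φ ξ * om ξ ^ (j+1) * Complex.exp (-(t * om ξ)))) t := by
  have hcont := h.cont
  refine (hasDerivAt_integral_of_dominated_loc_of_deriv_le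
    (F := fun (t : ℝ) ξ => φ ξ * om ξ ^ j * Complex.exp (-(t * om ξ)))
    (F' := fun (t : ℝ) ξ => -(φ ξ * om ξ ^ (j+1) * Complex.exp (-(t * om ξ))))
    (s := Set.Ioo (t-1) (t+1)) (Ioo_mem_nhds (by linarith) (by linarith))
    (bound := fun ξ => Real.exp (1-t) * (‖φ ξ‖ * ‖om ξ‖ ^ (j+1))) ?_ ?_ ?_ ?_ ?_ ?_).2
  · refine Filter.Eventually.of_forall fun x => ?_
    exact (h.integrable_pow_exp j x).aestronglyMeasurable
  · exact h.integrable_pow_exp j t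
  · exact (h.integrable_pow_exp (j+1) t).neg.aestronglyMeasurable
  · refine Filter.Eventually.of_forall fun ξ x hx => ?_
    rw [norm_neg, norm_mul, norm_mul, norm_pow, Complex.norm_exp, mul_comm]
    gcongr
    simp [om_re]
    linarith [hx.1]
  · exact (h.int (j+1)).const_mul _
  · refine Filter.Eventually.of_forall fun ξ x hx => ?_
    have h1 : HasDerivAt (fun x : ℝ => -((x : ℂ) * om ξ)) (-(om ξ)) x := by
      have h0 := ((Complex.ofRealCLM.hasDerivAt (x := x)).mul_const (om ξ)).fun_neg
      simp only [Complex.ofRealCLM_apply, Complex.ofReal_one, one_mul] at h0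
      exact h0
    have h2 := (h1.cexp).const_mul (φ ξ * om ξ ^ j)
    have h3 : -(φ ξ * om ξ ^ (j+1) * Complex.exp (-(x * om ξ))) =
      φ ξ * om ξ ^ j * (Complex.exp (-(x * om ξ)) * -om ξ) := by ring
    rw [h3]
    exact h2

/-- moments vanish when `f` vanishes near `0`. -/
lemma LapRep.moment {f : ℝ → ℝ} {φ : ℝ → ℂ} (h : LapRep f φ) (h0 : ∀ t < 1, f t = 0) (j : ℕ) :
    ∀ t < (1:ℝ), ∫ ξ, φ ξ * om ξ ^ j * Complex.exp (-(t * om ξ)) = 0 := by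
  induction j with
  | zero =>
    intro t ht
    simp only [pow_zero, mul_one]
    rw [← h.eq, h0 t ht]; simp
  | succ j ih =>
    intro t ht
    have h1 := h.hasDerivAt j t
    have h2 : HasDerivAt (fun t : ℝ => ∫ ξ, φ ξ * om ξ ^ j * Complex.exp (-(t * om ξ))) 0 t := by
      refine (hasDerivAt_const t (0:ℂ)).congr_of_eventuallyEq ?_
      filter_upwards [Iio_mem_nhds ht] with x hx
      exact ih x hx
    have h3 := h1.unique h2
    rw [MeasureTheory.integral_neg] at h3
    exact neg_eq_zero.1 h3

lemma LapRep.moment_zero {f : ℝ → ℝ} {φ : ℝ → ℂ} (h : LapRep f φ) (h0 : ∀ t < 1, f t = 0) (j : ℕ) :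
    ∫ ξ, φ ξ * om ξ ^ j = 0 := by
  have := h.moment h0 j 0 (by norm_num)
  simpa using this

lemma LapRep.deriv_eq {f : ℝ → ℝ} {φ : ℝ → ℂ} (h : LapRep f φ) (hf : Differentiable ℝ f) (t : ℝ) :
    ((deriv f t : ℝ) : ℂ) = -∫ ξ, φ ξ * om ξ * Complex.exp (-(t * om ξ)) := by
  have h1 := h.hasDerivAt 0 t
  have h2 : HasDerivAt (fun t : ℝ => ((f t : ℝ) : ℂ)) ((deriv f t : ℝ) : ℂ) t :=
    (hf t).hasDerivAt.ofReal_comp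
  have h3 : (fun t : ℝ => ∫ ξ, φ ξ * om ξ ^ 0 * Complex.exp (-(t * om ξ))) =
      fun t : ℝ => ((f t : ℝ) : ℂ) := by
    ext t; rw [h.eq]; simp
  rw [h3] at h1
  have := h2.unique h1
  rw [this, MeasureTheory.integral_neg]
  simp

end

section

/-! ### Character sums and bounds for `L(s,χ)` near `1` -/

lemma sum_range_char_modulus {r : ℕ} [NeZero r] (χ : DirichletCharacter ℂ r) (hχ : χ ≠ 1) :
    ∑ k ∈ Finset.range r, χ (k : ZMod r) = 0 := by
  rw [← MulChar.sum_eq_zero_of_ne_one hχ]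
  symm
  refine Finset.sum_bij (fun a _ => ZMod.val a) ?_ ?_ ?_ ?_
  · intro a _; simpa using ZMod.val_lt a
  · intro a _ b _ h; exact ZMod.val_injective r h
  · intro b hb
    exact ⟨(b : ZMod r), Finset.mem_univ _, ZMod.val_cast_of_lt (by simpa using hb)⟩
  · intro a _; simp

lemma norm_sum_range_char {r : ℕ} [NeZero r] (χ : DirichletCharacter ℂ r) (hχ : χ ≠ 1) (n : ℕ) :
    ‖∑ k ∈ Finset.range n, χ (k : ZMod r)‖ ≤ r := by
  have hper : Function.Periodic (fun n : ℕ => ∑ k ∈ Finset.range n, χ (k : ZMod r)) r := by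
    intro n
    simp only
    rw [add_comm, Finset.sum_range_add, sum_range_char_modulus χ hχ, zero_add]
    simp only [Nat.cast_add, CharP.cast_eq_zero, zero_add]
  have h1 := hper.map_mod_nat n
  rw [← h1]
  refine (norm_sum_le _ _).trans ?_
  refine (Finset.sum_le_card_nsmul _ _ 1 (fun k _ => χ.norm_le_one _)).trans ?_
  simp only [Finset.card_range, nsmul_eq_mul, mul_one]
  exact_mod_cast (Nat.mod_lt _ (NeZero.pos r)).le

lemma norm_sum_Icc_char {r : ℕ} [NeZero r] (χ : DirichletCharacter ℂ r) (hχ : χ ≠ 1) (n : ℕ) :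
    ‖∑ k ∈ Finset.Icc 1 n, χ (k : ZMod r)‖ ≤ r := by
  have hr : r ≠ 1 := by
    rintro rfl; exact hχ (DirichletCharacter.level_one χ)
  have h0 : χ (0 : ZMod r) = 0 := DirichletCharacter.map_zero' χ hr
  have := norm_sum_range_char χ hχ (n+1)
  rw [Finset.sum_range_succ'] at this
  simp only [Nat.cast_zero, h0, add_zero] at this
  rwa [Finset.range_eq_Ico, Finset.sum_Ico_add' (fun k : ℕ => χ (k : ZMod r)) 0 n 1] at this

lemma norm_sum_Icc_char_le {r : ℕ} (χ : DirichletCharacter ℂ r) (n : ℕ) :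
    ‖∑ k ∈ Finset.Icc 1 n, χ (k : ZMod r)‖ ≤ n := by
  refine (norm_sum_le _ _).trans ?_
  refine (Finset.sum_le_card_nsmul _ _ 1 (fun k _ => χ.norm_le_one _)).trans ?_
  simp

/-- partial sum function -/
noncomputable def chS {r : ℕ} (χ : DirichletCharacter ℂ r) (t : ℝ) : ℂ :=
  ∑ k ∈ Finset.Icc 1 ⌊t⌋₊, χ (k : ZMod r)

lemma chS_measurable {r : ℕ} (χ : DirichletCharacter ℂ r) : Measurable (chS χ) := by
  have : Measurable (fun n : ℕ => ∑ k ∈ Finset.Icc 1 n, χ (k : ZMod r)) := measurable_from_nat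
  exact this.comp Nat.measurable_floor

lemma chS_eq_zero {r : ℕ} (χ : DirichletCharacter ℂ r) {t : ℝ} (ht : t < 1) : chS χ t = 0 := by
  unfold chS
  rw [Nat.floor_eq_zero.2 ht]; simp

open Filter Topology MeasureTheory Set

lemma LFunction_eq_mellin {r : ℕ} [NeZero r] (χ : DirichletCharacter ℂ r) (hχ : χ ≠ 1) {s : ℂ}
    (hs : 0 < s.re) : χ.LFunction s = s * mellin (chS χ) (-s) := by
  have hdiff : DifferentiableOn ℂ (fun s => s * mellin (chS χ) (-s)) {s : ℂ | 0 < s.re} := by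
    intro s hs
    refine DifferentiableAt.differentiableWithinAt ?_
    refine differentiableAt_id.mul ?_
    have h := mellin_differentiableAt_of_isBigO_rpow (f := chS χ) (s := -s) (a := 0) 
      (b := (-s).re - 1) ?_ ?_ ?_ ?_ ?_
    · exact h.comp s (differentiableAt_id.neg)
    · apply LocallyIntegrable.locallyIntegrableOn
      refine (locallyIntegrable_const (r:ℝ)).mono (chS_measurable χ).aestronglyMeasurable ?_
      refine Eventually.of_forall fun t => ?_
      simpa [chS] using norm_sum_Icc_char χ hχ ⌊t⌋₊
    · refine Asymptotics.IsBigO.of_bound r (Eventually.of_forall fun t => ?_)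
      simpa [chS] using norm_sum_Icc_char χ hχ ⌊t⌋₊
    · simpa using hs
    · refine Asymptotics.IsBigO.of_bound 1 ?_
      have : ∀ᶠ t : ℝ in 𝓝[>] 0, t < 1 := by
        exact (Iio_mem_nhds one_pos : Iio (1:ℝ) ∈ 𝓝 0) |> mem_nhdsWithin_of_mem_nhds
      filter_upwards [this] with t ht
      rw [chS_eq_zero χ ht]; simp
    · linarith
  have ho : IsOpen {s : ℂ | 0 < s.re} := isOpen_lt continuous_const Complex.continuous_re
  have hconv : Convex ℝ {s : ℂ | 0 < s.re} := convex_halfSpace_re_gt 0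
  have h1 : AnalyticOnNhd ℂ (fun s => s * mellin (chS χ) (-s)) {s : ℂ | 0 < s.re} :=
    hdiff.analyticOnNhd ho
  have h2 : AnalyticOnNhd ℂ χ.LFunction {s : ℂ | 0 < s.re} :=
    (DirichletCharacter.differentiable_LFunction hχ).differentiableOn.analyticOnNhd ho
  have h3 := h2.eqOn_of_preconnected_of_eventuallyEq h1 hconv.isPreconnected (z₀ := 2) (by simp) ?_
  · exact h3 hs
  · have h4 : {s : ℂ | 1 < s.re} ∈ 𝓝 (2:ℂ) :=
      (isOpen_lt continuous_const Complex.continuous_re).mem_nhds (by simp)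
    filter_upwards [h4] with s hs
    have hs' : 1 < s.re := hs
    rw [DirichletCharacter.LFunction_eq_LSeries χ hs', LSeries_eq_mul_integral _ (r := 1) 
      zero_le_one hs' (DirichletCharacter.LSeriesSummable_of_one_lt_re χ hs')]
    · congr 1
      unfold mellin
      have : Ioi (1:ℝ) ⊆ Ioi 0 := Ioi_subset_Ioi zero_le_one
      rw [← setIntegral_eq_of_subset_of_ae_sdiff_eq_zero nullMeasurableSet_Ioi this]
      · refine setIntegral_congr_fun measurableSet_Ioi fun t ht => ?_
        simp only [smul_eq_mul, chS]
        rw [mul_comm]; congr 2; ring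
      · have h5 : ∀ᵐ t : ℝ, t ≠ 1 := by simp [ae_iff]
        filter_upwards [h5] with t ht ht2
        have : t < 1 := lt_of_le_of_ne (not_lt.1 fun h => ht2.2 h) ht
        have h6 := chS_eq_zero χ this
        unfold chS at h6
        rw [h6]; simp
    · refine Asymptotics.IsBigO.of_bound 1 (Eventually.of_forall fun n => ?_)
      simpa using norm_sum_Icc_char_le χ n

lemma norm_chS_le {r : ℕ} [NeZero r] (χ : DirichletCharacter ℂ r) (hχ : χ ≠ 1) {ℓ : ℝ} (hℓ : 2 ≤ ℓ)
    (hr : (r:ℝ) ≤ Real.exp ℓ) {t : ℝ} (ht : 0 < t) :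
    ‖chS χ t‖ ≤ Real.exp 2 * t ^ (1 - 2/ℓ) := by
  have h1 : ‖chS χ t‖ ≤ r := norm_sum_Icc_char χ hχ _
  have h2 : ‖chS χ t‖ ≤ t := (norm_sum_Icc_char_le χ _).trans (Nat.floor_le ht.le)
  have hc : 2/ℓ ≤ 1 := by rw [div_le_one (by linarith)]; exact hℓ
  have hc0 : 0 < 2/ℓ := by positivity
  have h0 := norm_nonneg (chS χ t)
  calc ‖chS χ t‖ = ‖chS χ t‖ ^ (2/ℓ) * ‖chS χ t‖ ^ (1 - 2/ℓ) := by
        rw [← Real.rpow_add' h0 (by norm_num)]; norm_num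
    _ ≤ (Real.exp ℓ) ^ (2/ℓ) * t ^ (1 - 2/ℓ) := by
        have := h1.trans hr
        gcongr
    _ = _ := by rw [← Real.exp_mul]; congr 2; field_simp

lemma norm_LFunction_le {r : ℕ} [NeZero r] (χ : DirichletCharacter ℂ r) (hχ : χ ≠ 1) {ℓ : ℝ}
    (hℓ : 2 ≤ ℓ) (hr : (r:ℝ) ≤ Real.exp ℓ) {s : ℂ} (hs : ‖s - 1‖ ≤ 1/ℓ) :
    ‖χ.LFunction s‖ ≤ 16 * ℓ := by
  have hi : 1/ℓ ≤ 1/2 := by gcongr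
  have hi0 : 0 < 1/ℓ := by positivity
  have hre : 1 - 1/ℓ ≤ s.re := by
    have := (Complex.abs_re_le_norm (s-1)).trans hs
    rw [abs_le] at this
    simp at this
    simp; linarith
  have hn : ‖s‖ ≤ 3/2 := by
    calc ‖s‖ = ‖(s-1)+1‖ := by ring_nf
      _ ≤ ‖s-1‖ + ‖(1:ℂ)‖ := norm_add_le _ _
      _ ≤ _ := by rw [norm_one]; linarith
  rw [LFunction_eq_mellin χ hχ (by linarith), norm_mul]
  have h1 : ‖mellin (chS χ) (-s)‖ ≤ Real.exp 2 * ℓ := by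
    unfold mellin
    have hsub : Ioi (1:ℝ) ⊆ Ioi 0 := Ioi_subset_Ioi zero_le_one
    rw [setIntegral_eq_of_subset_of_ae_sdiff_eq_zero nullMeasurableSet_Ioi hsub]
    · set a : ℝ := -s.re - 1 + (1 - 2/ℓ) with ha
      have ha1 : a ≤ -1 - 1/ℓ := by rw [ha]; field_simp at hre ⊢; linarith
      have ha2 : a < -1 := by linarith
      calc _ ≤ ∫ t in Ioi (1:ℝ), Real.exp 2 * t ^ a := by
            refine norm_integral_le_of_norm_le 
              ((integrableOn_Ioi_rpow_of_lt ha2 one_pos).const_mul _) ?_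
            refine (ae_restrict_iff' measurableSet_Ioi).2 (Eventually.of_forall fun t ht => ?_)
            have ht0 : 0 < t := one_pos.trans ht
            rw [norm_smul, Complex.norm_cpow_eq_rpow_re_of_pos ht0, ha, Real.rpow_add ht0]
            have := norm_chS_le χ hχ hℓ hr ht0
            simp only [Complex.sub_re, Complex.neg_re, Complex.one_re]
            calc _ ≤ t ^ (-s.re-1) * (Real.exp 2 * t ^ (1 - 2/ℓ)) := by gcongr
              _ = _ := by ring
        _ = Real.exp 2 * (-1 / (a+1)) := by
            rw [integral_const_mul, integral_Ioi_rpow_of_lt ha2 one_pos]; simp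
        _ ≤ _ := by
            gcongr
            rw [div_le_iff_of_neg (by linarith)]
            have : ℓ * (1/ℓ) = 1 := by field_simp
            nlinarith
    · have h5 : ∀ᵐ t : ℝ, t ≠ 1 := by simp [ae_iff]
      filter_upwards [h5] with t ht ht2
      have : t < 1 := lt_of_le_of_ne (not_lt.1 fun h => ht2.2 h) ht
      rw [chS_eq_zero χ this]; simp
  have h2 : Real.exp 2 ≤ 8 := by
    have := Real.exp_one_lt_d9
    have h3 : Real.exp 2 = Real.exp 1 ^ 2 := by rw [← Real.exp_nat_mul]; norm_num
    rw [h3]; nlinarith [Real.exp_pos 1]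
  calc _ ≤ 3/2 * (Real.exp 2 * ℓ) := by gcongr
    _ ≤ 3/2 * (8 * ℓ) := by gcongr
    _ ≤ _ := by linarith

lemma norm_deriv_LFunction_le {r : ℕ} [NeZero r] (χ : DirichletCharacter ℂ r) (hχ : χ ≠ 1) {ℓ : ℝ}
    (hℓ : 2 ≤ ℓ) (hr : (r:ℝ) ≤ Real.exp ℓ) {s : ℂ} (hs : ‖s - 1‖ ≤ 1/(2*ℓ)) :
    ‖deriv χ.LFunction s‖ ≤ 32 * ℓ^2 := by
  have h := Complex.norm_deriv_le_of_forall_mem_sphere_norm_le (c := s) (R := 1/(2*ℓ)) 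
    (f := χ.LFunction) (C := 16 * ℓ) (by positivity)
    (DirichletCharacter.differentiable_LFunction hχ).diffContOnCl ?_
  · refine h.trans (le_of_eq ?_)
    field_simp; ring
  · intro z hz
    refine norm_LFunction_le χ hχ hℓ hr ?_
    rw [mem_sphere_iff_norm] at hz
    calc ‖z - 1‖ = ‖(z - s) + (s - 1)‖ := by ring_nf
      _ ≤ ‖z-s‖ + ‖s-1‖ := norm_add_le _ _
      _ ≤ 1/(2*ℓ) + 1/(2*ℓ) := by rw [hz]; gcongr
      _ = _ := by field_simp; norm_num

lemma norm_LFunction_sub_le {r : ℕ} [NeZero r] (χ : DirichletCharacter ℂ r) (hχ : χ ≠ 1) {ℓ : ℝ}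
    (hℓ : 2 ≤ ℓ) (hr : (r:ℝ) ≤ Real.exp ℓ) {s : ℂ} (hs : ‖s - 1‖ ≤ 1/(2*ℓ)) :
    ‖χ.LFunction s - χ.LFunction 1‖ ≤ 32 * ℓ^2 * ‖s - 1‖ := by
  refine (convex_closedBall (1:ℂ) (1/(2*ℓ))).norm_image_sub_le_of_norm_deriv_le (𝕜 := ℂ) 
    (f := χ.LFunction) ?_ ?_ ?_ ?_
  · intro x _; exact DirichletCharacter.differentiable_LFunction hχ x
  · intro x hx
    exact norm_deriv_LFunction_le χ hχ hℓ hr (by simpa [dist_eq_norm] using hx)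
  · simp; linarith
  · simpa [dist_eq_norm] using hs

end

section

open Filter Topology MeasureTheory Set
open scoped ArithmeticFunction ComplexConjugate

lemma norm_riemannZeta_le {s : ℂ} (hs : 1 < s.re) : ‖riemannZeta s‖ ≤ ‖s‖ / (s.re - 1) := by
  rw [← LSeries_one_eq_riemannZeta hs, LSeries_eq_mul_integral _ (r := 1) zero_le_one hs
    (LSeriesSummable_one_iff.2 hs), norm_mul, div_eq_mul_inv]
  · gcongr
    have ha : -s.re < -1 := by linarith
    calc _ ≤ ∫ t in Ioi (1:ℝ), t ^ (-s.re) := by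
            refine norm_integral_le_of_norm_le (integrableOn_Ioi_rpow_of_lt ha one_pos) ?_
            refine (ae_restrict_iff' measurableSet_Ioi).2 (Eventually.of_forall fun t ht => ?_)
            have ht0 : 0 < t := one_pos.trans ht
            rw [norm_mul, Complex.norm_cpow_eq_rpow_re_of_pos ht0]
            simp only [Pi.one_apply, Finset.sum_const, Nat.card_Icc, add_tsub_cancel_right,
              nsmul_eq_mul, mul_one, Complex.norm_natCast]
            calc _ ≤ t * t ^ (-(s + 1)).re := by
                  gcongr; exact Nat.floor_le ht0.le
              _ = _ := by
                  rw [← Real.rpow_one_add' ht0.le (by simp; linarith)]; simp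
        _ = _ := by
            rw [integral_Ioi_rpow_of_lt ha one_pos]
            simp only [Real.one_rpow]
            rw [show -s.re + 1 = -(s.re - 1) by ring, neg_div_neg_eq, one_div]
  · refine Asymptotics.IsBigO.of_bound 1 (Eventually.of_forall fun n => ?_)
    simp

lemma summable_char_exp {r : ℕ} (χ : DirichletCharacter ℂ r) {s : ℂ} (hs : 1 < s.re) :
    LSeriesSummable (fun n : ℕ => χ n * (Λ n : ℂ) / (Real.log n : ℂ)) s := by
  refine LSeriesSummable_of_bounded_of_one_lt_re (m := 1) (fun n hn => ?_) hs
  rw [norm_div, norm_mul, Complex.norm_real, Complex.norm_real,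
    Real.norm_of_nonneg ArithmeticFunction.vonMangoldt_nonneg, 
    Real.norm_of_nonneg (Real.log_natCast_nonneg n)]
  refine div_le_one_of_le₀ ?_ (Real.log_natCast_nonneg n)
  calc _ ≤ 1 * Real.log n := by
        gcongr
        · exact χ.norm_le_one _
        · exact ArithmeticFunction.vonMangoldt_le_log
    _ = _ := one_mul _

lemma summable_zeta_exp {s : ℂ} (hs : 1 < s.re) :
    LSeriesSummable (fun n : ℕ => (Λ n : ℂ) / (Real.log n : ℂ)) s := by
  refine LSeriesSummable_of_bounded_of_one_lt_re (m := 1) (fun n hn => ?_) hs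
  rw [norm_div, Complex.norm_real, Complex.norm_real,
    Real.norm_of_nonneg ArithmeticFunction.vonMangoldt_nonneg, 
    Real.norm_of_nonneg (Real.log_natCast_nonneg n)]
  exact div_le_one_of_le₀ ArithmeticFunction.vonMangoldt_le_log (Real.log_natCast_nonneg n)

lemma pos_aux (a b : ℂ) (ha : ‖a‖ ≤ 1) (hb : ‖b‖ ≤ 1) :
    0 ≤ (3 + 2 * a + 2 * b + 2 * (a * conj b)).re := by
  have h1 : a.re^2 + a.im^2 ≤ 1 := by
    have := Complex.sq_norm a
    rw [Complex.normSq_apply] at this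
    nlinarith [norm_nonneg a]
  have h2 : b.re^2 + b.im^2 ≤ 1 := by
    have := Complex.sq_norm b
    rw [Complex.normSq_apply] at this
    nlinarith [norm_nonneg b]
  simp
  nlinarith [sq_nonneg (1 + a.re + b.re), sq_nonneg (a.im + b.im)]

lemma L_product_ge_one {r₁ r₂ r₃ : ℕ} [NeZero r₁] [NeZero r₂] [NeZero r₃]
    (χ₁ : DirichletCharacter ℂ r₁) (χ₂ : DirichletCharacter ℂ r₂)
    (χ₃ : DirichletCharacter ℂ r₃) (h3 : ∀ n : ℕ, χ₃ n = χ₁ n * conj (χ₂ n)) {σ : ℝ} (hσ : 1 < σ) :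
    1 ≤ ‖riemannZeta σ‖^3 * ‖χ₁.LFunction σ‖^2 * ‖χ₂.LFunction σ‖^2 * ‖χ₃.LFunction σ‖^2 := by
  have hs : 1 < (σ : ℂ).re := by simpa using hσ
  rw [χ₁.LFunction_eq_LSeries hs, χ₂.LFunction_eq_LSeries hs, χ₃.LFunction_eq_LSeries hs,
    ← riemannZeta_eq_exp_LSeries hs, ← DirichletCharacter.LSeries_eq_exp_LSeries _ hs,
    ← DirichletCharacter.LSeries_eq_exp_LSeries _ hs,
    ← DirichletCharacter.LSeries_eq_exp_LSeries _ hs]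
  simp only [Complex.norm_exp, ← Real.exp_nat_mul, ← Real.exp_add]
  rw [Real.one_le_exp_iff]
  have H0 := (summable_zeta_exp hs).LSeriesHasSum
  have H1 := (summable_char_exp χ₁ hs).LSeriesHasSum
  have H2 := (summable_char_exp χ₂ hs).LSeriesHasSum
  have H3 := (summable_char_exp χ₃ hs).LSeriesHasSum
  unfold LSeriesHasSum at H0 H1 H2 H3
  have H := (((H0.mul_left 3).add (H1.mul_left 2)).add (H2.mul_left 2)).add (H3.mul_left 2)
  have H' := Complex.hasSum_re H
  have := H'.nonneg (fun n => ?_)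
  · rw [Nat.cast_ofNat, Nat.cast_ofNat]
    have e2 : ∀ z : ℂ, (2 * z).re = 2 * z.re := fun z => by simp
    have e3 : ∀ z : ℂ, (3 * z).re = 3 * z.re := fun z => by simp
    simp only [Complex.add_re, e2, e3] at this
    exact this
  · rcases eq_or_ne n 0 with rfl | hn
    · simp
    rw [LSeries.term_of_ne_zero hn, LSeries.term_of_ne_zero hn, LSeries.term_of_ne_zero hn,
      LSeries.term_of_ne_zero hn, h3]
    have e : ((n : ℂ) ^ (σ : ℂ)) = (((n : ℝ) ^ σ : ℝ) : ℂ) := by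
      rw [Complex.ofReal_cpow (by positivity)]; simp
    rw [e]
    have : 3 * ((Λ n : ℂ) / (Real.log n : ℂ) / (((n : ℝ) ^ σ : ℝ) : ℂ)) +
        2 * (χ₁ n * (Λ n : ℂ) / (Real.log n : ℂ) / (((n : ℝ) ^ σ : ℝ) : ℂ)) +
        2 * (χ₂ n * (Λ n : ℂ) / (Real.log n : ℂ) / (((n : ℝ) ^ σ : ℝ) : ℂ)) +
        2 * (χ₁ n * conj (χ₂ n) * (Λ n : ℂ) / (Real.log n : ℂ) / (((n : ℝ) ^ σ : ℝ) : ℂ)) =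
        ((Λ n / Real.log n / (n : ℝ) ^ σ : ℝ) : ℂ) *
          (3 + 2 * χ₁ n + 2 * χ₂ n + 2 * (χ₁ n * conj (χ₂ n))) := by
      push_cast; ring
    rw [this, Complex.re_ofReal_mul]
    refine mul_nonneg ?_ (pos_aux _ _ (χ₁.norm_le_one _) (χ₂.norm_le_one _))
    have := Real.log_natCast_nonneg n
    have := ArithmeticFunction.vonMangoldt_nonneg (n := n)
    positivity

lemma LFunction_unique_bad_aux {ℓ δ : ℝ} (hℓ : 2 ≤ ℓ) (hδ0 : 0 < δ) 
    (hδ : δ * (2^60 * ℓ^8) ≤ 1) {r₁ r₂ r₃ : ℕ}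
    [NeZero r₁] [NeZero r₂] [NeZero r₃]
    (χ₁ : DirichletCharacter ℂ r₁) (χ₂ : DirichletCharacter ℂ r₂)
    (χ₃ : DirichletCharacter ℂ r₃) (h3 : ∀ n : ℕ, χ₃ n = χ₁ n * conj (χ₂ n)) 
    (h1' : χ₁ ≠ 1) (h2' : χ₂ ≠ 1) (h3' : χ₃ ≠ 1) (hr₁ : (r₁:ℝ) ≤ Real.exp ℓ)
    (hr₂ : (r₂:ℝ) ≤ Real.exp ℓ) (hr₃ : (r₃:ℝ) ≤ Real.exp (2*ℓ))
    (hb₁ : ‖χ₁.LFunction 1‖ ≤ δ) (hb₂ : ‖χ₂.LFunction 1‖ ≤ δ) : False := by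
  -- choose σ with ℓ^2 (σ-1) = δ
  set ε : ℝ := δ / ℓ^2 with hε
  have hε0 : 0 < ε := by positivity
  have hδε : δ = ε * ℓ^2 := by rw [hε]; field_simp
  have hεl : ε * (2^60 * ℓ^10) ≤ 1 := by 
    rw [hδε] at hδ; linarith [hδ, show ε * ℓ^2 * (2^60 * ℓ^8) = ε * (2^60 * ℓ^10) by ring]
  have hl10 : ℓ * 2 ≤ ℓ^10 := by
    have : (2:ℝ)^9 ≤ ℓ^9 := by gcongr
    nlinarith
  have hsmall : ε ≤ 1/(2*(2*ℓ)) := by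
    rw [le_div_iff₀ (by positivity)]
    nlinarith
  have hε1 : ε ≤ 1 := by
    refine hsmall.trans ?_
    rw [div_le_one (by positivity)]; linarith
  have hn : ‖((1 + ε : ℝ) : ℂ) - 1‖ = ε := by
    push_cast; rw [add_sub_cancel_left, Complex.norm_real, Real.norm_of_nonneg hε0.le]
  have key := L_product_ge_one χ₁ χ₂ χ₃ h3 (σ := 1 + ε) (by linarith)
  have hz : ‖riemannZeta ((1 + ε : ℝ) : ℂ)‖ ≤ 2 / ε := by
    refine (norm_riemannZeta_le (by simpa using hε0)).trans ?_
    rw [Complex.norm_real, Real.norm_of_nonneg (by linarith), Complex.ofReal_re]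
    rw [add_sub_cancel_left]; gcongr; linarith
  have hs2 : 1/(2*(2*ℓ)) ≤ 1/(2*ℓ) := by gcongr; linarith
  have hL : ∀ {r : ℕ} [NeZero r] (χ : DirichletCharacter ℂ r), χ ≠ 1 → (r:ℝ) ≤ Real.exp ℓ →
      ‖χ.LFunction 1‖ ≤ δ → ‖χ.LFunction ((1 + ε : ℝ) : ℂ)‖ ≤ 2^6 * (ε * ℓ^2) := by
    intro r _ χ hχ hr hb
    have h := norm_LFunction_sub_le χ hχ hℓ hr (s := ((1 + ε : ℝ) : ℂ)) (by rw [hn]; linarith)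
    rw [hn] at h
    have h' := norm_le_norm_add_norm_sub' (χ.LFunction ((1 + ε : ℝ) : ℂ)) (χ.LFunction 1)
    have : 0 < ε * ℓ^2 := by positivity
    linarith
  have hL1 := hL χ₁ h1' hr₁ hb₁
  have hL2 := hL χ₂ h2' hr₂ hb₂
  have hL3 : ‖χ₃.LFunction ((1 + ε : ℝ) : ℂ)‖ ≤ 2^5 * ℓ := by
    have := norm_LFunction_le χ₃ h3' (ℓ := 2*ℓ) (by linarith) hr₃ (s := ((1 + ε : ℝ) : ℂ)) (by
      rw [hn]; exact hsmall.trans (by gcongr))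
    linarith
  have : (1:ℝ) ≤ (2/ε)^3 * (2^6 * (ε * ℓ^2))^2 * (2^6 * (ε * ℓ^2))^2 * (2^5 * ℓ)^2 := by
    refine key.trans ?_
    gcongr
  have e : (2/ε)^3 * (2^6 * (ε * ℓ^2))^2 * (2^6 * (ε * ℓ^2))^2 * (2^5 * ℓ)^2 
      = 2^37 * (ε * ℓ^10) := by field_simp
  rw [e] at this
  nlinarith

/-- the twisted character `χ₁ * conj χ₂` is non principal if primitive characters differ. -/
lemma exists_twist {r₁ r₂ : ℕ} [NeZero r₁] [NeZero r₂]
    (χ₁ : DirichletCharacter ℂ r₁) (χ₂ : DirichletCharacter ℂ r₂) 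
    (hp₁ : χ₁.IsPrimitive) (hp₂ : χ₂.IsPrimitive)
    (hne : (⟨r₁, χ₁⟩ : Σ r : ℕ, DirichletCharacter ℂ r) ≠ ⟨r₂, χ₂⟩) :
    ∃ χ₃ : DirichletCharacter ℂ (r₁ * r₂), χ₃ ≠ 1 ∧ ∀ n : ℕ, χ₃ n = χ₁ n * conj (χ₂ n) := by
  have : NeZero (r₁ * r₂) := ⟨mul_ne_zero (NeZero.ne _) (NeZero.ne _)⟩
  refine ⟨DirichletCharacter.changeLevel (dvd_mul_right r₁ r₂) χ₁ * 
    (DirichletCharacter.changeLevel (dvd_mul_left r₂ r₁) χ₂)⁻¹, ?_, ?_⟩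
  · intro h
    rw [mul_inv_eq_one] at h
    apply hne
    have hc : r₁ = r₂ := by
      have h1 := DirichletCharacter.conductor_changeLevel χ₁ (dvd_mul_right r₁ r₂)
      have h2 := DirichletCharacter.conductor_changeLevel χ₂ (dvd_mul_left r₂ r₁)
      rw [h, h2] at h1
      rw [DirichletCharacter.isPrimitive_def] at hp₁ hp₂
      rw [← hp₁, ← hp₂, h1]
    subst hc
    congr 1
    exact DirichletCharacter.changeLevel_injective _ h
  · intro n
    have hinv : ∀ a : ZMod r₂, χ₂⁻¹ a = conj (χ₂ a) := fun a => (MulChar.star_apply' χ₂ a).symm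
    rw [← hinv, ← map_inv]
    by_cases hn : IsCoprime (n : ℤ) ((r₁ * r₂ : ℕ) : ℤ)
    · have h1 := DirichletCharacter.changeLevel_eq_cast_of_dvd' χ₁ (dvd_mul_right r₁ r₂) hn
      have h2 := DirichletCharacter.changeLevel_eq_cast_of_dvd' χ₂⁻¹ (dvd_mul_left r₂ r₁) hn
      simp only [Int.cast_natCast] at h1 h2
      rw [MulChar.mul_apply, h1, h2]
    · have h1 := (DirichletCharacter.apply_eq_zero_iff
        (DirichletCharacter.changeLevel (dvd_mul_right r₁ r₂) χ₁ * 
        (DirichletCharacter.changeLevel (dvd_mul_left r₂ r₁) χ₂⁻¹)) n).2 hn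
      simp only [Int.cast_natCast] at h1
      rw [h1]
      symm
      rw [mul_eq_zero]
      by_contra! hcon
      have a1 := (DirichletCharacter.apply_ne_zero_iff χ₁ n).1 (by simpa using hcon.1)
      have a2 := (DirichletCharacter.apply_ne_zero_iff χ₂⁻¹ n).1 (by simpa using hcon.2)
      apply hn
      push_cast
      exact a1.mul_right a2

/-- no bad primitive character of modulus at most `exp ℓ`. -/
def GoodLevel (c ℓ : ℝ) : Prop := ∀ (r : ℕ) [NeZero r] (χ : DirichletCharacter ℂ r), 1 < r → 
  (r:ℝ) ≤ Real.exp ℓ → χ.IsPrimitive → c / ℓ^8 ≤ ‖χ.LFunction 1‖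

lemma ne_one_of_primitive {r : ℕ} (hr : 1 < r) {χ : DirichletCharacter ℂ r} (hp : χ.IsPrimitive) :
    χ ≠ 1 := by
  rintro rfl
  have : NeZero r := ⟨by omega⟩
  rw [DirichletCharacter.isPrimitive_def, DirichletCharacter.conductor_one] at hp
  omega

lemma exists_good_level (ℓ₀ : ℝ) : ∃ ℓ : ℝ, ℓ₀ ≤ ℓ ∧ GoodLevel (1/2^70) ℓ := by
  by_contra! hcon
  unfold GoodLevel at hcon
  push Not at hcon
  set a : ℝ := max ℓ₀ 2 with ha
  have ha0 : ∀ n : ℕ, ℓ₀ ≤ a + n := fun n => by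
    have := le_max_left ℓ₀ 2
    have : (0:ℝ) ≤ n := Nat.cast_nonneg n
    linarith
  choose r hnz χ hr hle hp hL using fun n : ℕ => hcon (a + n) (ha0 n)
  have h2 : ∀ n : ℕ, 2 ≤ a + n := fun n => by
    have := le_max_right ℓ₀ 2
    have : (0:ℝ) ≤ n := Nat.cast_nonneg n
    linarith
  have hstep : ∀ n, (⟨r n, χ n⟩ : Σ r : ℕ, DirichletCharacter ℂ r) = ⟨r (n+1), χ (n+1)⟩ := by
    intro n
    by_contra hne
    obtain ⟨χ₃, h31, h32⟩ := exists_twist (χ n) (χ (n+1)) (hp n) (hp (n+1)) hne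
    have : NeZero (r n * r (n+1)) := ⟨mul_ne_zero (NeZero.ne _) (NeZero.ne _)⟩
    have hl1 : Real.exp (a + n) ≤ Real.exp (a + (n+1 : ℕ)) := by
      apply Real.exp_le_exp.2; push_cast; linarith
    have hpos := h2 n
    refine LFunction_unique_bad_aux (ℓ := a + (n+1:ℕ)) (δ := 1/2^70/(a+n)^8) (h2 _) 
      (by positivity) ?_ (χ n) (χ (n+1)) χ₃ h32 (ne_one_of_primitive (hr n) (hp n)) 
      (ne_one_of_primitive (hr _) (hp _)) h31 ((hle n).trans hl1) (hle (n+1)) ?_ (hL n).le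
      ((hL (n+1)).le.trans ?_)
    · have : (a + (n+1:ℕ)) ≤ 2 * (a+n) := by push_cast; linarith
      calc 1/2^70/(a+n)^8 * (2^60 * (a + (n+1:ℕ))^8) ≤ 1/2^70/(a+n)^8 * (2^60 * (2 * (a+n))^8) := by
            have h3 := h2 (n+1)
            gcongr
        _ ≤ 1 := by
            rw [mul_pow]; field_simp; norm_num
    · push_cast [two_mul, Real.exp_add]
      gcongr
      · exact (hle n).trans hl1 |>.trans (by push_cast [Real.exp_add]; exact le_refl _)
      · exact (hle (n+1)).trans (by push_cast [Real.exp_add]; exact le_refl _)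
    · gcongr; push_cast; linarith
  have hconst : ∀ n, (⟨r n, χ n⟩ : Σ r : ℕ, DirichletCharacter ℂ r) = ⟨r 0, χ 0⟩ := by
    intro n
    induction n with
    | zero => rfl
    | succ n ih => rw [← hstep n, ih]
  have hval : ∀ n : ℕ, ‖(χ 0).LFunction 1‖ ≤ 1/2^70/(a+n)^8 := by
    intro n
    have e : ‖(χ n).LFunction 1‖ = ‖(χ 0).LFunction 1‖ := by
      have h0 := hr 0
      have h0' := hr n
      set F : (Σ r : ℕ, DirichletCharacter ℂ r) → ℝ := fun p => 
        if h : p.1 = 0 then 0 else haveI : NeZero p.1 := ⟨h⟩; ‖p.2.LFunction 1‖ with hF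
      have := congrArg F (hconst n)
      rw [hF] at this
      simp only at this
      rw [dif_neg (by omega), dif_neg (by omega)] at this
      exact this
    rw [← e]; exact (hL n).le
  have hlim : Tendsto (fun n : ℕ => 1/2^70/(a+n)^8) atTop (𝓝 0) := by
    refine Tendsto.div_atTop tendsto_const_nhds ?_
    refine (tendsto_pow_atTop (by norm_num)).comp ?_
    exact tendsto_atTop_add_const_left _ _ tendsto_natCast_atTop_atTop
  have h0 : ‖(χ 0).LFunction 1‖ ≤ 0 := ge_of_tendsto' hlim hval
  exact DirichletCharacter.LFunction_apply_one_ne_zero (ne_one_of_primitive (hr 0) (hp 0)) 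
    (norm_le_zero_iff.1 h0)

end

section

open Filter Topology MeasureTheory Set
open scoped ArithmeticFunction ComplexConjugate

lemma re_one_add_om (ξ LL : ℝ) : (1 + om ξ / LL : ℂ).re = 1 + 1/LL := by
  simp [om_re]

lemma norm_term_om (a : ℕ → ℂ) (ξ LL : ℝ) (n : ℕ) :
    ‖LSeries.term a (1 + om ξ / LL) n‖ = ‖LSeries.term a (1 + 1/LL : ℝ) n‖ := by
  rw [LSeries.norm_term_eq, LSeries.norm_term_eq, re_one_add_om]; simp

lemma continuous_term_om (a : ℕ → ℂ) (LL : ℝ) (n : ℕ) : 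
    Continuous fun ξ : ℝ => LSeries.term a (1 + om ξ / LL) n := by
  rcases eq_or_ne n 0 with rfl | hn
  · simp only [LSeries.term_zero]; fun_prop
  · simp only [LSeries.term_of_ne_zero hn]
    have hn' : (n : ℂ) ≠ 0 := by exact_mod_cast hn
    refine Continuous.div continuous_const ?_ fun ξ => ?_
    · refine Continuous.const_cpow (by fun_prop) (Or.inl hn')
    · simp [Complex.cpow_eq_zero_iff, hn']

lemma term_om (a : ℕ → ℂ) (ξ LL : ℝ) (n : ℕ) :
    LSeries.term a (1 + om ξ / LL) n = 
      a n / n * Complex.exp (-((Real.log n / LL : ℝ) * om ξ)) := by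
  rcases eq_or_ne n 0 with rfl | hn
  · simp
  have hn' : (n : ℂ) ≠ 0 := by exact_mod_cast hn
  rw [LSeries.term_of_ne_zero hn, Complex.cpow_add _ _ hn', Complex.cpow_one,
    Complex.cpow_def_of_ne_zero hn', Complex.exp_neg, div_mul_eq_div_div, div_eq_mul_inv (a n / n)]
  congr 3
  push_cast [Complex.natCast_log]; ring

lemma sum_eq_integral {f : ℝ → ℝ} {φ : ℝ → ℂ} (h : LapRep f φ) {LL : ℝ} 
    (a : ℕ → ℂ) (ha : LSeriesSummable a (1 + 1/LL : ℝ)) :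
    ∑' n : ℕ, a n / n * f (Real.log n / LL) = ∫ ξ, φ ξ * LSeries a (1 + om ξ / LL) := by
  have h1 := hasSum_integral_of_summable_integral_norm (μ := volume)
    (F := fun (n : ℕ) (ξ : ℝ) => φ ξ * LSeries.term a (1 + om ξ / LL) n) ?_ ?_
  · simp only [tsum_mul_left] at h1
    unfold LSeries
    rw [← h1.tsum_eq]
    congr 1; ext n
    simp_rw [term_om]
    rw [h.eq, ← integral_const_mul]
    congr 1; ext ξ; ring
  · intro n
    have hb : ∀ ξ, ‖LSeries.term a (1 + om ξ / LL) n‖ ≤ ‖LSeries.term a (1 + 1/LL : ℝ) n‖ := 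
      fun ξ => (norm_term_om a ξ LL n).le
    exact h.integrable.mul_bdd (continuous_term_om a LL n).aestronglyMeasurable 
      (Eventually.of_forall hb)
  · simp only [norm_mul, norm_term_om, integral_mul_const]
    exact (ha.norm).mul_left _

lemma dslope_approx (J : ℕ) : ∀ (G : ℂ → ℂ) (B ρ : ℝ), 0 < ρ → 0 ≤ B → 
    DifferentiableOn ℂ G (Metric.ball 0 ρ) →
    (∀ z ∈ Metric.ball (0:ℂ) ρ, ‖G z‖ ≤ B) → 
    ∃ c : ℕ → ℂ, (∀ j < J, ‖c j‖ ≤ B * (2/ρ)^j) ∧ 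
      ∀ z ∈ Metric.ball (0:ℂ) ρ, ‖G z - ∑ j ∈ Finset.range J, c j * z^j‖ ≤ B * (2/ρ)^J * ‖z‖^J := by
  induction J with
  | zero =>
    intro G B ρ hρ hB hG hb
    exact ⟨0, by simp, fun z hz => by simpa using hb z hz⟩
  | succ J ih =>
    intro G B ρ hρ hB hG hb
    have h0 : (0:ℂ) ∈ Metric.ball (0:ℂ) ρ := by simpa using hρ
    have hd : DifferentiableOn ℂ (dslope G 0) (Metric.ball 0 ρ) := by
      rw [Complex.differentiableOn_dslope (Metric.ball_mem_nhds 0 hρ)]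
      exact hG
    have hbd : ∀ z ∈ Metric.ball (0:ℂ) ρ, ‖dslope G 0 z‖ ≤ 2 * B / ρ := by
      intro z hz
      refine Complex.norm_dslope_le_div_of_mapsTo_ball hG ?_ hz
      intro w hw
      rw [mem_closedBall_iff_norm]
      refine (norm_sub_le _ _).trans ?_
      linarith [hb w hw, hb 0 h0]
    obtain ⟨c, hc1, hc2⟩ := ih (dslope G 0) (2 * B / ρ) ρ hρ (by positivity) hd hbd
    refine ⟨fun j => Nat.casesOn j (G 0) (fun j => c j), ?_, ?_⟩
    · intro j hj
      rcases j with _ | j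
      · simpa using hb 0 h0
      · refine (hc1 j (by omega)).trans (le_of_eq ?_)
        ring
    · intro z hz
      have e : G z = G 0 + z * dslope G 0 z := by
        have := sub_smul_dslope G 0 z
        simp only [sub_zero, smul_eq_mul] at this
        rw [this]; ring
      rw [Finset.sum_range_succ', e]
      have e2 : G 0 + z * dslope G 0 z - (∑ k ∈ Finset.range J, c k * z ^ (k+1) + G 0 * z^0) 
        = z * (dslope G 0 z - ∑ k ∈ Finset.range J, c k * z ^ k) := by
        rw [mul_sub, Finset.mul_sum]
        have : ∀ k, z * (c k * z^k) = c k * z^(k+1) := fun k => by ring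
        simp only [this]; ring
      change ‖G 0 + z * dslope G 0 z - (∑ k ∈ Finset.range J, c k * z ^ (k+1) + G 0 * z^0)‖ ≤ _
      rw [e2, norm_mul]
      calc _ ≤ ‖z‖ * (2 * B / ρ * (2/ρ)^J * ‖z‖^J) := by
            gcongr; exact hc2 z hz
        _ = _ := by ring

lemma log_le_pow_div {ε : ℝ} (hε : 0 < ε) (n : ℕ) : Real.log n ≤ (n:ℝ)^ε / ε :=
  Real.log_natCast_le_rpow_div n hε

/-- crude bound for `∑ log n / n^(1+1/LL)` -/
lemma sum_log_le {LL : ℝ} (hL : 1 ≤ LL) : 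
    Summable (fun n : ℕ => Real.log n * (n:ℝ)^(-(1 + 1/LL))) ∧ 
    ∑' n : ℕ, Real.log n * (n:ℝ)^(-(1 + 1/LL)) ≤ 8 * LL^2 := by
  have h0 : 0 < LL := by linarith
  have hs : 1 < ((1 + 1/(2*LL) : ℝ) : ℂ).re := by 
    rw [Complex.ofReal_re]
    have : 0 < 1/(2*LL) := by positivity
    linarith
  have hsum : Summable (fun n : ℕ => 1 / (n:ℝ)^(1 + 1/(2*LL))) := by
    refine Real.summable_one_div_nat_rpow.2 (by simpa using hs)
  have hz : ∑' n : ℕ, 1 / (n:ℝ)^(1 + 1/(2*LL)) ≤ 4 * LL := by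
    have h1 := zeta_eq_tsum_one_div_nat_cpow hs
    have h2 : ((∑' n : ℕ, 1 / (n:ℝ)^(1 + 1/(2*LL)) : ℝ) : ℂ) = 
        riemannZeta ((1 + 1/(2*LL) : ℝ) : ℂ) := by
      rw [h1, Complex.ofReal_tsum]
      congr 1; ext n
      rw [Complex.ofReal_div, Complex.ofReal_cpow (by positivity)]; simp
    have h3 := norm_riemannZeta_le hs
    rw [← h2, Complex.norm_real, Complex.ofReal_re, add_sub_cancel_left, Complex.norm_real] at h3
    refine (le_abs_self _).trans (h3.trans ?_)
    rw [Real.norm_of_nonneg (by positivity), div_div_eq_mul_div, div_one, add_mul]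
    have : 1 / (2*LL) * (2*LL) = 1 := by field_simp
    rw [this]; linarith
  have hle : ∀ n : ℕ, Real.log n * (n:ℝ)^(-(1 + 1/LL)) ≤ 2 * LL * (1 / (n:ℝ)^(1 + 1/(2*LL))) := by
    intro n
    rcases Nat.eq_zero_or_pos n with rfl | hn
    · simp; positivity
    have hn0 : (0:ℝ) < n := by exact_mod_cast hn
    have h1 := log_le_pow_div (ε := 1/(2*LL)) (by positivity) n
    calc _ ≤ (n:ℝ)^(1/(2*LL)) / (1/(2*LL)) * (n:ℝ)^(-(1 + 1/LL)) := by gcongr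
      _ = 2 * LL * ((n:ℝ)^(1/(2*LL)) * (n:ℝ)^(-(1 + 1/LL))) := by field_simp
      _ = 2 * LL * (1 / (n:ℝ)^(1 + 1/(2*LL))) := by
        rw [← Real.rpow_add hn0, one_div ((n:ℝ)^(_:ℝ)), ← Real.rpow_neg hn0.le]
        congr 2; field_simp; ring
  have hnn : ∀ n : ℕ, 0 ≤ Real.log n * (n:ℝ)^(-(1 + 1/LL)) := fun n =>
    mul_nonneg (Real.log_natCast_nonneg n) (by positivity)
  have hS := Summable.of_nonneg_of_le hnn hle (hsum.mul_left _)
  refine ⟨hS, ?_⟩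
  refine (hS.tsum_le_tsum hle (hsum.mul_left _)).trans ?_
  rw [tsum_mul_left]
  nlinarith

lemma lseries_bound {LL : ℝ} (hL : 1 ≤ LL) (a : ℕ → ℂ) (ha : ∀ n, ‖a n‖ ≤ Real.log n) (ξ : ℝ) :
    LSeriesSummable a (1 + om ξ / LL) ∧ ‖LSeries a (1 + om ξ / LL)‖ ≤ 8 * LL^2 := by
  obtain ⟨hS, hb⟩ := sum_log_le hL
  have hle : ∀ n : ℕ, ‖LSeries.term a (1 + om ξ / LL) n‖ ≤ Real.log n * (n:ℝ)^(-(1 + 1/LL)) := by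
    intro n
    rcases eq_or_ne n 0 with rfl | hn
    · simp
    rw [LSeries.norm_term_eq, re_one_add_om, if_neg hn, Real.rpow_neg (by positivity), 
      ← div_eq_mul_inv]
    gcongr; exact ha n
  refine ⟨Summable.of_norm_bounded hS hle, ?_⟩
  exact (tsum_of_norm_bounded hS.hasSum hle).trans hb

lemma lseriesSummable_real {LL : ℝ} (hL : 1 ≤ LL) (a : ℕ → ℂ) (ha : ∀ n, ‖a n‖ ≤ Real.log n) :
    LSeriesSummable a (1 + 1/LL : ℝ) := by
  have := (lseries_bound hL a ha 0).1
  simpa [om] using this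

lemma norm_char_lambda_le {r : ℕ} (χ : DirichletCharacter ℂ r) (n : ℕ) : 
    ‖χ n * (Λ n : ℂ)‖ ≤ Real.log n := by
  rw [norm_mul, Complex.norm_real, Real.norm_of_nonneg ArithmeticFunction.vonMangoldt_nonneg]
  calc _ ≤ 1 * Real.log n := by
        gcongr
        · exact χ.norm_le_one _
        · exact ArithmeticFunction.vonMangoldt_le_log
    _ = _ := one_mul _

/-- the smoothed prime character sum -/
noncomputable def chSum (f : ℝ → ℝ) (LL : ℝ) {r : ℕ} (χ : DirichletCharacter ℂ r) : ℂ :=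
  ∑' n : ℕ, χ n * (Λ n : ℂ) / n * f (Real.log n / LL)

lemma small_conductor {f : ℝ → ℝ} {φ : ℝ → ℂ} (h : LapRep f φ) (h0 : ∀ t < 1, f t = 0) (J : ℕ) :
    ∃ K : ℝ, 0 ≤ K ∧ ∀ LL ℓ c ρ : ℝ, 1 ≤ LL → 2 ≤ ℓ → 0 < c → c ≤ 1 → ρ = c / (64 * ℓ^10) → 
      GoodLevel c ℓ →
      ∀ (r : ℕ) [NeZero r] (χ : DirichletCharacter ℂ r), 1 < r → (r:ℝ) ≤ Real.exp ℓ → 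
      χ.IsPrimitive → ‖chSum f LL χ‖ ≤ K * (1/ρ + LL^2) * (2/(ρ * LL))^J := by
  refine ⟨(J + 8) * ∫ ξ, ‖φ ξ‖ * ‖om ξ‖^J, by positivity, ?_⟩
  intro LL ℓ c ρ hLL hℓ hc hc1 hρ hgood r _ χ hr hrl hp
  have hχ := ne_one_of_primitive hr hp
  have hL0 : 0 < LL := by linarith
  have hρ0 : 0 < ρ := by rw [hρ]; positivity
  have hρl : ρ ≤ 1/(2*ℓ) := by
    rw [hρ]
    have : (2:ℝ)^9 ≤ ℓ^9 := by gcongr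
    rw [div_le_div_iff₀ (by positivity) (by positivity)]
    nlinarith [show ℓ^10 = ℓ^9*ℓ by ring]
  have hlow : ∀ z ∈ Metric.ball (0:ℂ) ρ, c / (2 * ℓ^8) ≤ ‖χ.LFunction (1 + z)‖ := by
    intro z hz
    have hz' : ‖z‖ < ρ := by simpa using hz
    have h1 := norm_LFunction_sub_le χ hχ hℓ hrl (s := 1 + z) (by simp at hρl ⊢; linarith)
    rw [add_sub_cancel_left] at h1
    have h2 := hgood r χ hr hrl hp
    have h3 := norm_le_norm_add_norm_sub (χ.LFunction (1+z)) (χ.LFunction 1)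
    have h4 : 32 * ℓ^2 * ‖z‖ ≤ 32 * ℓ^2 * ρ := by gcongr
    have h5 : 32 * ℓ^2 * ρ = c / (2 * ℓ^8) := by rw [hρ]; field_simp; norm_num
    have h6 : c / ℓ^8 = c / (2 * ℓ^8) + c / (2 * ℓ^8) := by field_simp; norm_num
    linarith
  have hcpos : 0 < c / (2 * ℓ^8) := by positivity
  set G : ℂ → ℂ := fun z => - deriv χ.LFunction (1 + z) / χ.LFunction (1 + z) with hG
  have hLd := DirichletCharacter.differentiable_LFunction hχ
  have hGd : DifferentiableOn ℂ G (Metric.ball 0 ρ) := by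
    intro z hz
    refine DifferentiableAt.differentiableWithinAt ?_
    have h1 : DifferentiableAt ℂ (fun z : ℂ => χ.LFunction (1+z)) z := by fun_prop
    have h2 : DifferentiableAt ℂ (fun z : ℂ => deriv χ.LFunction (1+z)) z := by
      have : Differentiable ℂ (deriv χ.LFunction) := hLd.deriv
      fun_prop
    refine h2.neg.div h1 ?_
    rw [← norm_pos_iff]; linarith [hlow z hz]
  have hGb : ∀ z ∈ Metric.ball (0:ℂ) ρ, ‖G z‖ ≤ 1/ρ := by
    intro z hz
    have hz' : ‖z‖ < ρ := by simpa using hz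
    have h1 := norm_deriv_LFunction_le χ hχ hℓ hrl (s := 1 + z) (by simp at hρl ⊢; linarith)
    rw [hG]; simp only [norm_div, norm_neg]
    calc _ ≤ 32 * ℓ^2 / (c / (2 * ℓ^8)) := by
          have := hlow z hz
          gcongr
      _ = 1/ρ := by rw [hρ]; field_simp; norm_num
  obtain ⟨cf, hcf1, hcf2⟩ := dslope_approx J G (1/ρ) ρ hρ0 (by positivity) hGd hGb
  have hrep := sum_eq_integral h (LL := LL) (fun n => χ n * (Λ n : ℂ)) 
    (lseriesSummable_real hLL _ (norm_char_lambda_le χ))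
  have hpoly : ∫ ξ, φ ξ * ∑ j ∈ Finset.range J, cf j * (om ξ / LL)^j = 0 := by
    have : ∀ ξ, φ ξ * ∑ j ∈ Finset.range J, cf j * (om ξ / LL)^j = 
        ∑ j ∈ Finset.range J, (cf j / LL^j) * (φ ξ * om ξ ^ j) := by
      intro ξ; rw [Finset.mul_sum]; refine Finset.sum_congr rfl fun j _ => ?_
      rw [div_pow]; ring
    simp_rw [this]
    rw [integral_finsetSum]
    · refine Finset.sum_eq_zero fun j _ => ?_
      rw [integral_const_mul, h.moment_zero h0, mul_zero]
    · intro j _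
      have := h.integrable_pow_exp j 0
      simp only [Complex.ofReal_zero, zero_mul, neg_zero, Complex.exp_zero, mul_one] at this
      exact this.const_mul _
  have hint1 : Integrable (fun ξ => φ ξ * ∑ j ∈ Finset.range J, cf j * (om ξ / LL)^j) := by
    simp_rw [Finset.mul_sum]
    refine integrable_finsetSum _ fun j _ => ?_
    have := h.integrable_pow_exp j 0
    simp only [Complex.ofReal_zero, zero_mul, neg_zero, Complex.exp_zero, mul_one] at this
    refine (this.const_mul (cf j / LL^j)).congr (Eventually.of_forall fun ξ => ?_)
    simp only; rw [div_pow]; ring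
  set F : ℝ → ℂ := fun ξ => LSeries (fun n => χ n * (Λ n : ℂ)) (1 + om ξ / LL) with hF
  have hFG : ∀ ξ, F ξ = G (om ξ / LL) := by
    intro ξ
    have hs : 1 < (1 + om ξ / LL).re := by
      rw [re_one_add_om]
      have : 0 < 1/LL := by positivity
      linarith
    have h1 := DirichletCharacter.LSeries_twist_vonMangoldt_eq χ hs
    rw [hG]; simp only
    rw [DirichletCharacter.deriv_LFunction_eq_deriv_LSeries χ hs, 
      DirichletCharacter.LFunction_eq_LSeries χ hs, ← h1]
    rfl
  have hFm : Continuous F := by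
    refine continuous_tsum (fun n => continuous_term_om _ LL n) 
      (lseriesSummable_real hLL _ (norm_char_lambda_le χ)).norm (fun n ξ => ?_)
    exact (norm_term_om _ ξ LL n).le
  have hint2 : Integrable (fun ξ => φ ξ * F ξ) := by
    refine h.integrable.mul_bdd (c := 8 * LL^2) hFm.aestronglyMeasurable ?_
    exact Eventually.of_forall fun ξ => (lseries_bound hLL _ (norm_char_lambda_le χ) ξ).2
  have e1 : chSum f LL χ = ∫ ξ, φ ξ * (F ξ - ∑ j ∈ Finset.range J, cf j * (om ξ / LL)^j) := by
    simp_rw [mul_sub]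
    rw [integral_sub hint2 hint1, hpoly, sub_zero, ← hrep]; rfl
  rw [e1]
  have hpt : ∀ ξ, ‖F ξ - ∑ j ∈ Finset.range J, cf j * (om ξ / LL)^j‖ ≤ 
      (J + 8) * (1/ρ + LL^2) * (2/(ρ * LL))^J * ‖om ξ‖^J := by
    intro ξ
    have hn : ‖om ξ / (LL:ℂ)‖ = ‖om ξ‖ / LL := by 
      rw [norm_div, Complex.norm_real, Real.norm_of_nonneg hL0.le]
    have e2 : (2/(ρ * LL))^J * ‖om ξ‖^J = (2/ρ)^J * ‖om ξ / (LL:ℂ)‖^J := by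
      rw [hn, ← mul_pow, ← mul_pow]; congr 1; field_simp
    rw [mul_assoc, e2]
    by_cases hz : om ξ / (LL:ℂ) ∈ Metric.ball (0:ℂ) ρ
    · rw [hFG]
      refine (hcf2 _ hz).trans ?_
      rw [mul_assoc]
      gcongr
      have h1 : 0 < 1/ρ := by positivity
      have h2 : 0 ≤ (J:ℝ) * (1/ρ + LL^2) := by positivity
      nlinarith
    · have hz' : ρ ≤ ‖om ξ / (LL:ℂ)‖ := by simpa using hz
      set x := ‖om ξ / (LL:ℂ)‖ with hx
      have hx1 : 1 ≤ 2/ρ * x := by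
        rw [div_mul_eq_mul_div, le_div_iff₀ hρ0]; linarith
      have hx0 : 1 ≤ (2/ρ)^J * x^J := by rw [← mul_pow]; exact one_le_pow₀ hx1
      refine (norm_sub_le _ _).trans ?_
      have h1 : ‖F ξ‖ ≤ 8 * LL^2 := (lseries_bound hLL _ (norm_char_lambda_le χ) ξ).2
      have h2 : ‖∑ j ∈ Finset.range J, cf j * (om ξ / LL)^j‖ ≤ J * (1/ρ * ((2/ρ)^J * x^J)) := by
        refine (norm_sum_le _ _).trans ?_
        refine (Finset.sum_le_card_nsmul _ _ (1/ρ * ((2/ρ)^J * x^J)) fun j hj => ?_).trans (by simp)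
        have hj' := Finset.mem_range.1 hj
        rw [norm_mul, norm_pow]
        calc _ ≤ 1/ρ * (2/ρ)^j * x^j := by gcongr; exact hcf1 j hj'
          _ = 1/ρ * (2/ρ * x)^j := by rw [mul_pow]; ring
          _ ≤ 1/ρ * (2/ρ * x)^J := by gcongr
          _ = _ := by rw [mul_pow]
      set y := (2/ρ)^J * x^J with hy
      calc _ ≤ 8 * LL^2 * y + J * (1/ρ * y) := by
            have : 8 * LL^2 * 1 ≤ 8 * LL^2 * y := by gcongr
            linarith
        _ ≤ _ := by
            have h3 : 0 ≤ (J:ℝ) * LL^2 * y := by positivity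
            have h4 : 0 ≤ 1/ρ * y := by positivity
            nlinarith
  refine (norm_integral_le_of_norm_le (g := fun ξ => (J + 8) * (1/ρ + LL^2) * (2/(ρ * LL))^J * 
    (‖φ ξ‖ * ‖om ξ‖^J)) ((h.int J).const_mul _) (Eventually.of_forall fun ξ => ?_)).trans 
    (le_of_eq ?_)
  · rw [norm_mul]
    calc _ ≤ ‖φ ξ‖ * ((J + 8) * (1/ρ + LL^2) * (2/(ρ * LL))^J * ‖om ξ‖^J) := by 
          gcongr; exact hpt ξ
      _ = _ := by ring
  · rw [integral_const_mul]; ring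

end

section

open Filter Topology MeasureTheory Set
open scoped ArithmeticFunction ComplexConjugate

lemma abel_identity (a : ℕ → ℂ) (g : ℕ → ℝ) (N : ℕ) :
    ∑ k ∈ Finset.range N, a k * g k = (∑ k ∈ Finset.range N, a k) * g N + 
      ∑ k ∈ Finset.range N, (∑ j ∈ Finset.range (k+1), a j) * ((g k - g (k+1) : ℝ) : ℂ) := by
  induction N with
  | zero => simp
  | succ N ih =>
    have e1 := Finset.sum_range_succ (fun k => (∑ j ∈ Finset.range (k+1), a j) * 
      ((g k - g (k+1) : ℝ) : ℂ)) N
    rw [Finset.sum_range_succ, ih, e1, Finset.sum_range_succ a N, Complex.ofReal_sub (g N)]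
    ring

lemma abel_bound (a : ℕ → ℂ) (g : ℕ → ℝ) (K : ℝ) 
    (hK : ∀ N, ‖∑ k ∈ Finset.range N, a k‖ ≤ K) (N : ℕ) :
    ‖∑ k ∈ Finset.range N, a k * g k‖ ≤ 
      K * (|g N| + ∑ k ∈ Finset.range N, |g k - g (k+1)|) := by
  rw [abel_identity, mul_add, Finset.mul_sum]
  refine (norm_add_le _ _).trans ?_
  gcongr
  · rw [norm_mul, Complex.norm_real, Real.norm_eq_abs]
    gcongr; exact hK N
  · refine (norm_sum_le _ _).trans ?_
    gcongr with k _
    rw [norm_mul, Complex.norm_real, Real.norm_eq_abs]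
    gcongr; exact hK _

lemma norm_sum_Ico_char {r : ℕ} [NeZero r] (χ : DirichletCharacter ℂ r) (hχ : χ ≠ 1) (a N : ℕ) :
    ‖∑ k ∈ Finset.range N, χ ((a + k : ℕ) : ZMod r)‖ ≤ 2 * r := by
  have h := Finset.sum_range_add (fun k : ℕ => χ ((k : ℕ) : ZMod r)) a N
  have h2 : ∑ k ∈ Finset.range N, χ ((a + k : ℕ) : ZMod r) = 
    ∑ k ∈ Finset.range (a + N), χ ((k : ℕ) : ZMod r) - ∑ k ∈ Finset.range a, χ ((k : ℕ) : ZMod r) := by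
    rw [h]; ring
  rw [h2]
  refine (norm_sub_le _ _).trans ?_
  linarith [norm_sum_range_char χ hχ (a+N), norm_sum_range_char χ hχ a]

lemma char_sum_antitone {r : ℕ} [NeZero r] (χ : DirichletCharacter ℂ r) (hχ : χ ≠ 1) (a N : ℕ)
    (g : ℕ → ℝ) (hg : ∀ k, a ≤ k → g (k+1) ≤ g k) (hg0 : ∀ k, 0 ≤ g k) :
    ‖∑ k ∈ Finset.range N, χ ((a + k : ℕ) : ZMod r) * g (a + k)‖ ≤ 2 * r * g a := by
  refine (abel_bound (fun k => χ ((a + k : ℕ) : ZMod r)) (fun k => g (a + k)) (2 * r) 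
    (norm_sum_Ico_char χ hχ a) N).trans (le_of_eq ?_)
  congr 1
  have : ∀ k, |g (a + k) - g (a + (k+1))| = g (a+k) - g (a + (k+1)) := fun k =>
    abs_of_nonneg (sub_nonneg.2 (hg (a+k) (Nat.le_add_right a k)))
  simp only [this]
  rw [Finset.sum_range_sub' (fun k => g (a+k)), abs_of_nonneg (hg0 _)]
  simp

lemma large_sieve {ι : Type*} [DecidableEq ι] (X : Finset ι) (N : Finset ℕ) (w : ℕ → ℝ) 
    (hw : ∀ n ∈ N, 0 < w n)
    (c : ι → ℕ → ℂ) (d o : ℝ) (hd : 0 < d) (ho : 0 ≤ o) 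
    (hdiag : ∀ i ∈ X, ‖∑ n ∈ N, (w n : ℂ) * (c i n * conj (c i n))‖ ≤ d)
    (hoff : ∀ i ∈ X, ∀ j ∈ X, i ≠ j → ‖∑ n ∈ N, (w n : ℂ) * (c i n * conj (c j n))‖ ≤ o)
    (x : ℕ → ℂ) :
    ∑ i ∈ X, ‖∑ n ∈ N, x n * c i n‖^2 ≤ (d + X.card * o) * ∑ n ∈ N, ‖x n‖^2 / w n := by
  set T : ι → ℂ := fun i => ∑ n ∈ N, x n * c i n with hT
  set y : ℕ → ℂ := fun n => ∑ i ∈ X, conj (T i) * c i n with hy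
  set Δ : ℝ := d + X.card * o with hΔ
  have hΔ0 : 0 < Δ := by positivity
  set S : ℝ := ∑ i ∈ X, ‖T i‖^2 with hS
  have h1 : (S : ℂ) = ∑ n ∈ N, x n * y n := by
    rw [hS]
    push_cast
    have e : ∀ i, ((‖T i‖ : ℂ))^2 = ∑ n ∈ N, x n * (conj (T i) * c i n) := by
      intro i
      rw [← Complex.conj_mul' (T i)]
      conv_lhs => rw [hT]
      simp only [Finset.mul_sum]
      refine Finset.sum_congr rfl fun n _ => ?_
      ring
    simp only [e, hy, Finset.mul_sum]
    rw [Finset.sum_comm]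
  have h2 : ∑ n ∈ N, w n * ‖y n‖^2 ≤ Δ * S := by
    have e : ((∑ n ∈ N, w n * ‖y n‖^2 : ℝ) : ℂ) = 
        ∑ i ∈ X, ∑ j ∈ X, conj (T i) * T j * ∑ n ∈ N, (w n : ℂ) * (c i n * conj (c j n)) := by
      push_cast
      have e1 : ∀ n, (w n : ℂ) * ((‖y n‖ : ℂ))^2 = 
          ∑ i ∈ X, ∑ j ∈ X, conj (T i) * T j * ((w n : ℂ) * (c i n * conj (c j n))) := by
        intro n
        rw [← Complex.mul_conj' (y n), hy]
        simp only [map_sum, map_mul, Complex.conj_conj]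
        rw [Finset.sum_mul_sum, Finset.mul_sum]
        refine Finset.sum_congr rfl fun i _ => ?_
        rw [Finset.mul_sum]
        refine Finset.sum_congr rfl fun j _ => ?_
        ring
      simp only [e1, Finset.mul_sum]
      rw [Finset.sum_comm]
      refine Finset.sum_congr rfl fun i _ => ?_
      rw [Finset.sum_comm]
    have hnn : 0 ≤ ∑ n ∈ N, w n * ‖y n‖^2 := 
      Finset.sum_nonneg fun n hn => mul_nonneg (hw n hn).le (by positivity)
    have e2 : ∑ n ∈ N, w n * ‖y n‖^2 = ‖((∑ n ∈ N, w n * ‖y n‖^2 : ℝ) : ℂ)‖ := by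
      rw [Complex.norm_real, Real.norm_of_nonneg hnn]
    rw [e2, e]
    calc _ ≤ ∑ i ∈ X, ∑ j ∈ X, (‖T i‖ * ‖T j‖ * o + if i = j then ‖T i‖^2 * d else 0) := by
          refine (norm_sum_le _ _).trans (Finset.sum_le_sum fun i hi => ?_)
          refine (norm_sum_le _ _).trans (Finset.sum_le_sum fun j hj => ?_)
          rw [norm_mul, norm_mul, RCLike.norm_conj]
          split_ifs with hij
          · subst hij
            have h3 := hdiag i hi
            have h4 : 0 ≤ ‖T i‖ * ‖T i‖ * o := by positivity
            have h5 : ‖T i‖ * ‖T i‖ * ‖∑ n ∈ N, (w n : ℂ) * (c i n * conj (c i n))‖ ≤ 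
              ‖T i‖ * ‖T i‖ * d := by gcongr
            nlinarith
          · rw [add_zero]
            gcongr
            exact hoff i hi j hj hij
      _ = o * (∑ i ∈ X, ‖T i‖)^2 + d * S := by
          simp only [Finset.sum_add_distrib, Finset.sum_ite_eq]
          congr 1
          · rw [sq, Finset.sum_mul_sum, Finset.mul_sum]
            refine Finset.sum_congr rfl fun i _ => ?_
            rw [Finset.mul_sum]
            refine Finset.sum_congr rfl fun j _ => by ring
          · rw [hS, Finset.mul_sum]
            refine Finset.sum_congr rfl fun i hi => ?_
            rw [if_pos hi]; ring
      _ ≤ o * (X.card * S) + d * S := by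
          gcongr
          exact sq_sum_le_card_mul_sum_sq
      _ = Δ * S := by rw [hΔ]; ring
  have hS0 : 0 ≤ S := by positivity
  have h3 : S ≤ ∑ n ∈ N, ‖x n‖ * ‖y n‖ := by
    have : S = ‖(S : ℂ)‖ := by rw [Complex.norm_real, Real.norm_of_nonneg hS0]
    rw [this, h1]
    refine (norm_sum_le _ _).trans (le_of_eq ?_)
    simp only [norm_mul]
  have h4 : ∑ n ∈ N, ‖x n‖ * ‖y n‖ ≤ 
      ∑ n ∈ N, (Δ / 2 * (‖x n‖^2 / w n) + 1 / (2 * Δ) * (w n * ‖y n‖^2)) := by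
    refine Finset.sum_le_sum fun n hn => ?_
    have hw0 := hw n hn
    have : Δ / 2 * (‖x n‖^2 / w n) + 1 / (2 * Δ) * (w n * ‖y n‖^2) - ‖x n‖ * ‖y n‖
      = (Δ * ‖x n‖ - w n * ‖y n‖)^2 / (2 * Δ * w n) := by
      field_simp; ring
    have h5 : 0 ≤ (Δ * ‖x n‖ - w n * ‖y n‖)^2 / (2 * Δ * w n) := by positivity
    linarith
  rw [Finset.sum_add_distrib, ← Finset.mul_sum, ← Finset.mul_sum] at h4
  have h5 : 1 / (2 * Δ) * ∑ n ∈ N, w n * ‖y n‖^2 ≤ S / 2 := by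
    calc _ ≤ 1 / (2 * Δ) * (Δ * S) := by gcongr
      _ = _ := by field_simp
  nlinarith

end

section

open Filter Topology MeasureTheory Set
open scoped ArithmeticFunction ComplexConjugate

lemma LapRep.shift {f : ℝ → ℝ} {φ : ℝ → ℂ} (h : LapRep f φ) (t₀ : ℝ) :
    LapRep (fun t => f (t + t₀)) (fun ξ => φ ξ * Complex.exp (-(t₀ * om ξ))) where
  cont := by have := h.cont; fun_prop
  int N := by
    refine ((h.int N).const_mul (Real.exp (-t₀))).congr (Eventually.of_forall fun ξ => ?_)
    simp only [norm_mul, Complex.norm_exp]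
    simp [om_re]; ring
  eq t := by
    rw [h.eq]
    congr 1; ext ξ
    rw [mul_assoc, ← Complex.exp_add]
    congr 2; push_cast; ring

lemma continuous_lseries_om (a : ℕ → ℂ) {LL : ℝ} (ha : LSeriesSummable a (1 + 1/LL : ℝ)) :
    Continuous fun ξ : ℝ => LSeries a (1 + om ξ / LL) := by
  unfold LSeries
  exact continuous_tsum (fun n => continuous_term_om a LL n) ha.norm
    (fun n ξ => (norm_term_om a ξ LL n).le)

lemma summable_om (a : ℕ → ℂ) {LL : ℝ} (ha : LSeriesSummable a (1 + 1/LL : ℝ)) (ξ : ℝ) :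
    LSeriesSummable a (1 + om ξ / LL) := by
  refine Summable.of_norm ?_
  simp only [norm_term_om]
  exact ha.norm

lemma norm_lseries_om_le (a : ℕ → ℂ) {LL : ℝ} (ha : LSeriesSummable a (1 + 1/LL : ℝ)) (ξ : ℝ) :
    ‖LSeries a (1 + om ξ / LL)‖ ≤ ∑' n, ‖LSeries.term a (1 + 1/LL : ℝ) n‖ := by
  refine tsum_of_norm_bounded ha.norm.hasSum fun n => (norm_term_om a ξ LL n).le

lemma integrable_phi_lseries {f : ℝ → ℝ} {φ : ℝ → ℂ} (h : LapRep f φ) {LL : ℝ} 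
    (a : ℕ → ℂ) (ha : LSeriesSummable a (1 + 1/LL : ℝ)) :
    Integrable fun ξ => φ ξ * LSeries a (1 + om ξ / LL) :=
  h.integrable.mul_bdd (continuous_lseries_om a ha).aestronglyMeasurable 
    (Eventually.of_forall (norm_lseries_om_le a ha))

lemma integrable_phi_lseries2 {f : ℝ → ℝ} {φ : ℝ → ℂ} (h : LapRep f φ) {LL : ℝ} 
    (a b : ℕ → ℂ) (ha : LSeriesSummable a (1 + 1/LL : ℝ)) (hb : LSeriesSummable b (1 + 1/LL : ℝ)) :
    Integrable fun ξ => φ ξ * LSeries a (1 + om ξ / LL) * LSeries b (1 + om ξ / LL) :=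
  (integrable_phi_lseries h a ha).mul_bdd (continuous_lseries_om b hb).aestronglyMeasurable 
    (Eventually.of_forall (norm_lseries_om_le b hb))

/-- pointwise variation bound for type I sums -/
lemma type_one_var {f : ℝ → ℝ} {K LL : ℝ} (hK : 0 ≤ K) (hLL : 1 ≤ LL)
    (h0 : ∀ t < 1, f t = 0) (h2 : ∀ t, 2 < t → f t = 0) (h1 : ∀ t, |f t| ≤ 1) 
    (hlip : ∀ s t, |f s - f t| ≤ K * |s - t|) (w : ℕ → ℝ) 
    (hw : ∀ n, |w n| ≤ 1 + Real.log n) (hw' : ∀ n, 1 ≤ n → |w n - w (n+1)| ≤ 1 / n) 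
    (m : ℕ) (hm : 1 ≤ m) (n : ℕ) (hn : 1 ≤ n) :
    |w n / n * f (Real.log n / LL + Real.log m / LL) - 
      w (n+1) / (n+1 : ℕ) * f (Real.log (n+1 : ℕ) / LL + Real.log m / LL)| ≤
      (2 * (1 + K) * (3 + 2 * LL) * (m * Real.exp (-LL))) * (1 / n) := by
  have hn0 : (0:ℝ) < n := by exact_mod_cast hn
  have hm0 : (0:ℝ) < m := by exact_mod_cast hm
  have hL0 : 0 < LL := by linarith
  have hlogm : 0 ≤ Real.log m := Real.log_natCast_nonneg m
  have hnon : 0 ≤ (2 * (1 + K) * (3 + 2 * LL) * (m * Real.exp (-LL))) * (1 / n) := by positivity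
  have hmono : Real.log n ≤ Real.log (n+1 : ℕ) := 
    Real.log_le_log hn0 (by push_cast; linarith)
  by_cases c1 : Real.log (n+1 : ℕ) / LL + Real.log m / LL < 1
  · rw [h0 _ c1, h0 (Real.log n / LL + Real.log m / LL), mul_zero, mul_zero, sub_zero, abs_zero]
    · exact hnon
    · refine lt_of_le_of_lt ?_ c1; gcongr
  by_cases c2 : 2 < Real.log n / LL + Real.log m / LL
  · rw [h2 _ c2, h2 (Real.log (n+1 : ℕ) / LL + Real.log m / LL), mul_zero, mul_zero, sub_zero, abs_zero]
    · exact hnon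
    · refine lt_of_lt_of_le c2 ?_; gcongr
  push Not at c1 c2
  have hlogn : Real.log n ≤ 2 * LL := by
    rw [← add_div, div_le_iff₀ hL0] at c2; linarith
  have hbig : Real.exp LL ≤ 2 * n * m := by
    rw [← add_div, one_le_div hL0, ← Real.log_mul (by positivity) (by positivity)] at c1
    have := (Real.le_log_iff_exp_le (by positivity)).1 c1
    push_cast at this
    have hn1 : (1:ℝ) ≤ n := by exact_mod_cast hn
    nlinarith
  have hinv : 1 / (n:ℝ) ≤ 2 * (m * Real.exp (-LL)) := by
    rw [Real.exp_neg, div_le_iff₀ hn0]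
    have := Real.exp_pos LL
    rw [← div_eq_mul_inv, mul_div_assoc', div_mul_eq_mul_div, le_div_iff₀ this]
    linarith
  have hdlog : Real.log (n+1 : ℕ) - Real.log n ≤ 1 / n := by
    rw [← Real.log_div (by positivity) (by positivity)]
    refine (Real.log_le_sub_one_of_pos (by positivity)).trans (le_of_eq ?_)
    push_cast; field_simp; ring
  have hdlog0 : Real.log (n+1 : ℕ) ≤ Real.log n + 1 := by
    have : 1 / (n:ℝ) ≤ 1 := by
      rw [div_le_one hn0]; exact_mod_cast hn
    linarith
  set F := f (Real.log n / LL + Real.log m / LL)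
  set F' := f (Real.log (n+1 : ℕ) / LL + Real.log m / LL)
  have hF : |F| ≤ 1 := h1 _
  have hFF : |F - F'| ≤ K * (1 / n) := by
    refine (hlip _ _).trans ?_
    gcongr
    rw [add_sub_add_right_eq_sub, ← sub_div, abs_div, abs_of_pos hL0, abs_sub_comm, 
      abs_of_nonneg (by linarith)]
    refine (div_le_self (by linarith) hLL).trans hdlog
  have e : w n / n * F - w (n+1) / (n+1 : ℕ) * F' = 
     (w n * (1 / (n * (n+1))) + (w n - w (n+1)) / (n+1)) * F + w (n+1) / (n+1) * (F - F') := by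
    push_cast; field_simp; ring
  have b1 : |w n| ≤ 1 + 2 * LL := by linarith [hw n]
  have b2 : |w (n+1)| ≤ 2 + 2 * LL := by linarith [hw (n+1)]
  have hq : 1 / ((n:ℝ)+1) ≤ 1 / n := by gcongr; linarith
  have a1 : |w n * (1 / (n * (n+1)))| ≤ (1 + 2 * LL) * (1/n * (1/n)) := by
    rw [abs_mul, abs_of_pos (by positivity : (0:ℝ) < 1 / (n * (n+1)))]
    have : 1 / ((n:ℝ) * (n+1)) ≤ 1/n * (1/n) := by
      rw [one_div_mul_one_div]; gcongr; linarith
    gcongr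
  have a2 : |(w n - w (n+1)) / (n+1)| ≤ 1/n * (1/n) := by
    rw [abs_div, abs_of_pos (by positivity : (0:ℝ) < n+1), div_eq_mul_one_div]
    gcongr; exact hw' n hn
  have a3 : |w (n+1) / (n+1) * (F - F')| ≤ (2 + 2 * LL) * (1/n) * (K * (1/n)) := by
    rw [abs_mul, abs_div, abs_of_pos (by positivity : (0:ℝ) < n+1), div_eq_mul_one_div]
    gcongr
  rw [e]
  calc _ ≤ ((1 + 2 * LL) * (1/n * (1/n)) + 1/n * (1/n)) * 1 + (2 + 2 * LL) * (1/n) * (K * (1/n)) := by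
        refine (abs_add_le _ _).trans (add_le_add ?_ a3)
        rw [abs_mul]
        gcongr
        exact (abs_add_le _ _).trans (add_le_add a1 a2)
    _ = (1 + K) * (2 + 2 * LL) * (1/n) * (1/n) := by ring
    _ ≤ (1 + K) * (3 + 2 * LL) * (2 * (m * Real.exp (-LL))) * (1/n) := by gcongr; linarith
    _ = _ := by ring

lemma type_one_inner {f : ℝ → ℝ} {K LL : ℝ} (hK : 0 ≤ K) (hLL : 1 ≤ LL)
    (h0 : ∀ t < 1, f t = 0) (h2 : ∀ t, 2 < t → f t = 0) (h1 : ∀ t, |f t| ≤ 1) 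
    (hlip : ∀ s t, |f s - f t| ≤ K * |s - t|) (w : ℕ → ℝ) 
    (hw : ∀ n, |w n| ≤ 1 + Real.log n) (hw' : ∀ n, 1 ≤ n → |w n - w (n+1)| ≤ 1 / n) 
    (m : ℕ) (hm : 1 ≤ m) (hmL : (m:ℝ) < Real.exp LL) {r : ℕ} [NeZero r] 
    (χ : DirichletCharacter ℂ r) (hχ : χ ≠ 1) :
    ‖∑' n : ℕ, χ n * w n / n * f (Real.log n / LL + Real.log m / LL)‖ ≤ 
      r * (2 * (1 + K) * (3 + 2 * LL)^2 * (m * Real.exp (-LL))) := by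
  have hL0 : 0 < LL := by linarith
  have hm0 : (0:ℝ) < m := by exact_mod_cast hm
  have hlogm : 0 ≤ Real.log m := Real.log_natCast_nonneg m
  set g : ℕ → ℝ := fun n => w n / n * f (Real.log n / LL + Real.log m / LL) with hg
  set N : ℕ := ⌊Real.exp (2 * LL)⌋₊ + 1 with hN
  have hgN : ∀ n, N ≤ n → g n = 0 := by
    intro n hn
    have : Real.exp (2 * LL) < n := (Nat.lt_floor_add_one _).trans_le (by exact_mod_cast hn)
    have hn0 : (0:ℝ) < n := (Real.exp_pos _).trans this
    have h3 := (Real.lt_log_iff_exp_lt hn0).2 this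
    simp only [hg]
    rw [h2, mul_zero]
    rw [← add_div, lt_div_iff₀ hL0]; linarith
  have e : ∑' n : ℕ, χ n * w n / n * f (Real.log n / LL + Real.log m / LL) = 
      ∑ n ∈ Finset.range N, χ n * g n := by
    rw [tsum_eq_sum (s := Finset.range N)]
    · refine Finset.sum_congr rfl fun n _ => ?_
      simp only [hg]; push_cast; ring
    · intro n hn
      have := hgN n (by simpa using hn)
      have h3 : χ n * w n / n * f (Real.log n / LL + Real.log m / LL) = χ n * g n := by 
        simp only [hg]; push_cast; ring
      rw [h3, this]; simp
  rw [e]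
  refine (abel_bound (fun k : ℕ => χ k) g r (norm_sum_range_char χ hχ) N).trans ?_
  have hlm : Real.log m / LL < 1 := by
    rw [div_lt_one hL0]; exact (Real.log_lt_iff_lt_exp hm0).2 hmL
  gcongr
  rw [hgN N le_rfl, abs_zero, zero_add, hN, Finset.sum_range_succ']
  have g0 : g 0 = 0 := by simp [hg]
  have g1 : g (0+1) = 0 := by
    simp only [hg]
    rw [h0, mul_zero]
    simpa using hlm
  rw [g0, g1, sub_zero, abs_zero, add_zero]
  calc _ ≤ ∑ k ∈ Finset.range ⌊Real.exp (2 * LL)⌋₊, 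
        (2 * (1 + K) * (3 + 2 * LL) * (m * Real.exp (-LL))) * (1 / (k+1 : ℕ)) := by
        refine Finset.sum_le_sum fun k _ => ?_
        exact type_one_var hK hLL h0 h2 h1 hlip w hw hw' m hm (k+1) (by omega)
    _ ≤ (2 * (1 + K) * (3 + 2 * LL) * (m * Real.exp (-LL))) * (3 + 2 * LL) := by
        rw [← Finset.mul_sum]
        gcongr
        have := harmonic_floor_le_one_add_log (Real.exp (2 * LL)) (Real.one_le_exp (by positivity))
        rw [Real.log_exp, harmonic] at this
        push_cast at this ⊢
        simp only [one_div]
        linarith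
    _ = _ := by ring

end

section

open Filter Topology MeasureTheory Set
open scoped ArithmeticFunction ComplexConjugate

lemma type_one {f : ℝ → ℝ} {φ : ℝ → ℂ} (h : LapRep f φ) {K LL : ℝ} (hK : 0 ≤ K) (hLL : 1 ≤ LL)
    (h0 : ∀ t < 1, f t = 0) (h2 : ∀ t, 2 < t → f t = 0) (h1 : ∀ t, |f t| ≤ 1) 
    (hlip : ∀ s t, |f s - f t| ≤ K * |s - t|) (w : ℕ → ℝ) 
    (hw : ∀ n, |w n| ≤ 1 + Real.log n) (hw' : ∀ n, 1 ≤ n → |w n - w (n+1)| ≤ 1 / n) 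
    {r : ℕ} [NeZero r] (χ : DirichletCharacter ℂ r) (hχ : χ ≠ 1) 
    (hsum : LSeriesSummable (fun n : ℕ => χ n * (w n : ℂ)) (1 + 1/LL : ℝ))
    (Y : ℕ) (hY : (Y:ℝ) ≤ Real.exp LL) (c : ℕ → ℂ) (hc : ∀ m, ‖c m‖ ≤ m) 
    (hcY : ∀ m, Y ≤ m → c m = 0) :
    ‖∫ ξ, φ ξ * LSeries c (1 + om ξ / LL) * LSeries (fun n : ℕ => χ n * (w n : ℂ)) (1 + om ξ / LL)‖ ≤
      r * (2 * (1 + K) * (3 + 2 * LL)^2 * (Y^2 * Real.exp (-LL))) := by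
  have e1 : ∀ ξ, LSeries c (1 + om ξ / LL) = 
      ∑ m ∈ Finset.range Y, c m / m * Complex.exp (-((Real.log m / LL : ℝ) * om ξ)) := by
    intro ξ
    unfold LSeries
    rw [tsum_eq_sum (s := Finset.range Y)]
    · simp only [term_om]
    · intro m hm
      rw [term_om, hcY m (by simpa using hm)]; simp
  have e2 : ∀ ξ, φ ξ * LSeries c (1 + om ξ / LL) * LSeries (fun n : ℕ => χ n * (w n : ℂ)) (1 + om ξ / LL) =
      ∑ m ∈ Finset.range Y, c m / m * (φ ξ * Complex.exp (-((Real.log m / LL : ℝ) * om ξ)) * 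
        LSeries (fun n : ℕ => χ n * (w n : ℂ)) (1 + om ξ / LL)) := by
    intro ξ
    rw [e1, Finset.mul_sum, Finset.sum_mul]
    refine Finset.sum_congr rfl fun m _ => by ring
  simp only [e2]
  rw [integral_finsetSum]
  swap
  · intro m _
    exact (integrable_phi_lseries (h.shift (Real.log m / LL)) _ hsum).const_mul _
  simp only [integral_const_mul]
  have e3 : ∀ m : ℕ, ∫ ξ, φ ξ * Complex.exp (-((Real.log m / LL : ℝ) * om ξ)) * 
        LSeries (fun n : ℕ => χ n * (w n : ℂ)) (1 + om ξ / LL) = 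
        ∑' n : ℕ, χ n * w n / n * f (Real.log n / LL + Real.log m / LL) := fun m =>
    (sum_eq_integral (h.shift (Real.log m / LL)) _ hsum).symm
  simp only [e3]
  calc _ ≤ ∑ m ∈ Finset.range Y, 1 * (r * (2 * (1 + K) * (3 + 2 * LL)^2 * (Y * Real.exp (-LL)))) := by
        refine (norm_sum_le _ _).trans (Finset.sum_le_sum fun m hm => ?_)
        rw [norm_mul]
        rcases Nat.eq_zero_or_pos m with rfl | hm0
        · simp; positivity
        have hmY : (m:ℝ) < Y := by exact_mod_cast Finset.mem_range.1 hm
        have hm0' : (0:ℝ) < m := by exact_mod_cast hm0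
        gcongr
        · rw [norm_div, Complex.norm_natCast, div_le_one hm0']; exact hc m
        · refine (type_one_inner hK hLL h0 h2 h1 hlip w hw hw' m hm0 (by linarith) χ hχ).trans ?_
          gcongr
    _ = _ := by
        rw [Finset.sum_const, Finset.card_range, nsmul_eq_mul]; ring

/-- crude bound for the zeta sum. -/
lemma sum_zeta_le {LL : ℝ} (hL : 1 ≤ LL) : 
    Summable (fun n : ℕ => (n:ℝ)^(-(1 + 1/LL))) ∧ ∑' n : ℕ, (n:ℝ)^(-(1 + 1/LL)) ≤ 2 * LL := by
  have h0 : 0 < LL := by linarith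
  have hs : 1 < ((1 + 1/LL : ℝ) : ℂ).re := by 
    rw [Complex.ofReal_re]
    have : 0 < 1/LL := by positivity
    linarith
  have hsum : Summable (fun n : ℕ => (n:ℝ)^(-(1 + 1/LL))) := by
    refine Real.summable_nat_rpow.2 ?_
    rw [Complex.ofReal_re] at hs; linarith
  refine ⟨hsum, ?_⟩
  have h1 := zeta_eq_tsum_one_div_nat_cpow hs
  have h2 : ((∑' n : ℕ, (n:ℝ)^(-(1 + 1/LL)) : ℝ) : ℂ) = riemannZeta ((1 + 1/LL : ℝ) : ℂ) := by
    rw [h1, Complex.ofReal_tsum]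
    congr 1; ext n
    rw [Complex.ofReal_cpow (by positivity), Complex.ofReal_neg, Complex.cpow_neg, one_div]
    simp
  have h3 := norm_riemannZeta_le hs
  rw [← h2, Complex.norm_real, Complex.ofReal_re, add_sub_cancel_left, Complex.norm_real] at h3
  refine (le_abs_self _).trans (h3.trans ?_)
  rw [Real.norm_of_nonneg (by positivity), div_div_eq_mul_div, div_one, add_mul]
  have : 1 / LL * LL = 1 := by field_simp
  rw [this]; linarith

lemma sum_log_sq_le {LL : ℝ} (hL : 1 ≤ LL) : 
    Summable (fun n : ℕ => Real.log n ^ 2 * (n:ℝ)^(-(1 + 1/LL))) ∧ 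
    ∑' n : ℕ, Real.log n ^ 2 * (n:ℝ)^(-(1 + 1/LL)) ≤ 64 * LL^3 := by
  have h0 : 0 < LL := by linarith
  obtain ⟨hS, hb⟩ := sum_zeta_le (LL := 2 * LL) (by linarith)
  have hle : ∀ n : ℕ, Real.log n ^ 2 * (n:ℝ)^(-(1 + 1/LL)) ≤ 
      16 * LL^2 * (n:ℝ)^(-(1 + 1/(2*LL))) := by
    intro n
    rcases Nat.eq_zero_or_pos n with rfl | hn
    · simp; positivity
    have hn0 : (0:ℝ) < n := by exact_mod_cast hn
    have h1 := log_le_pow_div (ε := 1/(4*LL)) (by positivity) n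
    have hlog := Real.log_natCast_nonneg n
    calc _ ≤ ((n:ℝ)^(1/(4*LL)) / (1/(4*LL)))^2 * (n:ℝ)^(-(1 + 1/LL)) := by gcongr
      _ = 16 * LL^2 * ((n:ℝ)^(1/(4*LL)) * (n:ℝ)^(1/(4*LL)) * (n:ℝ)^(-(1 + 1/LL))) := by 
        field_simp; ring
      _ = 16 * LL^2 * (n:ℝ)^(-(1 + 1/(2*LL))) := by
        rw [← Real.rpow_add hn0, ← Real.rpow_add hn0]
        congr 2; field_simp; ring
  have hnn : ∀ n : ℕ, 0 ≤ Real.log n ^ 2 * (n:ℝ)^(-(1 + 1/LL)) := fun n => by positivity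
  have hS' := Summable.of_nonneg_of_le hnn hle (hS.mul_left _)
  refine ⟨hS', ?_⟩
  refine (hS'.tsum_le_tsum hle (hS.mul_left _)).trans ?_
  rw [tsum_mul_left]
  calc _ ≤ 16 * LL^2 * (2 * (2 * LL)) := by gcongr
    _ = _ := by ring

lemma type_two {ι : Type*} [DecidableEq ι] (X : Finset ι) (c : ι → ℕ → ℂ) (hc : ∀ i n, ‖c i n‖ ≤ 1)
    {LL o : ℝ} (hLL : 1 ≤ LL) (a : ℕ) (ha : 1 ≤ a) (ho : 0 ≤ o)
    (hoff : ∀ i ∈ X, ∀ j ∈ X, i ≠ j → ∀ M, 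
      ‖∑ k ∈ Finset.range M, (c i (a+k) * conj (c j (a+k))) * (((a+k : ℕ):ℝ)^(-(1+1/LL)) : ℝ)‖ ≤ o)
    (b : ℕ → ℂ) (hb : ∀ n < a, b n = 0) (Z : ℝ) 
    (hZ : Summable fun n : ℕ => ‖b n‖^2 * (n:ℝ)^(-(1+1/LL)))
    (hZ' : ∑' n : ℕ, ‖b n‖^2 * (n:ℝ)^(-(1+1/LL)) ≤ Z)
    (hsum : ∀ i ∈ X, LSeriesSummable (fun n => c i n * b n) (1 + 1/LL : ℝ)) (ξ : ℝ) :
    ∑ i ∈ X, ‖LSeries (fun n => c i n * b n) (1 + om ξ / LL)‖^2 ≤ (2 * LL + X.card * o) * Z := by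
  have hL0 : 0 < LL := by linarith
  obtain ⟨hS, hb1⟩ := sum_zeta_le hLL
  have hlim : Tendsto (fun M : ℕ => ∑ i ∈ X, 
      ‖∑ n ∈ Finset.range (M + a), LSeries.term (fun n => c i n * b n) (1 + om ξ / LL) n‖^2) atTop 
      (𝓝 (∑ i ∈ X, ‖LSeries (fun n => c i n * b n) (1 + om ξ / LL)‖^2)) := by
    refine tendsto_finsetSum _ fun i hi => ?_
    refine Tendsto.pow (Tendsto.norm ?_) 2
    have := (summable_om _ (hsum i hi) ξ).hasSum.tendsto_sum_nat
    exact (tendsto_add_atTop_iff_nat a).2 this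
  refine le_of_tendsto hlim (Eventually.of_forall fun M => ?_)
  set x : ℕ → ℂ := fun n => b n / (n:ℂ)^(1 + om ξ / LL) with hx
  have e1 : ∀ i, ∑ n ∈ Finset.range (M + a), LSeries.term (fun n => c i n * b n) (1 + om ξ / LL) n = 
      ∑ n ∈ Finset.Ico a (a + M), x n * c i n := by
    intro i
    rw [add_comm M a, Finset.range_eq_Ico, ← Finset.sum_Ico_consecutive _ (Nat.zero_le a) (Nat.le_add_right a M)]
    rw [Finset.sum_eq_zero, zero_add]
    · refine Finset.sum_congr rfl fun n hn => ?_
      have : n ≠ 0 := by have := (Finset.mem_Ico.1 hn).1; omega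
      rw [LSeries.term_of_ne_zero this, hx]; ring
    · intro n hn
      rw [LSeries.term_def]
      simp [hb n (Finset.mem_Ico.1 hn).2]
  simp only [e1]
  have hpos : ∀ n ∈ Finset.Ico a (a+M), (0:ℝ) < n := fun n hn => by
    have := (Finset.mem_Ico.1 hn).1
    exact_mod_cast (by omega : 0 < n)
  refine (large_sieve X (Finset.Ico a (a+M)) (fun n => (n:ℝ)^(-(1+1/LL))) 
    (fun n hn => Real.rpow_pos_of_pos (hpos n hn) _) c (2 * LL) o (by positivity) ho ?_ ?_ x).trans ?_
  · intro i _
    refine (norm_sum_le _ _).trans (le_trans ?_ hb1)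
    refine le_trans (Finset.sum_le_sum (g := fun n : ℕ => (n:ℝ)^(-(1+1/LL))) fun n hn => ?_) 
      (hS.sum_le_tsum _ fun n _ => by positivity)
    rw [norm_mul, norm_mul, Complex.norm_real, RCLike.norm_conj, Real.norm_of_nonneg (by positivity)]
    have := hc i n
    have h3 : ‖c i n‖ * ‖c i n‖ ≤ 1 := by nlinarith [norm_nonneg (c i n)]
    nlinarith [Real.rpow_nonneg (hpos n hn).le (-(1+1/LL))]
  · intro i hi j hj hij
    refine le_trans (le_of_eq ?_) (hoff i hi j hj hij M)
    rw [Finset.sum_Ico_eq_sum_range, Nat.add_sub_cancel_left]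
    congr 1
    refine Finset.sum_congr rfl fun k _ => by ring
  · gcongr
    refine le_trans ?_ hZ'
    refine le_trans (le_of_eq ?_) (hZ.sum_le_tsum (Finset.Ico a (a+M)) fun n _ => by positivity)
    refine Finset.sum_congr rfl fun n hn => ?_
    have hn0 := hpos n hn
    simp only [hx]
    rw [norm_div, Complex.norm_natCast_cpow_of_pos (by exact_mod_cast hn0), re_one_add_om, 
      Real.rpow_neg hn0.le]
    have := Real.rpow_pos_of_pos hn0 (1+1/LL)
    field_simp

end

section

open Filter Topology MeasureTheory Set
open scoped ArithmeticFunction ComplexConjugate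

lemma one_conv_one (n : ℕ) : (LSeries.convolution (1 : ℕ → ℂ) 1) n = n.divisors.card := by
  rw [LSeries.convolution_def]
  simp only [Pi.one_apply, mul_one, Finset.sum_const, nsmul_eq_mul]
  rw [← Nat.map_div_right_divisors, Finset.card_map]

lemma card_divisors_mul_le (a b : ℕ) : (a * b).divisors.card ≤ a.divisors.card * b.divisors.card := by
  rw [Nat.divisors_mul]
  exact Finset.card_mul_le

lemma sum_tau_sq_le {LL : ℝ} (hL : 1 ≤ LL) : 
    Summable (fun n : ℕ => (n.divisors.card : ℝ) ^ 2 * (n:ℝ)^(-(1 + 1/LL))) ∧ 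
    ∑' n : ℕ, (n.divisors.card : ℝ) ^ 2 * (n:ℝ)^(-(1 + 1/LL)) ≤ 16 * LL^4 := by
  have h0 : 0 < LL := by linarith
  have hs : 1 < ((1 + 1/LL : ℝ) : ℂ).re := by 
    rw [Complex.ofReal_re]
    have : 0 < 1/LL := by positivity
    linarith
  have s1 : LSeriesSummable 1 ((1 + 1/LL : ℝ) : ℂ) := LSeriesSummable_one_iff.2 hs
  have s2 := s1.convolution s1
  have s4 := s2.convolution s2
  set D : ℕ → ℂ := LSeries.convolution (LSeries.convolution (1 : ℕ → ℂ) 1) (LSeries.convolution (1 : ℕ → ℂ) 1) with hD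
  have hDn : ∀ n, D n = ((∑ p ∈ n.divisorsAntidiagonal, p.1.divisors.card * p.2.divisors.card : ℕ) : ℂ) := by
    intro n
    rw [hD, LSeries.convolution_def]
    simp only [one_conv_one]
    push_cast; rfl
  have hDr : ∀ n : ℕ, LSeries.term D ((1 + 1/LL : ℝ) : ℂ) n = 
      ((((∑ p ∈ n.divisorsAntidiagonal, p.1.divisors.card * p.2.divisors.card : ℕ) : ℝ) * (n:ℝ)^(-(1 + 1/LL)) : ℝ) : ℂ) := by
    intro n
    rcases eq_or_ne n 0 with rfl | hn
    · simp
    rw [LSeries.term_of_ne_zero hn, hDn, Complex.ofReal_mul, Complex.ofReal_cpow (by positivity), 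
      Complex.ofReal_neg, Complex.cpow_neg, div_eq_mul_inv]
    simp
  have hsD : Summable (fun n : ℕ => ((∑ p ∈ n.divisorsAntidiagonal, p.1.divisors.card * p.2.divisors.card : ℕ) : ℝ) * (n:ℝ)^(-(1 + 1/LL))) := by
    have : Summable (fun n => LSeries.term D ((1 + 1/LL : ℝ) : ℂ) n) := s4
    simp only [hDr] at this
    exact Complex.summable_ofReal.1 this
  have hle : ∀ n : ℕ, (n.divisors.card : ℝ) ^ 2 * (n:ℝ)^(-(1 + 1/LL)) ≤ 
      ((∑ p ∈ n.divisorsAntidiagonal, p.1.divisors.card * p.2.divisors.card : ℕ) : ℝ) * (n:ℝ)^(-(1 + 1/LL)) := by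
    intro n
    gcongr
    norm_cast
    have : n.divisors.card ^ 2 = ∑ p ∈ n.divisorsAntidiagonal, n.divisors.card := by
      rw [Finset.sum_const, smul_eq_mul, ← Nat.map_div_right_divisors, Finset.card_map, sq]
    rw [this]
    refine Finset.sum_le_sum fun p hp => ?_
    rw [← (Nat.mem_divisorsAntidiagonal.1 hp).1]
    exact card_divisors_mul_le _ _
  have hS := Summable.of_nonneg_of_le (fun n => by positivity) hle hsD
  refine ⟨hS, (hS.tsum_le_tsum hle hsD).trans ?_⟩
  have h5 : ((∑' n : ℕ, ((∑ p ∈ n.divisorsAntidiagonal, p.1.divisors.card * p.2.divisors.card : ℕ) : ℝ) * (n:ℝ)^(-(1 + 1/LL)) : ℝ) : ℂ) 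
     = riemannZeta ((1 + 1/LL : ℝ) : ℂ) ^ 4 := by
    rw [Complex.ofReal_tsum]
    simp only [← hDr]
    have : ∑' n, LSeries.term D ((1 + 1/LL : ℝ) : ℂ) n = LSeries D ((1 + 1/LL : ℝ) : ℂ) := rfl
    rw [this, hD, LSeries_convolution' s2 s2, LSeries_convolution' s1 s1, LSeries_one_eq_riemannZeta hs]
    ring
  have h3 := norm_riemannZeta_le hs
  refine (le_abs_self _).trans ?_
  rw [← Real.norm_eq_abs, ← Complex.norm_real, h5, norm_pow]
  rw [Complex.ofReal_re, add_sub_cancel_left, Complex.norm_real] at h3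
  have h6 : ‖riemannZeta ((1 + 1/LL : ℝ) : ℂ)‖ ≤ 2 * LL := by
    refine h3.trans ?_
    rw [Real.norm_of_nonneg (by positivity), div_div_eq_mul_div, div_one, add_mul]
    have : 1 / LL * LL = 1 := by field_simp
    rw [this]; linarith
  calc _ ≤ (2 * LL)^4 := by gcongr
    _ = _ := by ring

noncomputable def vA (a : ℕ) : ℕ → ℂ := fun n => if n < a then (Λ n : ℂ) else 0
noncomputable def vB (a : ℕ) : ℕ → ℂ := fun n => if n < a then 0 else (Λ n : ℂ)
noncomputable def vM (a : ℕ) : ℕ → ℂ := fun n => if n < a then ((ArithmeticFunction.moebius n : ℤ) : ℂ) else 0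
noncomputable def vC (a : ℕ) : ℕ → ℂ := LSeries.convolution (vM a) (vA a)
noncomputable def vE (a : ℕ) : ℕ → ℂ := LSeries.delta - LSeries.convolution (vM a) 1

lemma norm_vA (a n : ℕ) : ‖vA a n‖ ≤ Λ n := by
  unfold vA
  split_ifs
  · rw [Complex.norm_real, Real.norm_of_nonneg ArithmeticFunction.vonMangoldt_nonneg]
  · simp
lemma norm_vB (a n : ℕ) : ‖vB a n‖ ≤ Λ n := by
  unfold vB
  split_ifs
  · simp
  · rw [Complex.norm_real, Real.norm_of_nonneg ArithmeticFunction.vonMangoldt_nonneg]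
lemma norm_vM (a n : ℕ) : ‖vM a n‖ ≤ 1 := by
  unfold vM
  split_ifs
  · rw [Complex.norm_intCast]
    exact_mod_cast ArithmeticFunction.abs_moebius_le_one
  · simp
lemma norm_vM' (a n : ℕ) : ‖vM a n‖ ≤ n := by
  rcases Nat.eq_zero_or_pos n with rfl | hn
  · simp [vM]
  · exact (norm_vM a n).trans (by exact_mod_cast hn)
lemma vM_zero (a n : ℕ) (h : a ≤ n) : vM a n = 0 := by simp [vM, h]
lemma vC_zero (a n : ℕ) (h : a^2 ≤ n) : vC a n = 0 := by
  rw [vC, LSeries.convolution_def]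
  refine Finset.sum_eq_zero fun p hp => ?_
  obtain ⟨h1, h2⟩ := Nat.mem_divisorsAntidiagonal.1 hp
  by_cases c1 : p.1 < a
  · by_cases c2 : p.2 < a
    · exfalso; nlinarith
    · simp [vA, c2]
  · simp [vM, c1]
lemma norm_vC (a n : ℕ) : ‖vC a n‖ ≤ n := by
  rw [vC, LSeries.convolution_def]
  calc _ ≤ ∑ p ∈ n.divisorsAntidiagonal, Λ p.2 := by
        refine (norm_sum_le _ _).trans (Finset.sum_le_sum fun p _ => ?_)
        rw [norm_mul]
        have := norm_vM a p.1
        have := norm_vA a p.2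
        have := norm_nonneg (vA a p.2)
        nlinarith
    _ = Real.log n := by
        rw [← ArithmeticFunction.vonMangoldt_sum, Nat.sum_divisorsAntidiagonal' (f := fun _ y => Λ y)]
    _ ≤ n := Real.log_le_self (by positivity)
lemma vE_zero (a n : ℕ) (h : n < a) : vE a n = 0 := by
  rcases eq_or_ne n 0 with rfl | hn
  · simp [vE, LSeries.delta]
  have e : (LSeries.convolution (vM a) 1) n = (LSeries.convolution (1 : ℕ → ℂ) (fun n : ℕ => ((ArithmeticFunction.moebius n : ℤ) : ℂ))) n := by
    rw [LSeries.convolution_def, LSeries.convolution_def]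
    simp only [Pi.one_apply, mul_one, one_mul]
    rw [Nat.sum_divisorsAntidiagonal (f := fun x _ => vM a x), 
      Nat.sum_divisorsAntidiagonal' (f := fun _ y => ((ArithmeticFunction.moebius y : ℤ) : ℂ))]
    refine Finset.sum_congr rfl fun d hd => ?_
    have := Nat.divisor_le hd
    simp [vM, (by omega : d < a)]
  have e2 : LSeries.convolution (1 : ℕ → ℂ) (fun n : ℕ => ((ArithmeticFunction.moebius n : ℤ) : ℂ)) = LSeries.delta := by
    rw [LSeries.one_convolution_eq_zeta_convolution, ← ArithmeticFunction.one_eq_delta]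
    simp_rw [← ArithmeticFunction.natCoe_apply, ← ArithmeticFunction.intCoe_apply, ArithmeticFunction.coe_mul, 
      ArithmeticFunction.coe_zeta_mul_coe_moebius]
  rw [vE, Pi.sub_apply, e, e2, sub_self]
lemma norm_vE (a n : ℕ) (ha : 2 ≤ a) : ‖vE a n‖ ≤ n.divisors.card := by
  by_cases h : n < a
  · rw [vE_zero a n h]; simp
  have : (LSeries.delta : ℕ → ℂ) n = 0 := by simp [LSeries.delta]; omega
  rw [vE, Pi.sub_apply, this, zero_sub, norm_neg, LSeries.convolution_def]
  refine (norm_sum_le _ _).trans ?_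
  rw [← Nat.map_div_right_divisors, Finset.sum_map]
  refine (Finset.sum_le_sum (g := fun _ => (1:ℝ)) fun d _ => ?_).trans (by simp)
  simp only [Pi.one_apply, mul_one]
  exact norm_vM a d

/-- twisting -/
noncomputable def tw {r : ℕ} (χ : DirichletCharacter ℂ r) (c : ℕ → ℂ) : ℕ → ℂ := fun n => χ n * c n

lemma tw_conv {r : ℕ} (χ : DirichletCharacter ℂ r) (c d : ℕ → ℂ) : tw χ (LSeries.convolution c d) = LSeries.convolution (tw χ c) (tw χ d) :=
  (χ.mul_convolution_distrib c d).symm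

lemma tw_summable {r : ℕ} (χ : DirichletCharacter ℂ r) {c : ℕ → ℂ} {s : ℂ} (h : LSeriesSummable c s) :
    LSeriesSummable (tw χ c) s := χ.LSeriesSummable_mul h

lemma one_lt_aux {LL : ℝ} (hL : 1 ≤ LL) : 1 < ((1 + 1/LL : ℝ) : ℂ).re := by 
  rw [Complex.ofReal_re]
  have : 0 < 1/LL := by positivity
  linarith
lemma vA_summable {LL : ℝ} (hL : 1 ≤ LL) (a : ℕ) : LSeriesSummable (vA a) (1 + 1/LL : ℝ) :=
  lseriesSummable_real hL _ fun n => (norm_vA a n).trans ArithmeticFunction.vonMangoldt_le_log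
lemma vB_summable {LL : ℝ} (hL : 1 ≤ LL) (a : ℕ) : LSeriesSummable (vB a) (1 + 1/LL : ℝ) :=
  lseriesSummable_real hL _ fun n => (norm_vB a n).trans ArithmeticFunction.vonMangoldt_le_log
lemma vM_summable {LL : ℝ} (hL : 1 ≤ LL) (a : ℕ) : LSeriesSummable (vM a) (1 + 1/LL : ℝ) :=
  LSeriesSummable_of_bounded_of_one_lt_re (m := 1) (fun n _ => norm_vM a n) (one_lt_aux hL)
lemma one_summable {LL : ℝ} (hL : 1 ≤ LL) : LSeriesSummable (1 : ℕ → ℂ) (1 + 1/LL : ℝ) := 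
  LSeriesSummable_one_iff.2 (one_lt_aux hL)
lemma log_summable {LL : ℝ} (hL : 1 ≤ LL) : LSeriesSummable (fun n : ℕ => ((Real.log n : ℝ) : ℂ)) (1 + 1/LL : ℝ) := 
  lseriesSummable_real hL _ fun n => by
    rw [Complex.norm_real, Real.norm_of_nonneg (Real.log_natCast_nonneg n)]
lemma vE_summable {LL : ℝ} (hL : 1 ≤ LL) (a : ℕ) : LSeriesSummable (vE a) (1 + 1/LL : ℝ) := by
  refine LSeriesSummable.sub ?_ ((vM_summable hL a).convolution (one_summable hL))
  refine LSeriesSummable_of_bounded_of_one_lt_re (m := 1) (fun n _ => ?_) (one_lt_aux hL)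
  unfold LSeries.delta; split_ifs <;> simp

lemma vaughan {LL : ℝ} (hL : 1 ≤ LL) (a : ℕ) {r : ℕ} (χ : DirichletCharacter ℂ r) (ξ : ℝ) :
    LSeries (fun n : ℕ => χ n * (Λ n : ℂ)) (1 + om ξ / LL) = 
      LSeries (tw χ (vA a)) (1 + om ξ / LL) + 
      LSeries (tw χ (vB a)) (1 + om ξ / LL) * LSeries (tw χ (vE a)) (1 + om ξ / LL) + 
      LSeries (tw χ (vM a)) (1 + om ξ / LL) * LSeries (fun n : ℕ => χ n * ((Real.log n : ℝ) : ℂ)) (1 + om ξ / LL) - 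
      LSeries (tw χ (vC a)) (1 + om ξ / LL) * LSeries (fun n : ℕ => χ n * ((1 : ℝ) : ℂ)) (1 + om ξ / LL) := by
  set s := (1 + om ξ / LL)
  have sA : LSeriesSummable (tw χ (vA a)) s := summable_om _ (tw_summable χ (vA_summable hL a)) ξ
  have sB : LSeriesSummable (tw χ (vB a)) s := summable_om _ (tw_summable χ (vB_summable hL a)) ξ
  have sM : LSeriesSummable (tw χ (vM a)) s := summable_om _ (tw_summable χ (vM_summable hL a)) ξ
  have s1 : LSeriesSummable (tw χ 1) s := summable_om _ (tw_summable χ (one_summable hL)) ξ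
  have eAB : (fun n : ℕ => χ n * (Λ n : ℂ)) = tw χ (vA a) + tw χ (vB a) := by
    ext n
    simp only [tw, vA, vB, Pi.add_apply]
    split_ifs <;> simp
  have hG : LSeries (fun n : ℕ => χ n * (Λ n : ℂ)) s = LSeries (tw χ (vA a)) s + LSeries (tw χ (vB a)) s := by
    rw [eAB, LSeries_add sA sB]
  have sG : LSeriesSummable (fun n : ℕ => χ n * (Λ n : ℂ)) s := by rw [eAB]; exact sA.add sB
  have e1 : (fun n : ℕ => χ n * ((1 : ℝ) : ℂ)) = tw χ 1 := by ext n; simp [tw]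
  have hC : LSeries (tw χ (vC a)) s = LSeries (tw χ (vM a)) s * LSeries (tw χ (vA a)) s := by
    rw [vC, tw_conv, LSeries_convolution' sM sA]
  have hE : LSeries (tw χ (vE a)) s = 1 - LSeries (tw χ (vM a)) s * LSeries (tw χ 1) s := by
    have : tw χ (vE a) = LSeries.delta - LSeries.convolution (tw χ (vM a)) (tw χ 1) := by
      rw [← tw_conv]
      ext n
      simp only [tw, vE, Pi.sub_apply, mul_sub]
      congr 1
      by_cases hn : n = 1
      · subst hn; simp
      · simp [LSeries.delta, hn]
    rw [this, LSeries_sub _ (sM.convolution s1), LSeries_convolution' sM s1, LSeries_delta]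
    · rfl
    · refine LSeriesSummable_of_bounded_of_one_lt_re (m := 1) (fun n _ => ?_) (?_ : 1 < s.re)
      · unfold LSeries.delta; split_ifs <;> simp
      · rw [re_one_add_om]; have : 0 < 1/LL := by positivity
        linarith
  have hlog : LSeries (fun n : ℕ => χ n * ((Real.log n : ℝ) : ℂ)) s = 
      LSeries (fun n : ℕ => χ n * (Λ n : ℂ)) s * LSeries (tw χ 1) s := by
    rw [← LSeries_convolution' sG s1]
    have h3 : LSeries.convolution (fun n : ℕ => χ n * (Λ n : ℂ)) (tw χ 1) = tw χ (LSeries.convolution (fun n : ℕ => (Λ n : ℂ)) 1) := (tw_conv χ _ _).symm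
    rw [h3, ArithmeticFunction.convolution_vonMangoldt_const_one]
    refine LSeries_congr (fun {n} _ => ?_) s
    simp only [tw, Complex.natCast_log]
  rw [e1, hC, hE, hlog, hG]; ring

end

section

open Filter Topology MeasureTheory Set
open scoped ArithmeticFunction ComplexConjugate

lemma log_w_bound (n : ℕ) (hn : 1 ≤ n) : |Real.log n - Real.log (n+1 : ℕ)| ≤ 1 / n := by
  have hn0 : (0:ℝ) < n := by exact_mod_cast hn
  have hmono : Real.log n ≤ Real.log (n+1 : ℕ) := 
    Real.log_le_log hn0 (by push_cast; linarith)
  rw [abs_sub_comm, abs_of_nonneg (by linarith), ← Real.log_div (by positivity) (by positivity)]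
  refine (Real.log_le_sub_one_of_pos (by positivity)).trans (le_of_eq ?_)
  push_cast; field_simp; ring

lemma norm_tw_le {r : ℕ} (χ : DirichletCharacter ℂ r) (c : ℕ → ℂ) (n : ℕ) : ‖tw χ c n‖ ≤ ‖c n‖ := by
  rw [tw, norm_mul]
  exact mul_le_of_le_one_left (norm_nonneg _) (χ.norm_le_one _)

/-- decomposition of the prime character sum for a single character -/
lemma chSum_le {f : ℝ → ℝ} {φ : ℝ → ℂ} (h : LapRep f φ) {K LL : ℝ} (hK : 0 ≤ K) (hLL : 10 ≤ LL)
    (h0 : ∀ t < 1, f t = 0) (h2 : ∀ t, 2 < t → f t = 0) (h1 : ∀ t, |f t| ≤ 1) 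
    (hlip : ∀ s t, |f s - f t| ≤ K * |s - t|) (a : ℕ) (ha : 1 ≤ a) (ha' : (a:ℝ) ≤ 2 * Real.exp (LL/10))
    {r : ℕ} [NeZero r] (χ : DirichletCharacter ℂ r) (hχ : χ ≠ 1) :
    ‖chSum f LL χ‖ ≤ ‖∫ ξ, φ ξ * LSeries (tw χ (vB a)) (1 + om ξ / LL) * LSeries (tw χ (vE a)) (1 + om ξ / LL)‖ 
      + 2 * (r * (2 * (1 + K) * (3 + 2 * LL)^2 * ((a:ℝ)^4 * Real.exp (-LL)))) := by
  have hL1 : 1 ≤ LL := by linarith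
  have hL0 : 0 < LL := by linarith
  have sA := tw_summable χ (vA_summable hL1 a)
  have sB := tw_summable χ (vB_summable hL1 a)
  have sM := tw_summable χ (vM_summable hL1 a)
  have sE := tw_summable χ (vE_summable hL1 a)
  have sC : LSeriesSummable (tw χ (vC a)) (1 + 1/LL : ℝ) := 
    tw_summable χ ((vM_summable hL1 a).convolution (vA_summable hL1 a))
  have slog : LSeriesSummable (fun n : ℕ => χ n * ((Real.log n : ℝ) : ℂ)) (1 + 1/LL : ℝ) := 
    tw_summable χ (log_summable hL1)
  have s1 : LSeriesSummable (fun n : ℕ => χ n * ((1 : ℝ) : ℂ)) (1 + 1/LL : ℝ) := by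
    have := tw_summable χ (one_summable hL1)
    convert this using 2
    simp [tw]
  have sG : LSeriesSummable (fun n : ℕ => χ n * (Λ n : ℂ)) (1 + 1/LL : ℝ) := 
    lseriesSummable_real hL1 _ (norm_char_lambda_le χ)
  have haL : (a:ℝ)^2 ≤ Real.exp LL := by
    have e8 : (4:ℝ) ≤ Real.exp (8 * LL / 10) := by
      have := Real.add_one_le_exp (8 * LL / 10); linarith
    calc (a:ℝ)^2 ≤ (2 * Real.exp (LL/10))^2 := by gcongr
      _ = 4 * Real.exp (2 * LL / 10) := by rw [mul_pow, ← Real.exp_nat_mul]; push_cast; ring_nf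
      _ ≤ Real.exp (8 * LL / 10) * Real.exp (2 * LL / 10) := by gcongr
      _ = Real.exp LL := by rw [← Real.exp_add]; ring_nf
  have ha1 : (1:ℝ) ≤ a := by exact_mod_cast ha
  have e0 : chSum f LL χ = ∫ ξ, φ ξ * LSeries (fun n : ℕ => χ n * (Λ n : ℂ)) (1 + om ξ / LL) := 
    sum_eq_integral h _ sG
  have iA : ∫ ξ, φ ξ * LSeries (tw χ (vA a)) (1 + om ξ / LL) = 0 := by
    rw [← sum_eq_integral h _ sA]
    refine (tsum_congr fun n => ?_).trans tsum_zero
    by_cases hn : n < a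
    · rcases Nat.eq_zero_or_pos n with rfl | hn0
      · simp
      have hn0' : (0:ℝ) < n := by exact_mod_cast hn0
      rw [h0, Complex.ofReal_zero, mul_zero]
      rw [div_lt_one hL0]
      refine (Real.log_lt_iff_lt_exp hn0').2 (lt_of_lt_of_le ?_ haL)
      have : (n:ℝ) < a := by exact_mod_cast hn
      nlinarith
    · simp [tw, vA, hn]
  have iM := type_one h hK hL1 h0 h2 h1 hlip (fun n => Real.log n) 
    (fun n => by rw [abs_of_nonneg (Real.log_natCast_nonneg n)]; linarith) log_w_bound χ hχ slog a
    (by nlinarith) (tw χ (vM a)) (fun m => (norm_tw_le _ _ _).trans (norm_vM' a m)) 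
    (fun m hm => by simp [tw, vM_zero a m hm])
  have iC := type_one h hK hL1 h0 h2 h1 hlip (fun n => 1) 
    (fun n => by rw [abs_one]; linarith [Real.log_natCast_nonneg n]) (fun n _ => by simp) χ hχ s1 (a^2)
    (by exact_mod_cast haL) (tw χ (vC a)) (fun m => (norm_tw_le _ _ _).trans (norm_vC a m)) 
    (fun m hm => by simp [tw, vC_zero a m hm])
  have i1 := integrable_phi_lseries h _ sA
  have i2 := integrable_phi_lseries2 h _ _ sB sE
  have i3 := integrable_phi_lseries2 h _ _ sM slog
  have i4 := integrable_phi_lseries2 h _ _ sC s1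
  have e1 : chSum f LL χ = (∫ ξ, φ ξ * LSeries (tw χ (vA a)) (1 + om ξ / LL)) + 
      (∫ ξ, φ ξ * LSeries (tw χ (vB a)) (1 + om ξ / LL) * LSeries (tw χ (vE a)) (1 + om ξ / LL)) + 
      (∫ ξ, φ ξ * LSeries (tw χ (vM a)) (1 + om ξ / LL) * LSeries (fun n : ℕ => χ n * ((Real.log n : ℝ) : ℂ)) (1 + om ξ / LL)) - 
      (∫ ξ, φ ξ * LSeries (tw χ (vC a)) (1 + om ξ / LL) * LSeries (fun n : ℕ => χ n * ((1 : ℝ) : ℂ)) (1 + om ξ / LL)) := by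
    have i12 := i1.add i2
    have i123 := i12.add i3
    simp only [Pi.add_def] at i12 i123
    rw [e0, ← integral_add i1 i2, ← integral_add i12 i3, ← integral_sub i123 i4]
    congr 1; ext ξ
    rw [vaughan hL1 a χ ξ]; ring
  rw [e1, iA, zero_add]
  refine (norm_sub_le _ _).trans ?_
  refine (add_le_add_left (norm_add_le _ _) _).trans ?_
  have h24 : (a:ℝ)^2 ≤ a^4 := pow_le_pow_right₀ ha1 (by norm_num)
  have iM' : r * (2 * (1 + K) * (3 + 2 * LL)^2 * ((a:ℝ)^2 * Real.exp (-LL))) ≤ 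
    r * (2 * (1 + K) * (3 + 2 * LL)^2 * ((a:ℝ)^4 * Real.exp (-LL))) := by gcongr
  have iC' : r * (2 * (1 + K) * (3 + 2 * LL)^2 * ((((a^2 : ℕ)) : ℝ)^2 * Real.exp (-LL))) = 
    r * (2 * (1 + K) * (3 + 2 * LL)^2 * ((a:ℝ)^4 * Real.exp (-LL))) := by push_cast; ring
  rw [iC'] at iC
  linarith

theorem large_conductor {f : ℝ → ℝ} {φ : ℝ → ℂ} (h : LapRep f φ) {K : ℝ} (hK : 0 ≤ K)
    (h0 : ∀ t < 1, f t = 0) (h2 : ∀ t, 2 < t → f t = 0) (h1 : ∀ t, |f t| ≤ 1) 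
    (hlip : ∀ s t, |f s - f t| ≤ K * |s - t|) : ∃ C : ℝ, 0 ≤ C ∧ ∀ LL : ℝ, 10 ≤ LL → 
    ∀ X : Finset (Σ r : ℕ, DirichletCharacter ℂ r), 
      (∀ p ∈ X, 1 < p.1 ∧ (p.1 : ℝ) ≤ Real.exp (LL/50) ∧ p.2.IsPrimitive) → 
      (X.card : ℝ) ≤ Real.exp (LL/25) → ∑ p ∈ X, ‖chSum f LL p.2‖ ≤ C * LL^5 := by
  classical
  refine ⟨(∫ ξ, ‖φ ξ‖) * 160 + 1600 * (1 + K), by positivity, ?_⟩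
  intro LL hLL X hX hcard
  have hL1 : 1 ≤ LL := by linarith
  have hL0 : 0 < LL := by linarith
  set a : ℕ := ⌊Real.exp (LL/10)⌋₊ + 1 with hadef
  have ha_lo : Real.exp (LL/10) ≤ a := by
    rw [hadef]; push_cast; exact (Nat.lt_floor_add_one _).le
  have ha_hi : (a:ℝ) ≤ 2 * Real.exp (LL/10) := by
    rw [hadef]; push_cast
    have := Nat.floor_le (Real.exp_pos (LL/10)).le
    have := Real.one_le_exp (by positivity : 0 ≤ LL/10)
    linarith
  have ha2 : 2 ≤ a := by
    have : (2:ℝ) ≤ a := by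
      have := Real.add_one_le_exp (LL/10)
      linarith
    exact_mod_cast this
  have hne : ∀ p ∈ X, NeZero p.1 := fun p hp => ⟨by have := (hX p hp).1; omega⟩
  -- type two
  set o : ℝ := 2 * Real.exp (LL/25) * Real.exp (-(LL/10)) with ho
  have hoff : ∀ i ∈ X, ∀ j ∈ X, i ≠ j → ∀ M, 
      ‖∑ k ∈ Finset.range M, ((fun (p : Σ r : ℕ, DirichletCharacter ℂ r) (n : ℕ) => p.2 n) i (a+k) * 
        conj ((fun (p : Σ r : ℕ, DirichletCharacter ℂ r) (n : ℕ) => p.2 n) j (a+k))) * 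
        (((a+k : ℕ):ℝ)^(-(1+1/LL)) : ℝ)‖ ≤ o := by
    intro i hi j hj hij M
    have := hne i hi
    have := hne j hj
    have : NeZero (i.1 * j.1) := ⟨mul_ne_zero (NeZero.ne _) (NeZero.ne _)⟩
    obtain ⟨χ₃, hχ₃, he⟩ := exists_twist i.2 j.2 (hX i hi).2.2 (hX j hj).2.2 hij
    simp only [← he]
    have ha0 : (0:ℝ) < a := by positivity
    refine (char_sum_antitone χ₃ hχ₃ a M (fun n => (n:ℝ)^(-(1+1/LL))) ?_ (fun n => by positivity)).trans ?_
    · intro k hk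
      have hk0 : (0:ℝ) < k := by exact_mod_cast (by omega : 0 < k)
      refine Real.rpow_le_rpow_of_nonpos hk0 (by push_cast; linarith) ?_
      have : 0 < 1/LL := by positivity
      linarith
    · have b1 : ((i.1 * j.1 : ℕ) : ℝ) ≤ Real.exp (LL/25) := by
        have e : Real.exp (LL/25) = Real.exp (LL/50) * Real.exp (LL/50) := by
          rw [← Real.exp_add]; ring_nf
        rw [e]; push_cast
        gcongr
        · exact (hX i hi).2.1
        · exact (hX j hj).2.1
      have b2 : (a:ℝ)^(-(1+1/LL)) ≤ Real.exp (-(LL/10)) := by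
        calc (a:ℝ)^(-(1+1/LL)) ≤ (a:ℝ)^(-1:ℝ) := by
              refine Real.rpow_le_rpow_of_exponent_le (by exact_mod_cast (by omega : 1 ≤ a)) ?_
              have : 0 < 1/LL := by positivity
              linarith
          _ = (a:ℝ)⁻¹ := Real.rpow_neg_one _
          _ ≤ _ := by rw [Real.exp_neg]; gcongr
      rw [ho]
      gcongr
  have hXo : X.card * o ≤ 2 := by
    calc X.card * o ≤ Real.exp (LL/25) * o := by gcongr
      _ = 2 * Real.exp (LL/25 + LL/25 + -(LL/10)) := by rw [ho, Real.exp_add, Real.exp_add]; ring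
      _ ≤ 2 * 1 := by
        gcongr
        rw [Real.exp_le_one_iff]; linarith
      _ = 2 := by ring
  have ho0 : 0 ≤ o := by positivity
  have hB : ∀ ξ, ∑ p ∈ X, ‖LSeries (tw p.2 (vB a)) (1 + om ξ / LL)‖^2 ≤ (2 * LL + X.card * o) * (64 * LL^3) := by
    intro ξ
    obtain ⟨hS, hb⟩ := sum_log_sq_le hL1
    have hle : ∀ n : ℕ, ‖vB a n‖^2 * (n:ℝ)^(-(1+1/LL)) ≤ Real.log n ^ 2 * (n:ℝ)^(-(1+1/LL)) := fun n => by
      gcongr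
      exact (norm_vB a n).trans ArithmeticFunction.vonMangoldt_le_log
    have hS' := Summable.of_nonneg_of_le (fun n => by positivity) hle hS
    exact type_two X (fun (p : Σ r : ℕ, DirichletCharacter ℂ r) (n : ℕ) => p.2 n) 
      (fun p n => p.2.norm_le_one _) hL1 a (by omega) ho0 hoff (vB a) (fun n hn => by simp [vB, hn]) (64 * LL^3)
      hS' ((hS'.tsum_le_tsum hle hS).trans hb) (fun p hp => tw_summable p.2 (vB_summable hL1 a)) ξ
  have hE : ∀ ξ, ∑ p ∈ X, ‖LSeries (tw p.2 (vE a)) (1 + om ξ / LL)‖^2 ≤ (2 * LL + X.card * o) * (16 * LL^4) := by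
    intro ξ
    obtain ⟨hS, hb⟩ := sum_tau_sq_le hL1
    have hle : ∀ n : ℕ, ‖vE a n‖^2 * (n:ℝ)^(-(1+1/LL)) ≤ (n.divisors.card : ℝ) ^ 2 * (n:ℝ)^(-(1+1/LL)) := fun n => by
      gcongr
      exact norm_vE a n ha2
    have hS' := Summable.of_nonneg_of_le (fun n => by positivity) hle hS
    exact type_two X (fun (p : Σ r : ℕ, DirichletCharacter ℂ r) (n : ℕ) => p.2 n) 
      (fun p n => p.2.norm_le_one _) hL1 a (by omega) ho0 hoff (vE a) (fun n hn => vE_zero a n hn) (16 * LL^4)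
      hS' ((hS'.tsum_le_tsum hle hS).trans hb) (fun p hp => tw_summable p.2 (vE_summable hL1 a)) ξ
  have hII : ∑ p ∈ X, ‖∫ ξ, φ ξ * LSeries (tw p.2 (vB a)) (1 + om ξ / LL) * 
      LSeries (tw p.2 (vE a)) (1 + om ξ / LL)‖ ≤ (∫ ξ, ‖φ ξ‖) * 160 * LL^5 := by
    calc _ ≤ ∑ p ∈ X, ∫ ξ, ‖φ ξ * LSeries (tw p.2 (vB a)) (1 + om ξ / LL) * 
          LSeries (tw p.2 (vE a)) (1 + om ξ / LL)‖ := 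
          Finset.sum_le_sum fun p _ => norm_integral_le_integral_norm _
      _ = ∫ ξ, ∑ p ∈ X, ‖φ ξ * LSeries (tw p.2 (vB a)) (1 + om ξ / LL) * 
          LSeries (tw p.2 (vE a)) (1 + om ξ / LL)‖ := by
          rw [integral_finsetSum]
          intro p _
          exact (integrable_phi_lseries2 h _ _ (tw_summable p.2 (vB_summable hL1 a))
            (tw_summable p.2 (vE_summable hL1 a))).norm
      _ ≤ ∫ ξ, ‖φ ξ‖ * (160 * LL^5) := by
          refine integral_mono ?_ (h.integrable.norm.mul_const _) ?_
          · refine integrable_finsetSum _ fun p _ => ?_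
            exact (integrable_phi_lseries2 h _ _ (tw_summable p.2 (vB_summable hL1 a))
              (tw_summable p.2 (vE_summable hL1 a))).norm
          · intro ξ
            simp only [norm_mul, mul_assoc]
            rw [← Finset.mul_sum]
            gcongr
            calc _ ≤ ∑ p ∈ X, (‖LSeries (tw p.2 (vB a)) (1 + om ξ / LL)‖^2 / 2 + 
                  ‖LSeries (tw p.2 (vE a)) (1 + om ξ / LL)‖^2 / 2) := by
                  refine Finset.sum_le_sum fun p _ => ?_
                  nlinarith [sq_nonneg (‖LSeries (tw p.2 (vB a)) (1 + om ξ / LL)‖ - 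
                    ‖LSeries (tw p.2 (vE a)) (1 + om ξ / LL)‖)]
              _ ≤ ((2 * LL + X.card * o) * (64 * LL^3)) / 2 + ((2 * LL + X.card * o) * (16 * LL^4)) / 2 := by
                  rw [Finset.sum_add_distrib, ← Finset.sum_div, ← Finset.sum_div]
                  gcongr
                  · exact hB ξ
                  · exact hE ξ
              _ ≤ ((4 * LL) * (64 * LL^4)) / 2 + ((4 * LL) * (16 * LL^4)) / 2 := by
                  gcongr <;> first | linarith | norm_num
              _ = _ := by ring
      _ = _ := by rw [integral_mul_const]; ring
  have hI : ∀ p ∈ X, 2 * (p.1 * (2 * (1 + K) * (3 + 2 * LL)^2 * ((a:ℝ)^4 * Real.exp (-LL)))) ≤ 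
      1600 * (1 + K) * LL^2 * Real.exp (-(LL/25)) := by
    intro p hp
    calc _ ≤ 2 * (Real.exp (LL/50) * (2 * (1 + K) * (5 * LL)^2 * ((2 * Real.exp (LL/10))^4 * Real.exp (-LL)))) := by
          gcongr
          · exact (hX p hp).2.1
          · linarith
      _ = 1600 * (1 + K) * LL^2 * Real.exp (LL/50 + 4 * (LL/10) + -LL) := by
          rw [mul_pow 2 (Real.exp (LL/10)), ← Real.exp_nat_mul, Real.exp_add, Real.exp_add]; push_cast; ring
      _ ≤ _ := by
          gcongr; linarith
  calc _ ≤ ∑ p ∈ X, (‖∫ ξ, φ ξ * LSeries (tw p.2 (vB a)) (1 + om ξ / LL) * 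
      LSeries (tw p.2 (vE a)) (1 + om ξ / LL)‖ + 1600 * (1 + K) * LL^2 * Real.exp (-(LL/25))) := by
        refine Finset.sum_le_sum fun p hp => ?_
        have := hne p hp
        refine (chSum_le h hK hLL h0 h2 h1 hlip a (by omega) ha_hi p.2 
          (ne_one_of_primitive (hX p hp).1 (hX p hp).2.2)).trans ?_
        exact add_le_add le_rfl (hI p hp)
    _ ≤ (∫ ξ, ‖φ ξ‖) * 160 * LL^5 + Real.exp (LL/25) * (1600 * (1 + K) * LL^2 * Real.exp (-(LL/25))) := by
        rw [Finset.sum_add_distrib, Finset.sum_const, nsmul_eq_mul]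
        gcongr
    _ = (∫ ξ, ‖φ ξ‖) * 160 * LL^5 + 1600 * (1 + K) * LL^2 := by
        rw [Real.exp_neg]
        have := Real.exp_pos (LL/25)
        field_simp
    _ ≤ (∫ ξ, ‖φ ξ‖) * 160 * LL^5 + 1600 * (1 + K) * LL^5 := by
        gcongr <;> first | linarith | norm_num
    _ = _ := by ring

end

section

open Complex MeasureTheory Filter Topology
open scoped ArithmeticFunction.vonMangoldt

noncomputable section

/-- The fixed smooth cutoff used to localise the primes. -/
structure Cut (f : ℝ → ℝ) : Prop where
  nonneg : ∀ t, 0 ≤ f t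
  le_one : ∀ t, f t ≤ 1
  lo : ∀ t, t < 5/4 → f t = 0
  hi : ∀ t, 7/4 < t → f t = 0
  one : ∀ t, 11/8 ≤ t → t ≤ 13/8 → f t = 1

lemma exists_cut : ∃ f : ℝ → ℝ, Cut f ∧ ContDiff ℝ (⊤:ℕ∞) f ∧ HasCompactSupport f := by
  let b : ContDiffBump (3/2:ℝ) := ⟨1/8, 1/4, by norm_num, by norm_num⟩
  refine ⟨b, ⟨fun t => b.nonneg, fun t => b.le_one, fun t ht => ?_, fun t ht => ?_, fun t h1 h2 => ?_⟩,
    b.contDiff, b.hasCompactSupport⟩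
  · apply b.zero_of_le_dist
    rw [Real.dist_eq, abs_sub_comm]
    exact le_trans (by show (1/4:ℝ) ≤ _; linarith) (le_abs_self _)
  · apply b.zero_of_le_dist
    rw [Real.dist_eq]
    exact le_trans (by show (1/4:ℝ) ≤ _; linarith) (le_abs_self _)
  · apply b.one_of_mem_closedBall
    rw [Metric.mem_closedBall, Real.dist_eq, abs_le]
    show -(1/8:ℝ) ≤ _ ∧ _ ≤ (1/8:ℝ)
    constructor <;> linarith

/-- `log n` on primes. -/
def thF (n : ℕ) : ℝ := if n.Prime then Real.log n else 0

/-- Weighted primes. -/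
def gF (f : ℝ → ℝ) (LL : ℝ) (n : ℕ) : ℝ := thF n * (f (Real.log n / LL) / n)

/-- Summation range. -/
def rg (LL : ℝ) : Finset ℕ := Finset.range (⌊Real.exp (2*LL)⌋₊ + 1)

/-- Total prime mass. -/
def XF (f : ℝ → ℝ) (LL : ℝ) : ℝ := ∑ n ∈ rg LL, gF f LL n

/-- Mass of proper prime powers. -/
def PPF (f : ℝ → ℝ) (LL : ℝ) : ℝ := ∑ n ∈ rg LL, (Λ n - thF n) * (f (Real.log n / LL) / n)

lemma thF_nonneg (n : ℕ) : 0 ≤ thF n := by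
  unfold thF; split_ifs
  · exact Real.log_natCast_nonneg n
  · rfl

lemma thF_le (n : ℕ) : thF n ≤ Λ n := by
  unfold thF; split_ifs with h
  · rw [ArithmeticFunction.vonMangoldt_apply_prime h]
  · exact ArithmeticFunction.vonMangoldt_nonneg

lemma gF_nonneg {f : ℝ → ℝ} (hf : Cut f) (LL : ℝ) (n : ℕ) : 0 ≤ gF f LL n :=
  mul_nonneg (thF_nonneg n) (div_nonneg (hf.nonneg _) (by positivity))

lemma Cut.supp {f : ℝ → ℝ} (hf : Cut f) {LL : ℝ} (hLL : 0 < LL) {n : ℕ} (hn : f (Real.log n / LL) ≠ 0) :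
    Real.exp (5*LL/4) ≤ n ∧ (n:ℝ) ≤ Real.exp (7*LL/4) := by
  have h1 : 5/4 ≤ Real.log n / LL := by
    by_contra h; exact hn (hf.lo _ (not_le.1 h))
  have h2 : Real.log n / LL ≤ 7/4 := by
    by_contra h; exact hn (hf.hi _ (not_le.1 h))
  rw [le_div_iff₀ hLL] at h1
  rw [div_le_iff₀ hLL] at h2
  have hn0 : (0:ℝ) < n := by
    rcases Nat.eq_zero_or_pos n with h | h
    · subst h; simp at h1; linarith
    · exact_mod_cast h
  constructor
  · rw [← Real.le_log_iff_exp_le hn0]; linarith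
  · rw [← Real.log_le_iff_le_exp hn0]; linarith

lemma Cut.notMem {f : ℝ → ℝ} (hf : Cut f) {LL : ℝ} (hLL : 0 < LL) {n : ℕ} (hn : n ∉ rg LL) :
    f (Real.log n / LL) = 0 := by
  by_contra h
  have h1 := (hf.supp hLL h).2
  apply hn
  rw [rg, Finset.mem_range, Nat.lt_succ_iff]
  apply Nat.le_floor
  exact h1.trans (Real.exp_le_exp.2 (by linarith))

lemma PPF_le {f : ℝ → ℝ} (hf : Cut f) {LL : ℝ} (hLL : 1 ≤ LL) :
    PPF f LL ≤ 4 * LL * Real.exp (-(3*LL/8)) := by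
  have h0 : 0 < LL := by linarith
  set x := Real.exp (7*LL/4)
  have hx1 : 1 ≤ x := Real.one_le_exp (by linarith)
  have hψ : Chebyshev.psi x - Chebyshev.theta x = ∑ n ∈ Finset.Ioc 0 ⌊x⌋₊, (Λ n - thF n) := by
    rw [Chebyshev.psi, Chebyshev.theta, Finset.sum_sub_distrib, Finset.sum_filter]
    rfl
  have h1 : PPF f LL ≤ (Chebyshev.psi x - Chebyshev.theta x) * Real.exp (-(5*LL/4)) := by
    rw [hψ, PPF, Finset.sum_mul]
    rw [← Finset.sum_filter_ne_zero]
    have hsub : (rg LL).filter (fun n => (Λ n - thF n) * (f (Real.log n / LL) / n) ≠ 0) ⊆ Finset.Ioc 0 ⌊x⌋₊ := by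
      intro n hn
      rw [Finset.mem_filter] at hn
      have : f (Real.log n / LL) ≠ 0 := fun h => hn.2 (by rw [h]; simp)
      have := hf.supp h0 this
      rw [Finset.mem_Ioc]
      refine ⟨?_, Nat.le_floor this.2⟩
      have := (Real.exp_pos _).trans_le this.1
      exact_mod_cast this
    refine (Finset.sum_le_sum fun n hn => ?_).trans (Finset.sum_le_sum_of_subset_of_nonneg hsub fun n _ _ => ?_)
    · apply mul_le_mul_of_nonneg_left _ (sub_nonneg.2 (thF_le n))
      rw [Finset.mem_filter] at hn
      have : f (Real.log n / LL) ≠ 0 := fun h => hn.2 (by rw [h]; simp)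
      have := hf.supp h0 this
      rw [Real.exp_neg, ← one_div]
      exact div_le_div₀ zero_le_one (hf.le_one _) (Real.exp_pos _) this.1
    · exact mul_nonneg (sub_nonneg.2 (thF_le n)) (Real.exp_pos _).le
  have h2 := Chebyshev.psi_sub_theta_le hx1
  have h3 : √x = Real.exp (7*LL/8) := by
    rw [← Real.exp_half]; congr 1; ring
  rw [h3, Real.log_exp] at h2
  calc _ ≤ _ := h1
    _ ≤ (2 * Real.exp (7*LL/8) * (7*LL/4)) * Real.exp (-(5*LL/4)) := by gcongr
    _ = 7/2 * LL * Real.exp (7*LL/8 + -(5*LL/4)) := by rw [Real.exp_add]; ring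
    _ = 7/2 * LL * Real.exp (-(3*LL/8)) := by congr 2; ring
    _ ≤ _ := by gcongr; norm_num

lemma PPF_nonneg {f : ℝ → ℝ} (hf : Cut f) (LL : ℝ) : 0 ≤ PPF f LL :=
  Finset.sum_nonneg fun n _ => mul_nonneg (sub_nonneg.2 (thF_le n)) (div_nonneg (hf.nonneg _) (by positivity))

lemma theta_block : ∀ᶠ t : ℝ in atTop, t ≤ Chebyshev.theta (8*t) - Chebyshev.theta t := by
  have e1 : ∀ᶠ t : ℝ in atTop, Real.log (8*t+2) ≤ t/2 := by
    have : Tendsto (fun t : ℝ => 8*t+2) atTop atTop :=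
      tendsto_atTop_add_const_right _ _ (tendsto_id.const_mul_atTop (by norm_num))
    have h := this.eventually (Real.isLittleO_log_id_atTop.bound (show (0:ℝ) < 1/32 by norm_num))
    filter_upwards [h, eventually_ge_atTop 1] with t ht h1
    simp only [id, Real.norm_eq_abs] at ht
    rw [abs_of_nonneg (show 0 ≤ 8*t+2 by linarith)] at ht
    have := (le_abs_self _).trans ht
    linarith
  have e2 : ∀ᶠ t : ℝ in atTop, 2 * √(8*t) * Real.log (8*t) ≤ t/2 := by
    have : Tendsto (fun t : ℝ => 8*t) atTop atTop := tendsto_id.const_mul_atTop (by norm_num)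
    have h := this.eventually ((isLittleO_log_rpow_atTop (show (0:ℝ) < 1/2 by norm_num)).bound (show (0:ℝ) < 1/32 by norm_num))
    filter_upwards [h, eventually_ge_atTop 1] with t ht h1
    rw [← Real.sqrt_eq_rpow] at ht
    simp only [Real.norm_eq_abs] at ht
    rw [abs_of_nonneg (Real.sqrt_nonneg _)] at ht
    have := (le_abs_self _).trans ht
    have h3 : √(8*t) * √(8*t) = 8*t := Real.mul_self_sqrt (by linarith)
    nlinarith [Real.sqrt_nonneg (8*t)]
  filter_upwards [e1, e2, eventually_ge_atTop 10] with t h1 h2 h3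
  have h4 := Chebyshev.theta_ge' (show 1 ≤ 8*t by linarith)
  have h5 := Chebyshev.theta_le_log4_mul_x (show 0 ≤ t by linarith)
  have h6 : Real.log 4 = 2 * Real.log 2 := by
    rw [show (4:ℝ) = 2^2 by norm_num, Real.log_pow]; norm_num
  rw [h6] at h5
  have := Real.log_two_gt_d9
  nlinarith

lemma XF_ge {f : ℝ → ℝ} (hf : Cut f) : ∀ᶠ LL : ℝ in atTop, LL / 200 ≤ XF f LL := by
  obtain ⟨t0, ht0⟩ := eventually_atTop.1 theta_block
  filter_upwards [eventually_ge_atTop 100, eventually_ge_atTop t0] with LL h100 hLt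
  have h0 : 0 < LL := by linarith
  set y := Real.exp (11*LL/8)
  have hy : LL ≤ y := by
    have := Real.add_one_le_exp (11*LL/8)
    linarith
  set S : ℝ → ℝ := fun x => ∑ n ∈ Finset.Ioc ⌊y⌋₊ ⌊x⌋₊, thF n / n with hS
  have hth : ∀ x, Chebyshev.theta x = ∑ n ∈ Finset.Ioc 0 ⌊x⌋₊, thF n := by
    intro x; rw [Chebyshev.theta, Finset.sum_filter]; rfl
  have hstep : ∀ J : ℕ, (J:ℝ)/8 ≤ S (y * 8^J) := by
    intro J
    induction J with
    | zero => simp [hS]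
    | succ J ih =>
      have hle : y ≤ y * 8^J := le_mul_of_one_le_right (by positivity) (one_le_pow₀ (by norm_num))
      have hle2 : y * 8^J ≤ y * 8^(J+1) := by gcongr <;> norm_num
      have h1 : S (y * 8^(J+1)) = S (y*8^J) + ∑ n ∈ Finset.Ioc ⌊y*8^J⌋₊ ⌊y*8^(J+1)⌋₊, thF n / n := by
        rw [hS]
        exact (Finset.sum_Ioc_consecutive _ (Nat.floor_mono hle) (Nat.floor_mono hle2)).symm
      have h2 := ht0 (y*8^J) (by linarith)
      rw [hth, hth, show 8 * (y*8^J) = y * 8^(J+1) by ring, ← Finset.sum_Ioc_consecutive _ (Nat.zero_le _) (Nat.floor_mono hle2), add_sub_cancel_left] at h2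
      have hpos : 0 < y * 8^(J+1) := by positivity
      have h3 : (∑ n ∈ Finset.Ioc ⌊y*8^J⌋₊ ⌊y*8^(J+1)⌋₊, thF n) / (y*8^(J+1)) ≤ ∑ n ∈ Finset.Ioc ⌊y*8^J⌋₊ ⌊y*8^(J+1)⌋₊, thF n / n := by
        rw [Finset.sum_div]
        refine Finset.sum_le_sum fun n hn => ?_
        rw [Finset.mem_Ioc] at hn
        have : (n:ℝ) ≤ y*8^(J+1) := (Nat.le_floor_iff hpos.le).1 hn.2
        have hn0 : (0:ℝ) < n := by have : 0 < n := by omega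
                                   exact_mod_cast this
        exact div_le_div_of_nonneg_left (thF_nonneg n) hn0 this
      have h4 : 1/8 ≤ (∑ n ∈ Finset.Ioc ⌊y*8^J⌋₊ ⌊y*8^(J+1)⌋₊, thF n) / (y*8^(J+1)) := by
        rw [le_div_iff₀ hpos]
        calc 1/8 * (y*8^(J+1)) = y*8^J := by ring
          _ ≤ _ := h2
      rw [h1]; push_cast; linarith
  set J := ⌊LL/12⌋₊
  have hJ1 : (J:ℝ) ≤ LL/12 := Nat.floor_le (by positivity)
  have hJ2 : LL/12 - 1 < J := Nat.sub_one_lt_floor _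
  have hend : y * 8^J ≤ Real.exp (13*LL/8) := by
    have : (8:ℝ)^J ≤ Real.exp (LL/4) := by
      have h8 : (8:ℝ) ≤ Real.exp 3 := by
        have := Real.exp_one_gt_d9
        have h : Real.exp 3 = Real.exp 1 ^ 3 := by rw [← Real.exp_nat_mul]; norm_num
        rw [h]
        calc (8:ℝ) = 2^3 := by norm_num
          _ ≤ _ := by gcongr; linarith
      calc (8:ℝ)^J ≤ (Real.exp 3)^J := by gcongr
        _ = Real.exp (J*3) := by rw [← Real.exp_nat_mul]
        _ ≤ _ := Real.exp_le_exp.2 (by linarith)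
    calc y * 8^J ≤ y * Real.exp (LL/4) := by gcongr
      _ = _ := by rw [← Real.exp_add]; congr 1; ring
  have hfin : S (y*8^J) ≤ XF f LL := by
    rw [hS, XF]
    have hsub : Finset.Ioc ⌊y⌋₊ ⌊y*8^J⌋₊ ⊆ rg LL := by
      intro n hn
      rw [Finset.mem_Ioc] at hn
      rw [rg, Finset.mem_range, Nat.lt_succ_iff]
      refine hn.2.trans (Nat.floor_mono (hend.trans (Real.exp_le_exp.2 (by linarith))))
    refine le_trans (Finset.sum_le_sum fun n hn => ?_) (Finset.sum_le_sum_of_subset_of_nonneg hsub fun n _ _ => gF_nonneg hf _ n)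
    rw [Finset.mem_Ioc] at hn
    have h1 : y ≤ n := (Nat.lt_of_floor_lt hn.1).le
    have h2 : (n:ℝ) ≤ Real.exp (13*LL/8) := ((Nat.le_floor_iff (by positivity)).1 hn.2).trans hend
    have hn0 : (0:ℝ) < n := (Real.exp_pos _).trans_le h1
    rw [gF, hf.one, mul_one_div]
    · rw [le_div_iff₀ h0, ← mul_comm, Real.le_log_iff_exp_le hn0]
      refine le_trans (Real.exp_le_exp.2 (by linarith)) h1
    · rw [div_le_iff₀ h0, Real.log_le_iff_le_exp hn0]
      refine h2.trans (Real.exp_le_exp.2 (by linarith))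
  have := hstep J
  linarith

end

end

section

open Complex MeasureTheory Filter Topology
open scoped ArithmeticFunction.vonMangoldt

lemma chSum_eq_sum {f : ℝ → ℝ} (hf : Cut f) {LL : ℝ} (hLL : 0 < LL) {r : ℕ} (χ : DirichletCharacter ℂ r) :
    chSum f LL χ = ∑ n ∈ rg LL, χ n * (Λ n : ℂ) / n * f (Real.log n / LL) := by
  rw [chSum]
  apply tsum_eq_sum
  intro n hn
  rw [hf.notMem hLL hn]; simp

lemma gF_coprime {f : ℝ → ℝ} (hf : Cut f) {LL : ℝ} (hLL : 0 < LL) {M : ℕ} (hM0 : M ≠ 0)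
    (hM : (M:ℝ) ≤ Real.exp LL) {n : ℕ} (hn : gF f LL n ≠ 0) : n.Coprime M := by
  have hp : n.Prime := by
    by_contra h; exact hn (by simp [gF, thF, h])
  have h1 := (hf.supp hLL (n := n) (fun h => hn (by rw [gF, h]; simp))).1
  rw [hp.coprime_iff_not_dvd]
  intro hd
  have := Nat.le_of_dvd (Nat.pos_of_ne_zero hM0) hd
  have h3 : (n:ℝ) ≤ M := by exact_mod_cast this
  have := Real.exp_lt_exp.2 (show LL < 5*LL/4 by linarith)
  linarith

lemma char_sum_gF {f : ℝ → ℝ} (hf : Cut f) {LL : ℝ} (hLL : 0 < LL) {M : ℕ} (hM0 : M ≠ 0)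
    (hM : (M:ℝ) ≤ Real.exp LL) (χ : DirichletCharacter ℂ M) :
    ‖∑ n ∈ rg LL, χ n * (gF f LL n : ℂ)‖ ≤ PPF f LL + ‖chSum f LL χ.primitiveCharacter‖ := by
  have h1 : ∑ n ∈ rg LL, χ n * (gF f LL n : ℂ) = chSum f LL χ.primitiveCharacter -
      ∑ n ∈ rg LL, χ.primitiveCharacter n * (((Λ n - thF n) * (f (Real.log n / LL) / n) : ℝ) : ℂ) := by
    rw [chSum_eq_sum hf hLL, ← Finset.sum_sub_distrib]
    refine Finset.sum_congr rfl fun n _ => ?_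
    have : χ n * (gF f LL n : ℂ) = χ.primitiveCharacter n * (gF f LL n : ℂ) := by
      by_cases h : gF f LL n = 0
      · simp [h]
      · have hc := gF_coprime hf hLL hM0 hM h
        have := DirichletCharacter.primitiveCharacter_apply_of_isCoprime χ (Nat.isCoprime_iff_coprime.2 hc)
        push_cast at this
        rw [this]
    rw [this, gF]
    push_cast
    ring
  rw [h1]
  refine (norm_sub_le _ _).trans ?_
  rw [add_comm]
  gcongr
  refine (norm_sum_le _ _).trans (Finset.sum_le_sum fun n _ => ?_)
  have h3 : 0 ≤ (Λ n - thF n) * (f (Real.log n / LL) / n) := 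
    mul_nonneg (sub_nonneg.2 (thF_le n)) (div_nonneg (hf.nonneg _) (by positivity))
  rw [norm_mul, Complex.norm_real, Real.norm_of_nonneg h3]
  exact mul_le_of_le_one_left h3 (DirichletCharacter.norm_le_one _ _)

/-- The error in arithmetic progressions. -/
noncomputable def ErrF (f : ℝ → ℝ) (LL : ℝ) (M : ℕ) : ℝ := 
  open Classical in
  if h : M = 0 then 0 else 
    haveI : NeZero M := ⟨h⟩
    PPF f LL + (1 / (M.totient:ℝ)) * 
    ∑ χ ∈ (Finset.univ : Finset (DirichletCharacter ℂ M)).erase 1, ‖chSum f LL χ.primitiveCharacter‖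

lemma ap_error {f : ℝ → ℝ} (hf : Cut f) {LL : ℝ} (hLL : 0 < LL) {M : ℕ} (hM0 : M ≠ 0)
    (hM : (M:ℝ) ≤ Real.exp LL) {c : ℕ} (hc : c.Coprime M) :
    |∑ n ∈ rg LL with n ≡ c [MOD M], gF f LL n - XF f LL / M.totient| ≤ ErrF f LL M := by
  classical
  have : NeZero M := ⟨hM0⟩
  have hφ : (0:ℝ) < M.totient := by exact_mod_cast Nat.totient_pos.2 (Nat.pos_of_ne_zero hM0)
  have hφc : (M.totient:ℂ) ≠ 0 := by exact_mod_cast hφ.ne'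
  have hu : IsUnit (c : ZMod M) := (ZMod.isUnit_iff_coprime c M).2 hc
  have h1 : (M.totient : ℂ) * ((∑ n ∈ rg LL with n ≡ c [MOD M], gF f LL n : ℝ) : ℂ) = 
      ∑ χ : DirichletCharacter ℂ M, χ (c : ZMod M)⁻¹ * ∑ n ∈ rg LL, χ n * (gF f LL n : ℂ) := by
    simp_rw [Finset.mul_sum]
    rw [Finset.sum_comm]
    rw [Finset.sum_filter]
    push_cast
    rw [Finset.mul_sum]
    refine Finset.sum_congr rfl fun n _ => ?_
    simp_rw [← mul_assoc]
    rw [← Finset.sum_mul, DirichletCharacter.sum_char_inv_mul_char_eq ℂ hu]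
    have : (n ≡ c [MOD M]) ↔ ((c : ZMod M) = n) := by
      rw [← ZMod.natCast_eq_natCast_iff, eq_comm]
    by_cases h : (c : ZMod M) = n
    · simp [h, this]
    · simp [h, this]
  have h2 : (1 : DirichletCharacter ℂ M) (c : ZMod M)⁻¹ * ∑ n ∈ rg LL, (1 : DirichletCharacter ℂ M) n * (gF f LL n : ℂ) = XF f LL := by
    have hui : IsUnit (c : ZMod M)⁻¹ := by
      rw [← ZMod.coe_unitOfCoprime c hc, ZMod.inv_coe_unit]; exact Units.isUnit _
    rw [MulChar.one_apply hui, one_mul, XF]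
    push_cast
    refine Finset.sum_congr rfl fun n _ => ?_
    by_cases h : gF f LL n = 0
    · simp [h]
    · rw [MulChar.one_apply ((ZMod.isUnit_iff_coprime n M).2 (gF_coprime hf hLL hM0 hM h)), one_mul]
  rw [← Finset.add_sum_erase _ _ (Finset.mem_univ (1 : DirichletCharacter ℂ M)), h2] at h1
  rw [ErrF, dif_neg hM0]
  have h3 : ((∑ n ∈ rg LL with n ≡ c [MOD M], gF f LL n - XF f LL / M.totient : ℝ) : ℂ) = 
      (1 / (M.totient : ℂ)) * ∑ χ ∈ (Finset.univ : Finset (DirichletCharacter ℂ M)).erase 1, χ (c : ZMod M)⁻¹ * ∑ n ∈ rg LL, χ n * (gF f LL n : ℂ) := by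
    rw [← sub_eq_iff_eq_add'] at h1
    rw [← h1]; push_cast; field_simp
  rw [← Real.norm_eq_abs, ← Complex.norm_real, h3, norm_mul]
  have h4 : ‖(1 / (M.totient : ℂ))‖ = 1 / (M.totient:ℝ) := by simp
  rw [h4]
  have h5 : ‖∑ χ ∈ (Finset.univ : Finset (DirichletCharacter ℂ M)).erase 1, χ (c : ZMod M)⁻¹ * ∑ n ∈ rg LL, χ n * (gF f LL n : ℂ)‖
      ≤ M.totient * PPF f LL + ∑ χ ∈ (Finset.univ : Finset (DirichletCharacter ℂ M)).erase 1, ‖chSum f LL χ.primitiveCharacter‖ := by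
    refine (norm_sum_le _ _).trans ?_
    calc _ ≤ ∑ χ ∈ (Finset.univ : Finset (DirichletCharacter ℂ M)).erase 1, (PPF f LL + ‖chSum f LL χ.primitiveCharacter‖) := by
          refine Finset.sum_le_sum fun χ _ => ?_
          rw [norm_mul]
          refine (mul_le_of_le_one_left (norm_nonneg _) (DirichletCharacter.norm_le_one _ _)).trans (char_sum_gF hf hLL hM0 hM χ)
      _ ≤ _ := by
          rw [Finset.sum_add_distrib, Finset.sum_const, nsmul_eq_mul]
          gcongr
          · exact PPF_nonneg hf LL
          · refine (Finset.card_le_card (Finset.erase_subset _ _)).trans ?_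
            rw [Finset.card_univ, ← Nat.card_eq_fintype_card, DirichletCharacter.card_eq_totient_of_hasEnoughRootsOfUnity]
  calc _ ≤ 1 / (M.totient:ℝ) * (M.totient * PPF f LL + ∑ χ ∈ (Finset.univ : Finset (DirichletCharacter ℂ M)).erase 1, ‖chSum f LL χ.primitiveCharacter‖) := by gcongr
    _ = _ := by field_simp

lemma ErrF_nonneg {f : ℝ → ℝ} (hf : Cut f) (LL : ℝ) (M : ℕ) : 0 ≤ ErrF f LL M := by
  rw [ErrF]; split_ifs
  · rfl
  · exact add_nonneg (PPF_nonneg hf LL) (mul_nonneg (by positivity) (Finset.sum_nonneg fun _ _ => norm_nonneg _))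

end

section

open Filter Topology

/-- Product over prime factors. -/
noncomputable def ph {R : Type*} [CommMonoid R] (g : ℕ → R) (n : ℕ) : R := ∏ p ∈ n.primeFactors, g p

lemma ph_mul {R : Type*} [CommMonoid R] (g : ℕ → R) {a b : ℕ} (h : a.Coprime b) : ph g (a*b) = ph g a * ph g b := by
  rw [ph, h.primeFactors_mul, Finset.prod_union h.disjoint_primeFactors]; rfl

lemma ph_one {R : Type*} [CommMonoid R] (g : ℕ → R) : ph g 1 = 1 := by simp [ph]

lemma ph_prime {R : Type*} [CommMonoid R] (g : ℕ → R) {p : ℕ} (hp : p.Prime) : ph g p = g p := by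
  simp [ph, hp.primeFactors]

lemma sum_divisors_ph {R : Type*} [CommSemiring R] (g : ℕ → R) {n : ℕ} (hn : Squarefree n) :
    ∑ d ∈ n.divisors, ph g d = ph (fun p => 1 + g p) n := by
  classical
  have := ArithmeticFunction.IsMultiplicative.prodPrimeFactors_one_add_of_squarefree
    (h_mult := ArithmeticFunction.IsMultiplicative.prodPrimeFactors g) hn
  rw [ph]
  rw [Finset.prod_congr rfl (g := fun p => 1 + (ArithmeticFunction.prodPrimeFactors g) p), this]
  · refine Finset.sum_congr rfl fun d hd => ?_
    rw [ArithmeticFunction.prodPrimeFactors_apply (Nat.pos_of_mem_divisors hd).ne']; rfl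
  · intro p hp
    have hp := Nat.prime_of_mem_primeFactors hp
    rw [ArithmeticFunction.prodPrimeFactors_apply hp.ne_zero, hp.primeFactors]; simp

lemma sum_le_of_inj {α β : Type*} {s : Finset α} {t : Finset β} {F : α → ℝ} {G : β → ℝ} (e : α → β)
    (h1 : ∀ a ∈ s, e a ∈ t) (h2 : Set.InjOn e s) (h3 : ∀ a ∈ s, F a ≤ G (e a)) (h4 : ∀ b ∈ t, 0 ≤ G b) :
    ∑ a ∈ s, F a ≤ ∑ b ∈ t, G b := by
  classical
  calc _ ≤ ∑ a ∈ s, G (e a) := Finset.sum_le_sum h3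
    _ = ∑ b ∈ s.image e, G b := (Finset.sum_image h2).symm
    _ ≤ _ := Finset.sum_le_sum_of_subset_of_nonneg (Finset.image_subset_iff.2 h1) fun b hb _ => h4 b hb

lemma ph_nonneg {g : ℕ → ℝ} {n : ℕ} (h : ∀ p ∈ n.primeFactors, 0 ≤ g p) : 0 ≤ ph g n := Finset.prod_nonneg h

lemma sum_sqfree_le (K y : ℕ) (hy : 1 ≤ y) :
    ∑ q ∈ Finset.Icc 1 y with Squarefree q, ph (fun _ => (K:ℝ)) q / q ≤ (1 + Real.log y)^K := by
  induction K with
  | zero =>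
    rw [pow_zero]
    calc _ ≤ ∑ q ∈ ({1} : Finset ℕ), (1:ℝ) := by
          rw [← Finset.sum_filter_ne_zero]
          refine (Finset.sum_le_sum (g := fun _ => (1:ℝ)) fun q hq => ?_).trans (Finset.sum_le_sum_of_subset_of_nonneg ?_ fun _ _ _ => zero_le_one)
          · have h1 := (Finset.mem_filter.1 (Finset.mem_filter.1 hq).1).1
            rw [Finset.mem_Icc] at h1
            rw [ph, Finset.prod_const]
            apply div_le_one_of_le₀ _ (by positivity)
            refine (pow_le_one₀ (by simp) (by simp)).trans ?_
            exact_mod_cast h1.1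
          · intro q hq
            rw [Finset.mem_filter, Finset.mem_filter] at hq
            rw [Finset.mem_singleton]
            by_contra h
            have h1 := (Finset.mem_Icc.1 hq.1.1).1
            have : q.primeFactors.card ≠ 0 := by
              rw [Finset.card_ne_zero, Nat.nonempty_primeFactors]; omega
            apply hq.2
            rw [ph, Finset.prod_const]; simp [this]
      _ = 1 := by simp
  | succ K ih =>
    have hlog : 0 ≤ Real.log y := Real.log_natCast_nonneg y
    set S := (Finset.Icc 1 y).filter Squarefree
    have h0 : ∀ d, 0 ≤ ph (fun _ => (K:ℝ)) d := fun d => ph_nonneg fun _ _ => by positivity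
    calc ∑ q ∈ S, ph (fun _ => ((K+1:ℕ):ℝ)) q / q = ∑ q ∈ S, ∑ d ∈ q.divisors, ph (fun _ => (K:ℝ)) d / q := by
          refine Finset.sum_congr rfl fun q hq => ?_
          rw [← Finset.sum_div, sum_divisors_ph _ (Finset.mem_filter.1 hq).2]
          congr 2; ext p; push_cast; ring
      _ = ∑ x ∈ S.sigma (fun q => q.divisors), ph (fun _ => (K:ℝ)) x.2 / x.1 := by rw [Finset.sum_sigma]
      _ ≤ ∑ x ∈ S ×ˢ Finset.Icc 1 y, (ph (fun _ => (K:ℝ)) x.1 / x.1) * (1/(x.2:ℝ)) := by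
          refine sum_le_of_inj (fun x => (x.2, x.1 / x.2)) ?_ ?_ ?_ ?_
          · rintro ⟨q, d⟩ hx
            simp only [Finset.mem_sigma, S, Finset.mem_filter, Finset.mem_Icc, Nat.mem_divisors] at hx
            obtain ⟨⟨⟨h1, h2⟩, h3⟩, ⟨m, rfl⟩, h4⟩ := hx
            have hd : 0 < d := by by_contra h; simp_all
            have hm : 0 < m := by by_contra h; simp_all
            simp only [Finset.mem_product, S, Finset.mem_filter, Finset.mem_Icc]
            rw [Nat.mul_div_cancel_left _ hd]
            refine ⟨⟨⟨hd, ?_⟩, h3.squarefree_of_dvd (dvd_mul_right _ _)⟩, hm, ?_⟩ <;> nlinarith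
          · rintro ⟨q, d⟩ hx ⟨q', d'⟩ hx' h
            simp only [Finset.coe_sigma, Set.mem_sigma_iff, Finset.mem_coe, Nat.mem_divisors] at hx hx'
            simp only [Prod.mk.injEq] at h
            obtain ⟨rfl, h⟩ := h
            have : q = q' := by
              rw [← Nat.div_mul_cancel hx.2.1, h, Nat.div_mul_cancel hx'.2.1]
            subst this; rfl
          · rintro ⟨q, d⟩ hx
            simp only [Finset.mem_sigma, Nat.mem_divisors] at hx
            obtain ⟨_, ⟨m, rfl⟩, h4⟩ := hx
            have hd : 0 < d := by by_contra h; simp_all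
            have hm : 0 < m := by by_contra h; simp_all
            simp only
            rw [Nat.mul_div_cancel_left _ hd]
            push_cast
            rw [div_mul_div_comm, mul_one]
          · rintro ⟨d, m⟩ _
            exact mul_nonneg (div_nonneg (h0 d) (by positivity)) (by positivity)
      _ = (∑ q ∈ S, ph (fun _ => (K:ℝ)) q / q) * ∑ m ∈ Finset.Icc 1 y, 1/(m:ℝ) := by
          rw [Finset.sum_product, Finset.sum_mul_sum]
      _ ≤ (1 + Real.log y)^K * (1 + Real.log y) := by
          gcongr
          have := harmonic_le_one_add_log y
          rw [harmonic_eq_sum_Icc] at this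
          push_cast at this
          simpa using this
      _ = _ := by rw [pow_succ]

lemma totient_sqfree {q : ℕ} (hq : Squarefree q) : (q.totient : ℝ) = ph (fun p => ((p:ℝ) - 1)) q := by
  have h := Nat.totient_mul_prod_primeFactors q
  rw [Nat.prod_primeFactors_of_squarefree hq, mul_comm] at h
  rw [Nat.eq_of_mul_eq_mul_left (Nat.pos_of_ne_zero hq.ne_zero) h, ph]
  push_cast
  refine Finset.prod_congr rfl fun p hp => ?_
  rw [Nat.cast_sub (Nat.prime_of_mem_primeFactors hp).one_le]; simp

lemma cast_sqfree {q : ℕ} (hq : Squarefree q) : (q : ℝ) = ph (fun p => (p:ℝ)) q := by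
  conv_lhs => rw [← Nat.prod_primeFactors_of_squarefree hq]
  rw [ph]; push_cast; rfl

/-- Squarefree moduli coprime to `W`. -/
def QQ (W y : ℕ) : Finset ℕ := (Finset.Icc 1 y).filter fun q => Squarefree q ∧ q.Coprime W

/-- multiplicative weight `B^ω(q)/φ(q)` on squarefrees -/
noncomputable def gB (B : ℕ) : ℕ → ℝ := fun p => (B:ℝ) / ((p:ℝ) - 1)

/-- multiplicative weight `B^ω(q)` -/
noncomputable def wB (B : ℕ) (q : ℕ) : ℝ := ph (fun _ => (B:ℝ)) q

lemma wB_nonneg (B q : ℕ) : 0 ≤ wB B q := ph_nonneg fun _ _ => by positivity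

lemma gB_nonneg (B : ℕ) {q : ℕ} : 0 ≤ ph (gB B) q := ph_nonneg fun p hp => by
  have : (1:ℝ) ≤ p := by exact_mod_cast (Nat.prime_of_mem_primeFactors hp).one_le
  exact div_nonneg (by positivity) (by linarith)

lemma gB_eq (B : ℕ) {q : ℕ} (hq : Squarefree q) : ph (gB B) q = wB B q / q.totient := by
  rw [totient_sqfree hq, wB, ph, ph, ph, ← Finset.prod_div_distrib]; rfl

lemma sum_gB_le (B W y : ℕ) (hy : 1 ≤ y) : ∑ q ∈ QQ W y, ph (gB B) q ≤ (1 + Real.log y)^(2*B) := by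
  refine le_trans ?_ (sum_sqfree_le (2*B) y hy)
  refine (Finset.sum_le_sum fun q hq => ?_).trans (Finset.sum_le_sum_of_subset_of_nonneg (s := QQ W y) ?_ ?_)
  · rw [QQ, Finset.mem_filter] at hq
    conv_rhs => rw [cast_sqfree hq.2.1]
    rw [ph, ph, ph, ← Finset.prod_div_distrib]
    refine Finset.prod_le_prod ?_ ?_
    · intro p hp
      have : (1:ℝ) ≤ p := by exact_mod_cast (Nat.prime_of_mem_primeFactors hp).one_le
      exact div_nonneg (by positivity) (by linarith)
    · intro p hp
      have : (2:ℝ) ≤ p := by exact_mod_cast (Nat.prime_of_mem_primeFactors hp).two_le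
      rw [gB, div_le_div_iff₀ (by linarith) (by linarith)]
      have : (0:ℝ) ≤ B := by positivity
      push_cast
      nlinarith
  · intro q hq
    simp only [QQ, Finset.mem_filter] at hq ⊢
    exact ⟨hq.1, hq.2.1⟩
  · intro q _ _
    exact div_nonneg (ph_nonneg fun _ _ => by positivity) (by positivity)

/-- all primes not dividing `W` are large -/
def WBig (B W : ℕ) : Prop := ∀ p : ℕ, p.Prime → ¬ p ∣ W → 4 * B^2 ≤ p

lemma WBig.prime {B W q : ℕ} (h : WBig B W) (hq : q.Coprime W) {p : ℕ} (hp : p ∈ q.primeFactors) : 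
    p.Prime ∧ 4 * B^2 ≤ p := by
  have hpp := Nat.prime_of_mem_primeFactors hp
  refine ⟨hpp, h p hpp fun hd => ?_⟩
  have := Nat.dvd_gcd (Nat.dvd_of_mem_primeFactors hp) hd
  rw [hq] at this
  exact hpp.one_lt.ne' (Nat.dvd_one.1 this)

lemma WBig.wB_le {B W q : ℕ} (h : WBig B W) (hq : q.Coprime W) (hs : Squarefree q) : wB B q ≤ q := by
  rw [cast_sqfree hs, wB]
  refine Finset.prod_le_prod (fun _ _ => by positivity) fun p hp => ?_
  have := (h.prime hq hp).2
  have : B ≤ p := by nlinarith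
  exact_mod_cast this

lemma WBig.gB_le {B W q : ℕ} (h : WBig B W) (hq : q.Coprime W) (hs : Squarefree q) : ph (gB B) q ≤ 1 / √q := by
  have : 1 / √(q:ℝ) = ph (fun p => 1/√(p:ℝ)) q := by
    conv_lhs => rw [cast_sqfree hs]
    rw [ph, ph, Finset.prod_div_distrib, Finset.prod_const_one, Real.sqrt_prod]
    intro _ _; positivity
  rw [this]
  refine Finset.prod_le_prod (fun p hp => ?_) fun p hp => ?_
  · have : (1:ℝ) ≤ p := by exact_mod_cast (Nat.prime_of_mem_primeFactors hp).one_le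
    exact div_nonneg (by positivity) (by linarith)
  · obtain ⟨h1, h2⟩ := h.prime hq hp
    have h3 : (2:ℝ) ≤ p := by exact_mod_cast h1.two_le
    have h4 : (2 * (B:ℝ))^2 ≤ p := by
      have : ((4 * B^2 : ℕ):ℝ) ≤ p := by exact_mod_cast h2
      push_cast at this; linarith
    have h5 := Real.le_sqrt_of_sq_le h4
    have h6 := Real.mul_self_sqrt (show (0:ℝ) ≤ p by linarith)
    rw [gB, div_le_div_iff₀ (by linarith) (by positivity)]
    nlinarith [Real.sqrt_nonneg (p:ℝ)]

lemma sum_gB_dvd {B W y r : ℕ} (h : WBig B W) (hW : W ≠ 0) (hy : 1 ≤ y) (hr : r ≠ 0) :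
    ∑ q ∈ QQ W y with r ∣ W * q, wB B q / (W*q).totient ≤ √W * (1 + Real.log y)^(2*B) / √r := by
  set g := r.gcd W
  have hg : 0 < g := Nat.gcd_pos_of_pos_left _ (Nat.pos_of_ne_zero hr)
  set r' := r / g
  have hr' : r' * g = r := Nat.div_mul_cancel (Nat.gcd_dvd_left _ _)
  have hr'0 : 0 < r' := by
    rcases Nat.eq_zero_or_pos r' with h0 | h0
    · rw [h0] at hr'; simp at hr'; exact absurd hr'.symm hr
    · exact h0
  have hdv : ∀ q, r ∣ W * q → r' ∣ q := by
    intro q hq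
    have h1 : r' * g ∣ (W / g * q) * g := by
      rw [hr']
      have : W / g * q * g = W * q := by
        rw [mul_right_comm, Nat.div_mul_cancel (Nat.gcd_dvd_right _ _)]
      rwa [this]
    have h2 := Nat.dvd_of_mul_dvd_mul_right hg h1
    have h3 : r'.Coprime (W / g) := Nat.coprime_div_gcd_div_gcd hg
    exact h3.dvd_of_dvd_mul_left h2
  by_cases hne : ((QQ W y).filter fun q => r ∣ W * q) = ∅
  · rw [hne, Finset.sum_empty]
    have := Real.log_natCast_nonneg y
    positivity
  obtain ⟨q0, hq0⟩ := Finset.nonempty_iff_ne_empty.2 hne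
  simp only [QQ, Finset.mem_filter] at hq0
  have hr's : Squarefree r' := hq0.1.2.1.squarefree_of_dvd (hdv _ hq0.2)
  have hr'W : r'.Coprime W := Nat.Coprime.coprime_dvd_left (hdv _ hq0.2) hq0.1.2.2
  have h1 : ∑ q ∈ QQ W y with r ∣ W * q, wB B q / (W*q).totient ≤ ∑ q ∈ QQ W y, ph (gB B) r' * ph (gB B) q := by
    refine sum_le_of_inj (fun q => q / r') ?_ ?_ ?_ ?_
    · intro q hq
      simp only [QQ, Finset.mem_filter, Finset.mem_Icc] at hq ⊢
      obtain ⟨m, rfl⟩ := hdv _ hq.2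
      rw [Nat.mul_div_cancel_left _ hr'0]
      have hm : 0 < m := by
        rcases Nat.eq_zero_or_pos m with h0 | h0
        · simp [h0] at hq
        · exact h0
      refine ⟨⟨hm, ?_⟩, hq.1.2.1.squarefree_of_dvd (dvd_mul_left _ _), Nat.Coprime.coprime_dvd_left (dvd_mul_left _ _) hq.1.2.2⟩
      nlinarith
    · intro q hq q' hq' heq
      simp only [Finset.coe_filter, Set.mem_ofPred_eq] at hq hq'
      simp only at heq
      rw [← Nat.div_mul_cancel (hdv _ hq.2), heq, Nat.div_mul_cancel (hdv _ hq'.2)]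
    · intro q hq
      simp only [QQ, Finset.mem_filter, Finset.mem_Icc] at hq
      have hd := hdv _ hq.2
      have hsq := hq.1.2.1
      have hc : r'.Coprime (q / r') := by
        have : Squarefree (r' * (q / r')) := by rwa [Nat.mul_div_cancel' hd]
        exact Nat.coprime_of_squarefree_mul this
      rw [← ph_mul _ hc, Nat.mul_div_cancel' hd, gB_eq B hsq]
      apply div_le_div_of_nonneg_left (wB_nonneg _ _)
      · exact_mod_cast Nat.totient_pos.2 hq.1.1.1
      · rw [Nat.totient_mul hq.1.2.2.symm]
        exact_mod_cast Nat.le_mul_of_pos_left _ (Nat.totient_pos.2 (Nat.pos_of_ne_zero hW))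
    · intro q _
      exact mul_nonneg (gB_nonneg B) (gB_nonneg B)
  rw [← Finset.mul_sum] at h1
  refine h1.trans ?_
  have h2 : 1 / √(r':ℝ) ≤ √W / √r := by
    rw [div_le_div_iff₀ (by positivity) (by positivity), one_mul, ← Real.sqrt_mul (by positivity)]
    apply Real.sqrt_le_sqrt
    have : g ≤ W := Nat.le_of_dvd (Nat.pos_of_ne_zero hW) (Nat.gcd_dvd_right _ _)
    have : r ≤ W * r' := by rw [← hr', mul_comm]; exact Nat.mul_le_mul_right _ this
    exact_mod_cast this
  have hl := Real.log_natCast_nonneg y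
  calc _ ≤ (√W / √r) * (1 + Real.log y)^(2*B) := by
        gcongr
        · exact Finset.sum_nonneg fun _ _ => gB_nonneg B
        · exact (h.gB_le hr'W hr's).trans h2
        · exact sum_gB_le B W y hy
    _ = _ := by ring

end

section

open Filter Topology

lemma finite_dc (r : ℕ) : Finite (DirichletCharacter ℂ r) := by
  rcases Nat.eq_zero_or_pos r with h | h
  · subst h
    have : Finite (ZMod 0)ˣ := inferInstanceAs (Finite ℤˣ)
    infer_instance
  · have : NeZero r := ⟨h.ne'⟩
    infer_instance

/-- primitive characters modulo `r` -/
noncomputable def prims (r : ℕ) : Finset (DirichletCharacter ℂ r) :=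
  have := finite_dc r
  (Set.toFinite {χ : DirichletCharacter ℂ r | χ.IsPrimitive}).toFinset

lemma mem_prims {r : ℕ} {χ : DirichletCharacter ℂ r} : χ ∈ prims r ↔ χ.IsPrimitive := by
  simp [prims]

/-- primitive characters of conductor in `[2,D]` -/
noncomputable def XX (D : ℕ) : Finset (Σ r : ℕ, DirichletCharacter ℂ r) := (Finset.Icc 2 D).sigma prims

lemma mem_XX {D : ℕ} {p : Σ r : ℕ, DirichletCharacter ℂ r} : p ∈ XX D ↔ (1 < p.1 ∧ p.1 ≤ D) ∧ p.2.IsPrimitive := by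
  rw [XX, Finset.mem_sigma, mem_prims, Finset.mem_Icc]; rfl

lemma card_XX (D : ℕ) : (XX D).card ≤ D^2 := by
  rw [XX, Finset.card_sigma]
  calc _ ≤ ∑ r ∈ Finset.Icc 2 D, D := by
        refine Finset.sum_le_sum fun r hr => ?_
        rw [Finset.mem_Icc] at hr
        have : NeZero r := ⟨by omega⟩
        have := finite_dc r
        calc (prims r).card ≤ Nat.card (DirichletCharacter ℂ r) := by
              have := Fintype.ofFinite (DirichletCharacter ℂ r)
              rw [Nat.card_eq_fintype_card]; exact Finset.card_le_univ _
          _ = r.totient := DirichletCharacter.card_eq_totient_of_hasEnoughRootsOfUnity ℂ r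
          _ ≤ r := Nat.totient_le r
          _ ≤ D := hr.2
    _ ≤ D^2 := by
        rw [Finset.sum_const, smul_eq_mul, pow_two, Nat.card_Icc]
        exact Nat.mul_le_mul_right _ (by omega)

lemma sum_primitive_le {M D : ℕ} [NeZero M] (hMD : M ≤ D) (F : (Σ r : ℕ, DirichletCharacter ℂ r) → ℝ) (hF : ∀ p, 0 ≤ F p) 
    (S : Finset (DirichletCharacter ℂ M)) (hS : 1 ∉ S) :
    ∑ χ ∈ S, F ⟨χ.conductor, χ.primitiveCharacter⟩ ≤ ∑ p ∈ XX D with p.1 ∣ M, F p := by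
  refine sum_le_of_inj (fun χ => (⟨χ.conductor, χ.primitiveCharacter⟩ : Σ r : ℕ, DirichletCharacter ℂ r)) ?_ ?_ ?_ ?_
  · intro χ hχ
    rw [Finset.mem_filter, mem_XX]
    refine ⟨⟨⟨?_, ?_⟩, χ.primitiveCharacter_isPrimitive⟩, χ.conductor_dvd_level⟩
    · have h0 : χ.conductor ≠ 0 := DirichletCharacter.conductor_ne_zero χ
      have h1 : χ.conductor ≠ 1 := fun h => hS (((DirichletCharacter.eq_one_iff_conductor_eq_one).2 h) ▸ hχ)
      show 1 < χ.conductor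
      omega
    · exact (Nat.le_of_dvd (Nat.pos_of_ne_zero (NeZero.ne M)) χ.conductor_dvd_level).trans hMD
  · intro χ _ χ' _ h
    have key : ∀ (a b : Σ r : ℕ, DirichletCharacter ℂ r), a = b → ∀ (ha : a.1 ∣ M) (hb : b.1 ∣ M), 
        DirichletCharacter.changeLevel ha a.2 = DirichletCharacter.changeLevel hb b.2 := by
      rintro a b rfl _ _; rfl
    have := key _ _ h χ.conductor_dvd_level χ'.conductor_dvd_level
    simpa only [DirichletCharacter.changeLevel_primitiveCharacter] using this
  · intro _ _; exact le_rfl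
  · intro p _; exact hF p

lemma bv_swap {f : ℝ → ℝ} (hf : Cut f) {LL : ℝ} {B W y D : ℕ} (h : WBig B W) (hW : W ≠ 0) (hy : 1 ≤ y) (hD : W * y ≤ D) :
    ∑ q ∈ QQ W y, wB B q * ErrF f LL (W*q) ≤ (y:ℝ)^2 * PPF f LL + 
      √W * (1 + Real.log y)^(2*B) * ∑ p ∈ XX D, ‖chSum f LL p.2‖ / √(p.1:ℝ) := by
  have hmem : ∀ q ∈ QQ W y, 1 ≤ q ∧ q ≤ y ∧ Squarefree q ∧ q.Coprime W := by
    intro q hq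
    simpa [QQ, and_assoc] using hq
  have h1 : ∀ q ∈ QQ W y, wB B q * ErrF f LL (W*q) ≤ y * PPF f LL + 
      ∑ p ∈ XX D, (if p.1 ∣ W * q then wB B q / (W*q).totient * ‖chSum f LL p.2‖ else 0) := by
    intro q hq
    obtain ⟨h1, h2, h3, h4⟩ := hmem q hq
    have h0 : W * q ≠ 0 := mul_ne_zero hW (by omega)
    have : NeZero (W*q) := ⟨h0⟩
    rw [ErrF, dif_neg h0, mul_add]
    refine add_le_add ?_ ?_
    · refine mul_le_mul_of_nonneg_right ((h.wB_le h4 h3).trans (by exact_mod_cast h2)) (PPF_nonneg hf LL)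
    · rw [← Finset.sum_filter, ← Finset.mul_sum, ← mul_assoc, mul_one_div]
      refine mul_le_mul_of_nonneg_left ?_ (div_nonneg (wB_nonneg _ _) (by positivity))
      refine sum_primitive_le (le_trans (Nat.mul_le_mul_left _ h2) hD) (fun p => ‖chSum f LL p.2‖) (fun p => norm_nonneg _) _ ?_
      simp
  refine (Finset.sum_le_sum h1).trans ?_
  rw [Finset.sum_add_distrib, Finset.sum_const, nsmul_eq_mul, Finset.sum_comm]
  refine add_le_add ?_ ?_
  · rw [pow_two, mul_assoc]
    have : (QQ W y).card ≤ y := by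
      refine (Finset.card_filter_le _ _).trans (by simp)
    have hP := PPF_nonneg hf LL
    gcongr
  · rw [Finset.mul_sum]
    refine Finset.sum_le_sum fun p hp => ?_
    rw [← Finset.sum_filter, ← Finset.sum_mul]
    have hp1 := (mem_XX.1 hp).1.1
    refine (mul_le_mul_of_nonneg_right (sum_gB_dvd h hW hy (show p.1 ≠ 0 by omega)) (norm_nonneg _)).trans (le_of_eq ?_)
    ring

lemma bv_split {f : ℝ → ℝ} {LL : ℝ} {D : ℕ} {Q a S : ℝ} (hQ : 1 ≤ Q) (ha : 0 ≤ a)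
    (hsmall : ∀ p ∈ XX D, (p.1:ℝ) ≤ Q → ‖chSum f LL p.2‖ ≤ a)
    (hlarge : ∑ p ∈ XX D, ‖chSum f LL p.2‖ ≤ S) :
    ∑ p ∈ XX D, ‖chSum f LL p.2‖ / √(p.1:ℝ) ≤ Q^2 * a + S / √Q := by
  rw [← Finset.sum_filter_add_sum_filter_not _ (fun p : Σ r : ℕ, DirichletCharacter ℂ r => (p.1:ℝ) ≤ Q)]
  refine add_le_add ?_ ?_
  · have hc : (((XX D).filter fun p => (p.1:ℝ) ≤ Q).card : ℝ) ≤ Q^2 := by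
      have h1 : (XX D).filter (fun p => (p.1:ℝ) ≤ Q) ⊆ XX ⌊Q⌋₊ := by
        intro p hp
        rw [Finset.mem_filter, mem_XX] at hp
        rw [mem_XX]
        exact ⟨⟨hp.1.1.1, Nat.le_floor hp.2⟩, hp.1.2⟩
      have h2 := (Finset.card_le_card h1).trans (card_XX _)
      have h3 : (((XX D).filter fun p => (p.1:ℝ) ≤ Q).card : ℝ) ≤ (⌊Q⌋₊:ℝ)^2 := by exact_mod_cast h2
      refine h3.trans ?_
      gcongr
      exact Nat.floor_le (by linarith)
    calc _ ≤ ∑ p ∈ (XX D).filter (fun p => (p.1:ℝ) ≤ Q), a := by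
          refine Finset.sum_le_sum fun p hp => ?_
          rw [Finset.mem_filter] at hp
          have h1 : (1:ℝ) ≤ √(p.1:ℝ) := by
            rw [Real.one_le_sqrt]
            have := (mem_XX.1 hp.1).1.1
            exact_mod_cast this.le
          exact (div_le_self (norm_nonneg _) h1).trans (hsmall p hp.1 hp.2)
      _ ≤ _ := by rw [Finset.sum_const, nsmul_eq_mul]; gcongr
  · have hS : 0 ≤ S := le_trans (Finset.sum_nonneg fun _ _ => norm_nonneg _) hlarge
    calc _ ≤ ∑ p ∈ (XX D).filter (fun p => ¬ (p.1:ℝ) ≤ Q), ‖chSum f LL p.2‖ / √Q := by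
          refine Finset.sum_le_sum fun p hp => ?_
          rw [Finset.mem_filter, not_le] at hp
          have : √Q ≤ √(p.1:ℝ) := Real.sqrt_le_sqrt hp.2.le
          have : 0 < √Q := Real.sqrt_pos.2 (by linarith)
          gcongr
      _ ≤ ∑ p ∈ XX D, ‖chSum f LL p.2‖ / √Q := 
          Finset.sum_le_sum_of_subset_of_nonneg (Finset.filter_subset _ _) fun _ _ _ => by positivity
      _ ≤ _ := by rw [← Finset.sum_div]; gcongr

end

section

open Filter Topology

theorem bv {f : ℝ → ℝ} {φ : ℝ → ℂ} (hf : Cut f) (h : LapRep f φ) {K : ℝ} (hK : 0 ≤ K)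
    (hlip : ∀ s t, |f s - f t| ≤ K * |s - t|) (B W A0 : ℕ) (hB : WBig B W) (hW : W ≠ 0) (LL0 : ℝ) :
    ∃ LL ≥ LL0, ∑ q ∈ QQ W ⌊Real.exp (LL/100)⌋₊, wB B q * ErrF f LL (W*q) ≤ 1 / LL^A0 := by
  have h0 : ∀ t < 1, f t = 0 := fun t ht => hf.lo t (by linarith)
  have h2 : ∀ t, 2 < t → f t = 0 := fun t ht => hf.hi t (by linarith)
  have h1 : ∀ t, |f t| ≤ 1 := fun t => abs_le.2 ⟨by linarith [hf.nonneg t], hf.le_one t⟩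
  obtain ⟨C, hC, hlarge⟩ := large_conductor h hK h0 h2 h1 hlip
  set a := A0 + 2*B + 7 with ha
  set A := 2 * a with hA
  set j := 2*A + A0 + 2*B + 4 with hj
  obtain ⟨K1, hK1, hsmall⟩ := small_conductor h h0 (2*j)
  have hApos : (0:ℝ) < A := by rw [hA, ha]; positivity
  -- eventual conditions
  have e1 : ∀ᶠ ℓ : ℝ in atTop, 2 * (64 * ℓ^10 * 2^70) ≤ √(Real.exp (ℓ/A)) := by
    have t := Real.tendsto_pow_mul_exp_neg_atTop_nhds_zero 10
    have t2 : Tendsto (fun ℓ : ℝ => ℓ/(2*A)) atTop atTop := tendsto_id.atTop_div_const (by positivity)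
    have t3 := (t.comp t2).eventually (gt_mem_nhds (show (0:ℝ) < 1 / (2 * 64 * 2^70 * (2*A)^10) by positivity))
    filter_upwards [t3] with ℓ hℓ
    simp only [Function.comp] at hℓ
    rw [← Real.exp_half, show ℓ/A/2 = ℓ/(2*A) by field_simp]
    rw [Real.exp_neg, lt_div_iff₀ (by positivity), div_pow] at hℓ
    have hp := Real.exp_pos (ℓ/(2*A))
    field_simp at hℓ
    linarith
  have e2 : ∀ᶠ LL : ℝ in atTop, LL^A0 * (4 * LL * Real.exp (-(LL/4))) ≤ 1/2 := by
    have t := Real.tendsto_pow_mul_exp_neg_atTop_nhds_zero (A0+1)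
    have t2 : Tendsto (fun ℓ : ℝ => ℓ/4) atTop atTop := tendsto_id.atTop_div_const (by positivity)
    have t3 := (t.comp t2).eventually (gt_mem_nhds (show (0:ℝ) < 1 / (8 * 4^(A0+1)) by positivity))
    filter_upwards [t3] with ℓ hℓ
    simp only [Function.comp] at hℓ
    rw [div_pow, div_mul_eq_mul_div, div_lt_div_iff₀ (by positivity) (by positivity)] at hℓ
    rw [pow_succ] at hℓ
    have : (0:ℝ) < 4^(A0+1) := by positivity
    have h3 : ℓ ^ A0 * ℓ * Real.exp (-(ℓ/4)) * 8 < 1 := by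
      by_contra hc
      push Not at hc
      nlinarith
    linarith
  have e3 : ∀ᶠ LL : ℝ in atTop, (2 * √W * K1 + √W * C) / LL^2 ≤ 1/2 := by
    have t : Tendsto (fun LL : ℝ => (2 * √W * K1 + √W * C) / LL^2) atTop (𝓝 0) := 
      tendsto_const_nhds.div_atTop (tendsto_pow_atTop (by norm_num))
    exact (t.eventually (gt_mem_nhds (show (0:ℝ) < 1/2 by norm_num))).mono fun _ h => h.le
  have e4 : ∀ᶠ LL : ℝ in atTop, (W:ℝ) ≤ Real.exp (LL/100) := by
    have t2 : Tendsto (fun ℓ : ℝ => ℓ/100) atTop atTop := tendsto_id.atTop_div_const (by positivity)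
    exact (Real.tendsto_exp_atTop.comp t2).eventually (eventually_ge_atTop _)
  have tL : Tendsto (fun ℓ : ℝ => Real.exp (ℓ/A)) atTop atTop := 
    Real.tendsto_exp_atTop.comp (tendsto_id.atTop_div_const hApos)
  have ev := ((tL.eventually (e2.and (e3.and (e4.and ((eventually_ge_atTop 10).and (eventually_ge_atTop LL0)))))).and 
    (e1.and (eventually_ge_atTop 2)))
  obtain ⟨ℓ₀, hℓ₀⟩ := eventually_atTop.1 ev
  obtain ⟨ℓ, hℓ, hgood⟩ := exists_good_level ℓ₀
  obtain ⟨⟨c2, c3, c4, c10, cL⟩, c1, cℓ⟩ := hℓ₀ ℓ hℓ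
  set LL := Real.exp (ℓ/A) with hLL
  refine ⟨LL, cL, ?_⟩
  have hLL0 : 0 < LL := by linarith
  have hQ : LL^A = Real.exp ℓ := by
    rw [hLL, ← Real.exp_nat_mul]; congr 1; field_simp
  set y := ⌊Real.exp (LL/100)⌋₊
  set D := ⌊Real.exp (LL/50)⌋₊
  have hy1 : 1 ≤ y := by
    rw [Nat.one_le_floor_iff]; exact Real.one_le_exp (by linarith)
  have hyle : (y:ℝ) ≤ Real.exp (LL/100) := Nat.floor_le (Real.exp_pos _).le
  have hDle : (D:ℝ) ≤ Real.exp (LL/50) := Nat.floor_le (Real.exp_pos _).le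
  have hWy : W * y ≤ D := by
    apply Nat.le_floor
    push_cast
    calc (W:ℝ) * y ≤ Real.exp (LL/100) * Real.exp (LL/100) := by gcongr
      _ = _ := by rw [← Real.exp_add]; congr 1; ring
  have hlogy : 1 + Real.log y ≤ LL := by
    have : Real.log y ≤ LL/100 := by
      rw [Real.log_le_iff_le_exp (by exact_mod_cast hy1)]; exact hyle
    linarith
  have hlogy0 : 0 ≤ Real.log y := Real.log_natCast_nonneg y
  have hL := hlarge LL c10 (XX D) (by
    intro p hp
    rw [mem_XX] at hp
    refine ⟨hp.1.1, le_trans (by exact_mod_cast hp.1.2) hDle, hp.2⟩) (by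
    calc ((XX D).card:ℝ) ≤ (D:ℝ)^2 := by exact_mod_cast card_XX D
      _ ≤ (Real.exp (LL/50))^2 := by gcongr
      _ = _ := by rw [← Real.exp_nat_mul]; congr 1; push_cast; ring)
  have hS : ∀ p ∈ XX D, (p.1:ℝ) ≤ LL^A → ‖chSum f LL p.2‖ ≤ K1 * (2 * LL^2) / LL^j := by
    intro p hp hpQ
    rw [mem_XX] at hp
    have hne : NeZero p.1 := ⟨by omega⟩
    have := hsmall LL ℓ (1/2^70) _ (by linarith) cℓ (by positivity) (by norm_num) rfl hgood p.1 p.2 hp.1.1 (by rw [← hQ]; exact hpQ) hp.2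
    refine this.trans ?_
    set ρ : ℝ := 1/2^70/(64*ℓ^10)
    have hℓ0 : 0 < ℓ := by linarith
    have hρ : 0 < ρ := by positivity
    have hρ1 : 1/ρ = 64 * ℓ^10 * 2^70 := by simp only [ρ]; field_simp
    have hsq : √LL ≤ LL := by
      rw [Real.sqrt_le_left (by linarith)]; nlinarith
    have hsq0 : 0 < √LL := Real.sqrt_pos.2 hLL0
    have hss : √LL * √LL = LL := Real.mul_self_sqrt hLL0.le
    have hρ2 : 2/ρ ≤ √LL := by
      rw [show 2/ρ = 2 * (1/ρ) by ring, hρ1]; exact c1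
    have hρ3 : 1/ρ ≤ LL^2 := by
      have : 1/ρ ≤ 2/ρ := by gcongr; norm_num
      nlinarith
    have hρ4 : 2/(ρ*LL) ≤ 1/√LL := by
      rw [← div_div, div_le_div_iff₀ hLL0 hsq0]
      nlinarith
    calc _ ≤ K1 * (LL^2 + LL^2) * (1/√LL)^(2*j) := by gcongr
      _ = K1 * (2 * LL^2) / LL^j := by
        rw [div_pow, one_pow, pow_mul, Real.sq_sqrt hLL0.le]; ring
  have hQ1 : 1 ≤ LL^A := one_le_pow₀ (by linarith)
  have hsplit := bv_split (f := f) (LL := LL) (D := D) hQ1 (by positivity) hS hL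
  refine (bv_swap hf hB hW hy1 hWy).trans ?_
  have hsqA : √(LL^A) = LL^a := by
    rw [hA, mul_comm, pow_mul, Real.sqrt_sq (by positivity)]
  rw [hsqA] at hsplit
  have hPP := PPF_le hf (show 1 ≤ LL by linarith)
  have hfirst : (y:ℝ)^2 * PPF f LL ≤ 4 * LL * Real.exp (-(LL/4)) := by
    calc _ ≤ (Real.exp (LL/100))^2 * (4 * LL * Real.exp (-(3*LL/8))) := by
          have := PPF_nonneg hf LL
          gcongr
      _ = 4 * LL * Real.exp (2 * (LL/100) + -(3*LL/8)) := by
          rw [Real.exp_add, two_mul (LL/100), Real.exp_add]; ring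
      _ ≤ _ := by gcongr; linarith
  have hsec : √W * (1 + Real.log y)^(2*B) * ∑ p ∈ XX D, ‖chSum f LL p.2‖ / √(p.1:ℝ) ≤ 
      (2 * √W * K1 + √W * C) / LL^2 / LL^A0 := by
    calc _ ≤ √W * LL^(2*B) * ((LL^A)^2 * (K1 * (2 * LL^2) / LL^j) + C * LL^5 / LL^a) := by gcongr
      _ = _ := by
        rw [hj, ha]
        simp only [pow_add, pow_mul]
        field_simp
        ring
  have hfirst2 : 4 * LL * Real.exp (-(LL/4)) ≤ 1/2 / LL^A0 := by
    rw [le_div_iff₀ (by positivity)]; linarith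
  calc _ ≤ 1/2 / LL^A0 + 1/2 / LL^A0 := by
        refine add_le_add (hfirst.trans hfirst2) (hsec.trans ?_)
        gcongr
    _ = _ := by ring

end

section

open Finset in
/-- `∏ (1+w i)` is close to `1 + ∑ w i`. -/
lemma near_prod {ι : Type*} [DecidableEq ι] (s : Finset ι) : ∃ C : ℝ, 0 ≤ C ∧ ∀ (δ : ℝ) (w : ι → ℂ),
    0 ≤ δ → δ ≤ 1 → (∀ i, ‖w i‖ ≤ 40 * δ) →
    ‖∏ i ∈ s, (1 + w i) - 1 - ∑ i ∈ s, w i‖ ≤ C * δ ^ 2 := by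
  induction s using Finset.induction_on with
  | empty => exact ⟨0, le_rfl, fun δ w _ _ _ => by simp⟩
  | insert j s hj ih =>
    obtain ⟨C, hC, h⟩ := ih
    refine ⟨41 * C + 1600 * s.card, by positivity, fun δ w h0 h1 hw => ?_⟩
    rw [prod_insert hj, sum_insert hj]
    have h2 := h δ w h0 h1 hw
    have h3 : ‖∑ i ∈ s, w i‖ ≤ s.card * (40 * δ) := by
      refine (norm_sum_le _ _).trans ((sum_le_card_nsmul _ _ _ fun i _ => hw i).trans ?_)
      rw [nsmul_eq_mul]
    have h4 : (1 + w j) * ∏ i ∈ s, (1 + w i) - 1 - (w j + ∑ i ∈ s, w i)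
      = (1 + w j) * (∏ i ∈ s, (1 + w i) - 1 - ∑ i ∈ s, w i) + w j * ∑ i ∈ s, w i := by ring
    rw [h4]
    have h5 : ‖1 + w j‖ ≤ 41 := by
      refine (norm_add_le _ _).trans ?_
      rw [norm_one]; have := hw j; linarith
    refine (norm_add_le _ _).trans ?_
    rw [norm_mul, norm_mul]
    have h6 := mul_le_mul h5 h2 (norm_nonneg _) (by norm_num)
    have h7 := mul_le_mul (hw j) h3 (norm_nonneg _) (by positivity)
    nlinarith

/-- local zeta-quotient factor -/
noncomputable def rr (δ : ℝ) (α β : ℂ) : ℂ := (1 - δ * (α * β)) * (1 - δ * α)⁻¹ * (1 - δ * β)⁻¹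

lemma norm_one_sub_ge {δ : ℝ} (h0 : 0 ≤ δ) (h1 : δ ≤ 1/2) {α : ℂ} (hα : ‖α‖ ≤ 1) :
    1/2 ≤ ‖1 - δ * α‖ := by
  have := norm_sub_norm_le (1:ℂ) (δ * α)
  rw [norm_one, norm_mul, Complex.norm_real, Real.norm_of_nonneg h0] at this
  nlinarith [norm_nonneg α]

lemma rr_bound {δ : ℝ} (h0 : 0 ≤ δ) (h1 : δ ≤ 1/2) {α β : ℂ} (hα : ‖α‖ ≤ 1) (hβ : ‖β‖ ≤ 1) :
    ‖rr δ α β - 1 - δ * (α + β - α * β)‖ ≤ 40 * δ ^ 2 := by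
  have ha := norm_one_sub_ge h0 h1 hα
  have hb := norm_one_sub_ge h0 h1 hβ
  have ha' : (1 - δ * α) ≠ 0 := by intro h; rw [h, norm_zero] at ha; linarith
  have hb' : (1 - δ * β) ≠ 0 := by intro h; rw [h, norm_zero] at hb; linarith
  have key : rr δ α β - 1 - δ * (α + β - α * β)
      = (δ^2 * ((α + β - α * β) * (α + β) - α * β - δ * ((α + β - α * β) * (α * β))))
        * (1 - δ * α)⁻¹ * (1 - δ * β)⁻¹ := by
    unfold rr; field_simp; ring
  rw [key, norm_mul, norm_mul, norm_inv, norm_inv]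
  have hab : ‖α * β‖ ≤ 1 := by rw [norm_mul]; nlinarith [norm_nonneg α, norm_nonneg β]
  have hu : ‖α + β - α * β‖ ≤ 3 := by
    refine (norm_sub_le _ _).trans ?_
    have := norm_add_le α β
    linarith
  have hs : ‖α + β‖ ≤ 2 := (norm_add_le _ _).trans (by linarith)
  have hn : ‖(δ:ℂ)^2 * ((α + β - α * β) * (α + β) - α * β - δ * ((α + β - α * β) * (α * β)))‖
      ≤ δ^2 * 10 := by
    rw [norm_mul, norm_pow, Complex.norm_real, Real.norm_of_nonneg h0]
    gcongr
    refine (norm_sub_le _ _).trans ?_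
    have e1 : ‖(α + β - α * β) * (α + β) - α * β‖ ≤ 7 := by
      refine (norm_sub_le _ _).trans ?_
      rw [norm_mul (α + β - α * β)]
      nlinarith [norm_nonneg (α + β - α * β), norm_nonneg (α + β)]
    have e2 : ‖(δ:ℂ) * ((α + β - α * β) * (α * β))‖ ≤ 3 := by
      rw [norm_mul, norm_mul, Complex.norm_real, Real.norm_of_nonneg h0]
      have : ‖α + β - α * β‖ * ‖α * β‖ ≤ 3 := by
        nlinarith [norm_nonneg (α + β - α * β), norm_nonneg (α * β)]
      have h3 := mul_nonneg (norm_nonneg (α + β - α * β)) (norm_nonneg (α * β))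
      nlinarith
    linarith
  have i1 : ‖1 - δ * α‖⁻¹ ≤ 2 := by
    rw [inv_le_comm₀ (by linarith) (by norm_num)]; linarith
  have i2 : ‖1 - δ * β‖⁻¹ ≤ 2 := by
    rw [inv_le_comm₀ (by linarith) (by norm_num)]; linarith
  calc _ ≤ (δ^2 * 10) * 2 * 2 := by gcongr
    _ = _ := by ring

/-- `b(α,β)` with `(1-α)(1-β) = 1 + b`. -/
def bq (α β : ℂ) : ℂ := -α - β + α * β

lemma bq_bound {α β : ℂ} {r : ℝ} (hr : r ≤ 1) (hα : ‖α‖ ≤ r) (hβ : ‖β‖ ≤ r) : ‖bq α β‖ ≤ 3 * r := by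
  unfold bq
  have h1 := norm_add_le (-α - β) (α * β)
  have h2 := norm_sub_le (-α) β
  rw [norm_neg] at h2
  rw [norm_mul] at h1
  nlinarith [norm_nonneg α, norm_nonneg β]

/-- Euler factor after removing zeta factors. -/
noncomputable def EE {ι : Type*} [Fintype ι] (W : ℕ) (a : ℕ → ℝ) (p : ℕ) (α β : ι → ℂ) : ℂ :=
  (1 + ((if p ∣ W then 0 else a p : ℝ) : ℂ) * ∑ i, bq (α i) (β i)) *
    ∏ i, rr ((p:ℝ)⁻¹) (α i) (β i)

lemma EE_bound {ι : Type*} [Fintype ι] [DecidableEq ι] (W : ℕ) (hW : W ≠ 0) (a : ℕ → ℝ)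
    (ha : ∀ p : ℕ, p.Prime → ¬ p ∣ W → |a p - (p:ℝ)⁻¹| ≤ 2 * ((p:ℝ)⁻¹)^2) :
    ∃ C : ℝ, 0 ≤ C ∧ ∀ (p : ℕ) (α β : ι → ℂ), p.Prime → (∀ i, ‖α i‖ ≤ 1) → (∀ i, ‖β i‖ ≤ 1) →
      ‖EE W a p α β - 1‖ ≤ C * ((p:ℝ)⁻¹)^2 := by
  obtain ⟨C, hC, h⟩ := near_prod (Finset.univ : Finset ι)
  set k : ℝ := ((Fintype.card ι : ℕ) : ℝ) with hk
  have hk0 : 0 ≤ k := by positivity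
  set D : ℝ := C + 40 * k with hD
  have hD0 : 0 ≤ D := by positivity
  refine ⟨(D + 3*k) * W^2 + (D + 6 * k + 18 * k^2 + 6 * k * D), by positivity, fun p α β hp hα hβ => ?_⟩
  set δ : ℝ := (p:ℝ)⁻¹ with hδ
  have hp2 : (2:ℝ) ≤ p := by exact_mod_cast hp.two_le
  have h0 : 0 < δ := by positivity
  have h1 : δ ≤ 1/2 := by rw [hδ, inv_le_comm₀ (by linarith) (by norm_num)]; linarith
  set B : ℂ := ∑ i, bq (α i) (β i) with hB
  have hBn : ‖B‖ ≤ 3 * k := by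
    refine (norm_sum_le _ _).trans ((Finset.sum_le_card_nsmul _ _ (3*1)
      fun i _ => bq_bound le_rfl (hα i) (hβ i)).trans ?_)
    rw [nsmul_eq_mul, Finset.card_univ]; linarith
  have hr : ∀ i, ‖rr δ (α i) (β i) - 1 + δ * bq (α i) (β i)‖ ≤ 40 * δ^2 := fun i => by
    have := rr_bound h0.le h1 (hα i) (hβ i)
    convert this using 2
    unfold bq; ring
  have hw : ∀ i, ‖rr δ (α i) (β i) - 1‖ ≤ 40 * δ := fun i => by
    have e1 := hr i
    have e2 : ‖(δ:ℂ) * bq (α i) (β i)‖ ≤ δ * 3 := by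
      rw [norm_mul, Complex.norm_real, Real.norm_of_nonneg h0.le]
      have := bq_bound le_rfl (hα i) (hβ i)
      nlinarith
    have e3 := norm_sub_le (rr δ (α i) (β i) - 1 + δ * bq (α i) (β i)) (δ * bq (α i) (β i))
    rw [add_sub_cancel_right] at e3
    nlinarith
  have hP := h δ (fun i => rr δ (α i) (β i) - 1) h0.le (by linarith) hw
  simp only [add_sub_cancel] at hP
  set P : ℂ := ∏ i, rr δ (α i) (β i) with hPd
  have hS : ‖∑ i, (rr δ (α i) (β i) - 1) + δ * B‖ ≤ 40 * k * δ^2 := by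
    rw [hB, Finset.mul_sum, ← Finset.sum_add_distrib]
    refine (norm_sum_le _ _).trans ((Finset.sum_le_card_nsmul _ _ _ fun i _ => hr i).trans ?_)
    rw [nsmul_eq_mul, Finset.card_univ]; linarith
  have hR : ‖P - 1 + δ * B‖ ≤ D * δ^2 := by
    have := norm_add_le (P - 1 - ∑ i, (rr δ (α i) (β i) - 1))
      (∑ i, (rr δ (α i) (β i) - 1) + δ * B)
    have e : P - 1 - ∑ i, (rr δ (α i) (β i) - 1) + (∑ i, (rr δ (α i) (β i) - 1) + δ * B)
      = P - 1 + δ * B := by ring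
    rw [e] at this
    rw [hD]; linarith
  have hδB : ‖(δ:ℂ) * B‖ ≤ δ * (3 * k) := by
    rw [norm_mul, Complex.norm_real, Real.norm_of_nonneg h0.le]
    gcongr
  have hEE : EE W a p α β = (1 + ((if p ∣ W then 0 else a p : ℝ) : ℂ) * B) * P := rfl
  rw [hEE]
  split_ifs with hd
  · have hpW : (p:ℝ) ≤ W := by exact_mod_cast Nat.le_of_dvd (Nat.pos_of_ne_zero hW) hd
    have h2 : 1 ≤ (W:ℝ)^2 * δ^2 := by
      rw [← mul_pow]
      refine one_le_pow₀ ?_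
      rw [hδ, ← div_eq_mul_inv, one_le_div (by linarith)]; exact hpW
    have e3 := norm_sub_le (P - 1 + δ * B) (δ * B)
    rw [add_sub_cancel_right] at e3
    simp only [Complex.ofReal_zero, zero_mul, add_zero, one_mul]
    have d2 : δ^2 ≤ 1 := by nlinarith
    have d3 := mul_le_mul_of_nonneg_left d2 hD0
    have d4 : δ * (3 * k) ≤ 1 * (3 * k) := by gcongr; linarith
    have h3 : ‖P - 1‖ ≤ D + 3 * k := by linarith
    calc _ ≤ (D + 3*k) * 1 := by linarith
      _ ≤ (D + 3*k) * (W^2 * δ^2) := by gcongr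
      _ ≤ _ := by
        have : 0 ≤ (D + 6 * k + 18 * k^2 + 6 * k * D) * δ^2 := by positivity
        nlinarith
  · have hap := ha p hp hd
    have hap2 : |a p| ≤ 2 * δ := by
      have := abs_add_le (a p - δ) δ
      rw [sub_add_cancel, abs_of_pos h0] at this
      nlinarith
    have e : (1 + (a p : ℂ) * B) * P - 1 = (((a p - δ : ℝ) : ℂ) * B + (P - 1 + δ * B))
        - (a p : ℂ) * (δ * B * B) + (a p : ℂ) * B * (P - 1 + δ * B) := by
      push_cast; ring
    rw [e]
    have n1 : ‖((a p - δ : ℝ) : ℂ) * B‖ ≤ 2 * δ^2 * (3 * k) := by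
      rw [norm_mul, Complex.norm_real, Real.norm_eq_abs]; gcongr
    have n2 : ‖(a p : ℂ) * (δ * B * B)‖ ≤ 2 * δ * (δ * (3 * k) * (3 * k)) := by
      rw [norm_mul, norm_mul _ B, Complex.norm_real, Real.norm_eq_abs]; gcongr
    have n3 : ‖(a p : ℂ) * B * (P - 1 + δ * B)‖ ≤ 2 * 1 * (3 * k) * (D * δ^2) := by
      rw [norm_mul, norm_mul, Complex.norm_real, Real.norm_eq_abs]; gcongr; linarith
    refine (norm_add_le _ _).trans ?_
    have m1 := norm_sub_le (((a p - δ : ℝ) : ℂ) * B + (P - 1 + δ * B)) ((a p : ℂ) * (δ * B * B))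
    have m2 := norm_add_le (((a p - δ : ℝ) : ℂ) * B) (P - 1 + δ * B)
    have : 0 ≤ (D + 3*k) * W^2 * δ^2 := by positivity
    nlinarith

end

section

open Filter Topology

/-- `n^{-om ξ/L}` -/
noncomputable def ee (L : ℝ) (n : ℕ) (ξ : ℝ) : ℂ := Complex.exp (-((Real.log n / L : ℝ) * om ξ))

lemma norm_ee (L : ℝ) (n : ℕ) (ξ : ℝ) : ‖ee L n ξ‖ = Real.exp (-(Real.log n / L)) := by
  unfold ee
  rw [Complex.norm_exp, Complex.neg_re, Complex.re_ofReal_mul, om_re, mul_one]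

lemma norm_ee_le {L : ℝ} (hL : 0 < L) (n : ℕ) (ξ : ℝ) : ‖ee L n ξ‖ ≤ 1 := by
  rw [norm_ee, Real.exp_le_one_iff, neg_nonpos]
  exact div_nonneg (Real.log_natCast_nonneg n) hL.le

lemma norm_ee_eq {L : ℝ} {n : ℕ} (hn : n ≠ 0) (ξ : ℝ) : ‖ee L n ξ‖ = (n:ℝ)^(-(1/L)) := by
  rw [norm_ee, Real.rpow_def_of_pos (by positivity)]
  congr 1; ring

lemma ee_eq_cpow {L : ℝ} {n : ℕ} (hn : n ≠ 0) (ξ : ℝ) : ee L n ξ = (n:ℂ)^(-(om ξ / L)) := by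
  unfold ee
  rw [Complex.cpow_def_of_ne_zero (by exact_mod_cast hn), ← Complex.natCast_log]
  congr 1; push_cast; ring

lemma ee_mul {L : ℝ} {m n : ℕ} (hm : m ≠ 0) (hn : n ≠ 0) (ξ : ℝ) :
    ee L (m * n) ξ = ee L m ξ * ee L n ξ := by
  unfold ee
  rw [← Complex.exp_add, Nat.cast_mul, Real.log_mul (by positivity) (by positivity)]
  congr 1; push_cast; ring

lemma ee_one (L ξ : ℝ) : ee L 1 ξ = 1 := by simp [ee]

lemma ee_tendsto (n : ℕ) (ξ : ℝ) : Tendsto (fun L => ee L n ξ) atTop (𝓝 1) := by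
  have h : Tendsto (fun L : ℝ => Real.log n / L) atTop (𝓝 0) :=
    tendsto_const_nhds.div_atTop tendsto_id
  have h2 : Continuous fun u : ℝ => Complex.exp (-(u * om ξ)) := by fun_prop
  have := (h2.tendsto 0).comp h
  simpa [Function.comp_def, ee] using this

@[fun_prop] lemma continuous_ee (L : ℝ) (n : ℕ) : Continuous (ee L n) := by
  unfold ee; fun_prop

/-- zeta quotient -/
noncomputable def zZ (L ξ η : ℝ) : ℂ :=
  riemannZeta (1 + (om ξ + om η) / L) * (riemannZeta (1 + om ξ / L))⁻¹ *
    (riemannZeta (1 + om η / L))⁻¹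

lemma re_om_div (L ξ : ℝ) : (1 + om ξ / L).re = 1 + 1 / L := by
  rw [Complex.add_re, Complex.div_ofReal_re, om_re, Complex.one_re]

lemma re_om2_div (L ξ η : ℝ) : (1 + (om ξ + om η) / L).re = 1 + 2 / L := by
  rw [Complex.add_re, Complex.div_ofReal_re, Complex.add_re, om_re, om_re, Complex.one_re]
  norm_num

lemma om_add_ne (ξ η : ℝ) : om ξ + om η ≠ 0 := by
  intro h
  have := congrArg Complex.re h
  rw [Complex.add_re, om_re, om_re, Complex.zero_re] at this
  norm_num at this

lemma zeta_res {w : ℂ} (hw : w ≠ 0) :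
    Tendsto (fun L : ℝ => w / L * riemannZeta (1 + w / L)) atTop (𝓝 1) := by
  have h0 : Tendsto (fun L : ℝ => w / (L:ℂ)) atTop (𝓝 0) := by
    have : Tendsto (fun L : ℝ => ((L⁻¹ : ℝ) : ℂ)) atTop (𝓝 ((0:ℝ):ℂ)) :=
      (Complex.continuous_ofReal.tendsto _).comp tendsto_inv_atTop_zero
    have := this.const_mul w
    simpa [div_eq_mul_inv] using this
  have h1 : Tendsto (fun L : ℝ => 1 + w / L) atTop (𝓝[≠] 1) := by
    rw [tendsto_nhdsWithin_iff]
    refine ⟨by simpa using h0.const_add 1, ?_⟩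
    filter_upwards [eventually_gt_atTop 0] with L hL
    simp [hw, hL.ne']
  have := riemannZeta_residue_one.comp h1
  simpa [Function.comp_def] using this

lemma zZ_tendsto (ξ η : ℝ) : Tendsto (fun L : ℝ => (L:ℂ) * zZ L ξ η) atTop
    (𝓝 (om ξ * om η / (om ξ + om η))) := by
  have h1 := zeta_res (om_ne_zero ξ)
  have h2 := zeta_res (om_ne_zero η)
  have h3 := zeta_res (om_add_ne ξ η)
  have h4 := ((h3.mul (h1.inv₀ one_ne_zero)).mul (h2.inv₀ one_ne_zero)).const_mul
    (om ξ * om η / (om ξ + om η))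
  simp only [inv_one, mul_one] at h4
  refine h4.congr' ?_
  filter_upwards [eventually_gt_atTop 0] with L hL
  have := om_ne_zero ξ
  have := om_ne_zero η
  have := om_add_ne ξ η
  have hL' : (L:ℂ) ≠ 0 := by exact_mod_cast hL.ne'
  have z1 : riemannZeta (1 + om ξ / L) ≠ 0 := riemannZeta_ne_zero_of_one_lt_re (by
    rw [re_om_div]; have : 0 < 1 / L := by positivity
    linarith)
  have z2 : riemannZeta (1 + om η / L) ≠ 0 := riemannZeta_ne_zero_of_one_lt_re (by
    rw [re_om_div]; have : 0 < 1 / L := by positivity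
    linarith)
  unfold zZ
  field_simp

lemma zeta_inv_le {L : ℝ} (hL : 1 ≤ L) (ξ : ℝ) : ‖(riemannZeta (1 + om ξ / L))⁻¹‖ ≤ 2 * L := by
  have h0 : 0 < L := by linarith
  obtain ⟨h1, h2⟩ := sum_zeta_le hL
  have hs : 1 < (1 + om ξ / L).re := by
    rw [re_om_div]; have : 0 < 1 / L := by positivity
    linarith
  have h3 := ArithmeticFunction.LSeries_zeta_mul_Lseries_moebius hs
  rw [ArithmeticFunction.LSeries_zeta_eq_riemannZeta hs] at h3
  rw [inv_eq_of_mul_eq_one_right h3]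
  refine le_trans ?_ h2
  unfold LSeries
  refine tsum_of_norm_bounded h1.hasSum fun n => ?_
  rcases eq_or_ne n 0 with rfl | hn
  · simp
    positivity
  · rw [LSeries.norm_term_eq, if_neg hn, re_om_div, Real.rpow_neg (by positivity), div_eq_mul_inv]
    refine mul_le_of_le_one_left (by positivity) ?_
    rw [Complex.norm_intCast]
    exact_mod_cast ArithmeticFunction.abs_moebius_le_one

lemma zeta_inv_bound : ∃ C : ℝ, 0 ≤ C ∧ ∀ L ξ : ℝ, 1 ≤ L →
    ‖(riemannZeta (1 + om ξ / L))⁻¹‖ ≤ C * ‖om ξ‖^2 / L := by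
  have h := riemannZeta_residue_one.norm
  rw [norm_one] at h
  have h2 := h.eventually (lt_mem_nhds (show (1/2:ℝ) < 1 by norm_num))
  rw [eventually_nhdsWithin_iff, Metric.eventually_nhds_iff] at h2
  obtain ⟨ε, hε, h3⟩ := h2
  refine ⟨2 + 2 / ε^2, by positivity, fun L ξ hL => ?_⟩
  have h0 : 0 < L := by linarith
  have ho := one_le_norm_om ξ
  have hn : ‖om ξ / L‖ = ‖om ξ‖ / L := by
    rw [norm_div, Complex.norm_real, Real.norm_of_nonneg h0.le]
  by_cases hc : ‖om ξ‖ / L < ε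
  · have h4 := h3 (y := 1 + om ξ / L) (by rw [dist_eq_norm, add_sub_cancel_left, hn]; exact hc)
      (by simp [om_ne_zero, h0.ne'])
    rw [add_sub_cancel_left, norm_mul, hn] at h4
    have hz : 0 < ‖riemannZeta (1 + om ξ / L)‖ := by
      by_contra hz
      have : ‖riemannZeta (1 + om ξ / L)‖ = 0 := le_antisymm (not_lt.1 hz) (norm_nonneg _)
      rw [this] at h4; norm_num at h4
    rw [norm_inv]
    have h5 : ‖riemannZeta (1 + om ξ / L)‖⁻¹ ≤ 2 * (‖om ξ‖ / L) := by
      rw [inv_le_iff_one_le_mul₀ hz]; linarith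
    refine h5.trans ?_
    rw [← mul_div_assoc]
    refine div_le_div_of_nonneg_right ?_ h0.le
    have : 0 ≤ 2 / ε^2 * ‖om ξ‖^2 := by positivity
    nlinarith
  · rw [not_lt] at hc
    refine (zeta_inv_le hL ξ).trans ?_
    rw [le_div_iff₀ h0] at hc ⊢
    have : L ^ 2 ≤ ‖om ξ‖^2 / ε^2 := by
      rw [le_div_iff₀ (by positivity), ← mul_pow]
      gcongr; linarith
    have e : (2 + 2/ε^2) * ‖om ξ‖^2 = 2 * (‖om ξ‖^2 / ε^2) + 2 * ‖om ξ‖^2 := by ring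
    rw [e]; nlinarith [sq_nonneg ‖om ξ‖]

lemma zZ_bound : ∃ C : ℝ, 0 ≤ C ∧ ∀ L ξ η : ℝ, 1 ≤ L →
    ‖(L:ℂ) * zZ L ξ η‖ ≤ C * (‖om ξ‖^3 * ‖om η‖^3) := by
  obtain ⟨C, hC, h⟩ := zeta_inv_bound
  refine ⟨2 * C * C, by positivity, fun L ξ η hL => ?_⟩
  have h0 : 0 < L := by linarith
  have ho := one_le_norm_om ξ
  have ho' := one_le_norm_om η
  have hs : 1 < (1 + (om ξ + om η) / L).re := by
    rw [re_om2_div]; have : 0 < 2 / L := by positivity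
    linarith
  have h1 : ‖riemannZeta (1 + (om ξ + om η) / L)‖ ≤ 2 * L * (‖om ξ‖ * ‖om η‖) := by
    refine (norm_riemannZeta_le hs).trans ?_
    rw [re_om2_div, add_sub_cancel_left, div_div_eq_mul_div, div_le_iff₀ (by norm_num)]
    have : ‖1 + (om ξ + om η) / L‖ ≤ 1 + (‖om ξ‖ + ‖om η‖) := by
      refine (norm_add_le _ _).trans ?_
      rw [norm_one, norm_div, Complex.norm_real, Real.norm_of_nonneg h0.le]
      gcongr
      exact (div_le_self (norm_nonneg _) hL).trans (norm_add_le _ _)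
    have h2 : 1 + (‖om ξ‖ + ‖om η‖) ≤ 4 * (‖om ξ‖ * ‖om η‖) := by nlinarith
    nlinarith
  unfold zZ
  rw [norm_mul, norm_mul, norm_mul, Complex.norm_real, Real.norm_of_nonneg h0.le]
  calc _ ≤ L * ((2 * L * (‖om ξ‖ * ‖om η‖)) * (C * ‖om ξ‖^2 / L) * (C * ‖om η‖^2 / L)) := by
        gcongr
        · exact h L ξ hL
        · exact h L η hL
    _ = _ := by field_simp

lemma rr_ne {δ : ℝ} (h0 : 0 ≤ δ) (h1 : δ ≤ 1/2) {α β : ℂ} (hα : ‖α‖ ≤ 1) (hβ : ‖β‖ ≤ 1) :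
    rr δ α β ≠ 0 := by
  have aux : ∀ γ : ℂ, ‖γ‖ ≤ 1 → (1 - δ * γ) ≠ 0 := fun γ hγ h => by
    have := norm_one_sub_ge h0 h1 hγ
    rw [h, norm_zero] at this; linarith
  unfold rr
  exact mul_ne_zero (mul_ne_zero (aux _ (by rw [norm_mul]; nlinarith [norm_nonneg α, norm_nonneg β]))
    (inv_ne_zero (aux _ hα))) (inv_ne_zero (aux _ hβ))

lemma inv_prime_le {p : ℕ} (hp : p.Prime) : ((p:ℝ)⁻¹) ≤ 1/2 := by
  have hp2 : (2:ℝ) ≤ p := by exact_mod_cast hp.two_le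
  rw [inv_le_comm₀ (by linarith) (by norm_num)]; linarith

lemma rr_prod_tendsto {L : ℝ} (hL : 0 < L) (ξ η : ℝ) :
    Tendsto (fun n : ℕ => ∏ p ∈ n.primesBelow, (rr ((p:ℝ)⁻¹) (ee L p ξ) (ee L p η))⁻¹) atTop
      (𝓝 (zZ L ξ η)) := by
  have p1 : 0 < 1 / L := by positivity
  have p2 : 0 < 2 / L := by positivity
  have s1 : 1 < (1 + om ξ / L).re := by rw [re_om_div]; linarith
  have s2 : 1 < (1 + om η / L).re := by rw [re_om_div]; linarith
  have s3 : 1 < (1 + (om ξ + om η) / L).re := by rw [re_om2_div]; linarith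
  have t1 := (riemannZeta_eulerProduct s1).inv₀ (riemannZeta_ne_zero_of_one_lt_re s1)
  have t2 := (riemannZeta_eulerProduct s2).inv₀ (riemannZeta_ne_zero_of_one_lt_re s2)
  have t3 := riemannZeta_eulerProduct s3
  have t := (t3.mul t1).mul t2
  refine t.congr fun n => ?_
  rw [← Finset.prod_inv_distrib, ← Finset.prod_inv_distrib, ← Finset.prod_mul_distrib,
    ← Finset.prod_mul_distrib]
  refine Finset.prod_congr rfl fun p hp => ?_
  have hp0 : p ≠ 0 := (Nat.prime_of_mem_primesBelow hp).ne_zero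
  have hpc : (p:ℂ) ≠ 0 := by exact_mod_cast hp0
  have e1 : ∀ w : ℂ, (p:ℂ)^(-(1 + w / L)) = (((p:ℝ)⁻¹ : ℝ) : ℂ) * (p:ℂ)^(-(w/L)) := fun w => by
    rw [neg_add, Complex.cpow_add _ _ hpc, Complex.cpow_neg_one]; push_cast; rfl
  rw [e1, e1, e1, ← ee_eq_cpow hp0, ← ee_eq_cpow hp0]
  have e2 : (p:ℂ)^(-((om ξ + om η)/L)) = ee L p ξ * ee L p η := by
    rw [ee_eq_cpow hp0, ee_eq_cpow hp0, ← Complex.cpow_add _ _ hpc]; congr 1; ring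
  rw [e2]
  unfold rr
  rw [mul_inv, mul_inv]

end

section

open Filter Topology

/-- local density close to `1/p` -/
def AOk (W : ℕ) (a : ℕ → ℝ) : Prop :=
  ∀ p : ℕ, p.Prime → ¬ p ∣ W → |a p - (p:ℝ)⁻¹| ≤ 2 * ((p:ℝ)⁻¹)^2

noncomputable def bb (L : ℝ) (p : ℕ) (x : ℝ × ℝ) : ℂ := bq (ee L p x.1) (ee L p x.2)

noncomputable def Fac {ι : Type*} [Fintype ι] (W : ℕ) (a : ℕ → ℝ) (L : ℝ) (p : ℕ)
    (x : ι → ℝ × ℝ) : ℂ := 1 + ((if p ∣ W then 0 else a p : ℝ) : ℂ) * ∑ i, bb L p (x i)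

noncomputable def eN {ι : Type*} [Fintype ι] (W : ℕ) (a : ℕ → ℝ) (α β : ℕ → ι → ℂ) (n : ℕ) : ℂ :=
  if n.Prime then EE W a n (α n) (β n) - 1 else 0

noncomputable def KK {ι : Type*} [Fintype ι] (W : ℕ) (a : ℕ → ℝ) (L : ℝ) (x : ι → ℝ × ℝ) : ℂ :=
  (∏' n, (1 + eN W a (fun n i => ee L n (x i).1) (fun n i => ee L n (x i).2) n)) *
    ∏ i, zZ L (x i).1 (x i).2

noncomputable def SSer (ι : Type*) [Fintype ι] (W : ℕ) (a : ℕ → ℝ) : ℂ :=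
  ∏' n, (1 + eN W a (fun _ (_ : ι) => 1) (fun _ _ => 1) n)

lemma summable_inv_sq (C : ℝ) : Summable fun n : ℕ => C * ((n:ℝ)⁻¹)^2 := by
  refine Summable.mul_left C ?_
  simp only [inv_pow]
  exact Real.summable_nat_pow_inv.2 (by norm_num)

lemma norm_prod_one_add_le {s : Finset ℕ} (e : ℕ → ℂ) (b : ℕ → ℝ) (hb : ∀ n ∈ s, ‖e n‖ ≤ b n) :
    ‖∏ n ∈ s, (1 + e n)‖ ≤ Real.exp (∑ n ∈ s, b n) := by
  rw [norm_prod, Real.exp_sum]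
  refine Finset.prod_le_prod (fun _ _ => norm_nonneg _) fun n hn => ?_
  refine (norm_add_le _ _).trans ?_
  rw [norm_one]
  have := Real.add_one_le_exp (b n)
  have := hb n hn
  linarith

lemma eN_bound {ι : Type*} [Fintype ι] [DecidableEq ι] {W : ℕ} (hW : W ≠ 0) {a : ℕ → ℝ}
    (ha : AOk W a) :
    ∃ C : ℝ, 0 ≤ C ∧ ∀ (α β : ℕ → ι → ℂ), (∀ n i, ‖α n i‖ ≤ 1) → (∀ n i, ‖β n i‖ ≤ 1) →
      ∀ n, ‖eN W a α β n‖ ≤ C * ((n:ℝ)⁻¹)^2 := by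
  obtain ⟨C, hC, h⟩ := EE_bound (ι := ι) W hW a ha
  refine ⟨C, hC, fun α β hα hβ n => ?_⟩
  unfold eN
  split_ifs with hn
  · exact h n _ _ hn (hα n) (hβ n)
  · rw [norm_zero]; positivity

lemma eN_hasProd {ι : Type*} [Fintype ι] [DecidableEq ι] {W : ℕ} (hW : W ≠ 0) {a : ℕ → ℝ}
    (ha : AOk W a) (α β : ℕ → ι → ℂ) (hα : ∀ n i, ‖α n i‖ ≤ 1) (hβ : ∀ n i, ‖β n i‖ ≤ 1) :
    Tendsto (fun n : ℕ => ∏ p ∈ n.primesBelow, EE W a p (α p) (β p)) atTop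
      (𝓝 (∏' n, (1 + eN W a α β n))) := by
  obtain ⟨C, hC, h⟩ := eN_bound (ι := ι) hW ha
  have hs : Summable fun n => ‖eN W a α β n‖ :=
    (summable_inv_sq C).of_nonneg_of_le (fun _ => norm_nonneg _) (h α β hα hβ)
  have := (multipliable_one_add_of_summable hs).hasProd.tendsto_prod_nat
  refine this.congr fun n => ?_
  rw [Nat.primesBelow, Finset.prod_filter]
  refine Finset.prod_congr rfl fun p _ => ?_
  unfold eN
  split_ifs <;> simp

lemma Fac_eq {ι : Type*} [Fintype ι] {W : ℕ} {a : ℕ → ℝ} {L : ℝ} (hL : 0 < L) {p : ℕ}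
    (hp : p.Prime) (x : ι → ℝ × ℝ) :
    Fac W a L p x = EE W a p (fun i => ee L p (x i).1) (fun i => ee L p (x i).2) *
      ∏ i, (rr ((p:ℝ)⁻¹) (ee L p (x i).1) (ee L p (x i).2))⁻¹ := by
  unfold EE Fac bb
  rw [mul_assoc, ← Finset.prod_mul_distrib, Finset.prod_eq_one, mul_one]
  intro i _
  exact mul_inv_cancel₀ (rr_ne (by positivity) (inv_prime_le hp) (norm_ee_le hL _ _)
    (norm_ee_le hL _ _))

lemma KK_tendsto_n {ι : Type*} [Fintype ι] [DecidableEq ι] {W : ℕ} (hW : W ≠ 0) {a : ℕ → ℝ}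
    (ha : AOk W a) {L : ℝ} (hL : 0 < L) (x : ι → ℝ × ℝ) :
    Tendsto (fun n : ℕ => ∏ p ∈ n.primesBelow, Fac W a L p x) atTop (𝓝 (KK W a L x)) := by
  have h1 := eN_hasProd hW ha (fun n i => ee L n (x i).1) (fun n i => ee L n (x i).2)
    (fun _ _ => norm_ee_le hL _ _) (fun _ _ => norm_ee_le hL _ _)
  have h2 : Tendsto (fun n : ℕ => ∏ i, ∏ p ∈ n.primesBelow,
      (rr ((p:ℝ)⁻¹) (ee L p (x i).1) (ee L p (x i).2))⁻¹) atTop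
      (𝓝 (∏ i, zZ L (x i).1 (x i).2)) :=
    tendsto_finsetProd _ fun i _ => rr_prod_tendsto hL _ _
  refine (h1.mul h2).congr fun n => ?_
  rw [Finset.prod_comm, ← Finset.prod_mul_distrib]
  refine Finset.prod_congr rfl fun p hp => ?_
  rw [Fac_eq hL (Nat.prime_of_mem_primesBelow hp)]

lemma Fac_prod_bound {ι : Type*} [Fintype ι] {W : ℕ} {a : ℕ → ℝ}
    (ha : AOk W a) {L : ℝ} (hL : 1 ≤ L) (x : ι → ℝ × ℝ) (n : ℕ) :
    ‖∏ p ∈ n.primesBelow, Fac W a L p x‖ ≤ Real.exp (6 * Fintype.card ι * (2 * L)) := by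
  obtain ⟨h1, h2⟩ := sum_zeta_le hL
  have h0 : 0 < L := by linarith
  unfold Fac
  refine (norm_prod_one_add_le _ (fun n => 6 * Fintype.card ι * (n:ℝ)^(-(1 + 1/L))) ?_).trans ?_
  · intro p hp
    have hp := Nat.prime_of_mem_primesBelow hp
    have hp0 : 0 < (p:ℝ) := by exact_mod_cast hp.pos
    have hr : (p:ℝ)^(-(1/L)) ≤ 1 := by
      have := norm_ee_le h0 p 0
      rwa [norm_ee_eq hp.ne_zero] at this
    have hB : ‖∑ i, bb L p (x i)‖ ≤ Fintype.card ι * (3 * (p:ℝ)^(-(1/L))) := by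
      refine (norm_sum_le _ _).trans ((Finset.sum_le_card_nsmul _ _ (3 * (p:ℝ)^(-(1/L)))
        fun i _ => ?_).trans ?_)
      · exact bq_bound hr (norm_ee_eq hp.ne_zero _).le (norm_ee_eq hp.ne_zero _).le
      · rw [nsmul_eq_mul, Finset.card_univ]
    have hA : ‖((if p ∣ W then 0 else a p : ℝ) : ℂ)‖ ≤ 2 * (p:ℝ)⁻¹ := by
      rw [Complex.norm_real, Real.norm_eq_abs]
      split_ifs with hd
      · rw [abs_zero]; positivity
      · have h3 := ha p hp hd
        have h4 := inv_prime_le hp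
        have := abs_add_le (a p - (p:ℝ)⁻¹) (p:ℝ)⁻¹
        have h5 : 0 < (p:ℝ)⁻¹ := by positivity
        rw [sub_add_cancel, abs_of_pos h5] at this
        nlinarith
    rw [norm_mul]
    have e : (p:ℝ)^(-(1+1/L)) = (p:ℝ)⁻¹ * (p:ℝ)^(-(1/L)) := by
      rw [neg_add, Real.rpow_add hp0, Real.rpow_neg_one]
    calc _ ≤ 2 * (p:ℝ)⁻¹ * (Fintype.card ι * (3 * (p:ℝ)^(-(1/L)))) := by gcongr
      _ = _ := by rw [e]; ring
  · rw [Real.exp_le_exp, ← Finset.mul_sum]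
    gcongr
    exact (h1.sum_le_tsum _ fun n _ => by positivity).trans h2

lemma KK_bound {ι : Type*} [Fintype ι] [DecidableEq ι] {W : ℕ} (hW : W ≠ 0) {a : ℕ → ℝ}
    (ha : AOk W a) : ∃ C : ℝ, 0 ≤ C ∧ ∀ (L : ℝ) (x : ι → ℝ × ℝ), 1 ≤ L →
      ‖(L:ℂ)^(Fintype.card ι) * KK W a L x‖ ≤ C * ∏ i, (‖om (x i).1‖^3 * ‖om (x i).2‖^3) := by
  obtain ⟨C, hC, h⟩ := zZ_bound
  obtain ⟨D, hD, h'⟩ := eN_bound (ι := ι) hW ha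
  refine ⟨Real.exp (∑' n : ℕ, D * ((n:ℝ)⁻¹)^2) * C^(Fintype.card ι), by positivity,
    fun L x hL => ?_⟩
  have h0 : 0 < L := by linarith
  have e : (L:ℂ)^(Fintype.card ι) * KK W a L x
      = (∏' n, (1 + eN W a (fun n i => ee L n (x i).1) (fun n i => ee L n (x i).2) n)) *
        ∏ i, (L * zZ L (x i).1 (x i).2) := by
    unfold KK
    rw [Finset.prod_mul_distrib, Finset.prod_const, Finset.card_univ]; ring
  rw [e, norm_mul, norm_prod, mul_assoc]
  have h1 : ‖∏' n, (1 + eN W a (fun n i => ee L n (x i).1) (fun n i => ee L n (x i).2) n)‖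
      ≤ Real.exp (∑' n : ℕ, D * ((n:ℝ)⁻¹)^2) := by
    have hb := h' (fun n i => ee L n (x i).1) (fun n i => ee L n (x i).2)
      (fun _ _ => norm_ee_le h0 _ _) (fun _ _ => norm_ee_le h0 _ _)
    have hs : Summable fun n => ‖eN W a (fun n i => ee L n (x i).1) (fun n i => ee L n (x i).2) n‖ :=
      (summable_inv_sq D).of_nonneg_of_le (fun _ => norm_nonneg _) hb
    have := (multipliable_one_add_of_summable hs).hasProd.tendsto_prod_nat
    refine le_of_tendsto' this.norm fun n => ?_
    refine (norm_prod_one_add_le _ _ fun n _ => hb n).trans ?_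
    rw [Real.exp_le_exp]
    exact (summable_inv_sq D).sum_le_tsum _ fun n _ => by positivity
  have h2 : ∏ i, ‖(L:ℂ) * zZ L (x i).1 (x i).2‖
      ≤ C^(Fintype.card ι) * ∏ i, (‖om (x i).1‖^3 * ‖om (x i).2‖^3) := by
    rw [← Finset.card_univ, ← Finset.prod_const, ← Finset.prod_mul_distrib]
    exact Finset.prod_le_prod (fun _ _ => norm_nonneg _) fun i _ => h L _ _ hL
  gcongr

lemma KK_tendsto_L {ι : Type*} [Fintype ι] [DecidableEq ι] {W : ℕ} (hW : W ≠ 0) {a : ℕ → ℝ}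
    (ha : AOk W a) (x : ι → ℝ × ℝ) :
    Tendsto (fun L : ℝ => (L:ℂ)^(Fintype.card ι) * KK W a L x) atTop
      (𝓝 (SSer ι W a * ∏ i, (om (x i).1 * om (x i).2 / (om (x i).1 + om (x i).2)))) := by
  obtain ⟨D, hD, h'⟩ := eN_bound (ι := ι) hW ha
  have h2 : Tendsto (fun L : ℝ => ∏ i, ((L:ℂ) * zZ L (x i).1 (x i).2)) atTop
      (𝓝 (∏ i, (om (x i).1 * om (x i).2 / (om (x i).1 + om (x i).2)))) :=
    tendsto_finsetProd _ fun i _ => zZ_tendsto _ _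
  have h1 : Tendsto (fun L : ℝ => ∏' n, (1 + eN W a (fun n i => ee L n (x i).1)
      (fun n i => ee L n (x i).2) n)) atTop (𝓝 (SSer ι W a)) := by
    refine tendsto_tprod_one_add_of_dominated_convergence (summable_inv_sq D) (fun n => ?_) ?_
    · unfold eN
      split_ifs with hn
      · refine Tendsto.sub_const ?_ _
        unfold EE
        have t1 : ∀ i, Tendsto (fun L => ee L n (x i).1) atTop (𝓝 1) := fun i => ee_tendsto _ _
        have t2 : ∀ i, Tendsto (fun L => ee L n (x i).2) atTop (𝓝 1) := fun i => ee_tendsto _ _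
        refine Tendsto.mul (Tendsto.const_add _ (Tendsto.const_mul _ ?_)) ?_
        · refine tendsto_finsetSum _ fun i _ => ?_
          unfold bq
          exact ((t1 i).neg.sub (t2 i)).add ((t1 i).mul (t2 i))
        · refine tendsto_finsetProd _ fun i _ => ?_
          unfold rr
          have hne : (1 - (((n:ℝ)⁻¹ : ℝ) : ℂ) * 1) ≠ 0 := fun h => by
            have := norm_one_sub_ge (by positivity) (inv_prime_le hn) (α := 1) (by simp)
            rw [h, norm_zero] at this; linarith
          refine Tendsto.mul (Tendsto.mul (Tendsto.const_sub _ (Tendsto.const_mul _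
            ((t1 i).mul (t2 i)))) ?_) ?_
          · exact (Tendsto.const_sub _ (Tendsto.const_mul _ (t1 i))).inv₀ hne
          · exact (Tendsto.const_sub _ (Tendsto.const_mul _ (t2 i))).inv₀ hne
      · exact tendsto_const_nhds
    · filter_upwards [eventually_gt_atTop 0] with L hL
      exact h' _ _ (fun _ _ => norm_ee_le hL _ _) (fun _ _ => norm_ee_le hL _ _)
  refine (h1.mul h2).congr fun L => ?_
  unfold KK
  rw [Finset.prod_mul_distrib, Finset.prod_const, Finset.card_univ]; ring

end

section

open Filter Topology MeasureTheory

/-- product of all transforms -/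
noncomputable def PH {ι : Type*} [Fintype ι] (φ ψ : ι → ℝ → ℂ) (x : ι → ℝ × ℝ) : ℂ :=
  ∏ i, (φ i (x i).1 * ψ i (x i).2)

/-- the sieve coefficients, in integral form -/
noncomputable def GR {ι : Type*} [Fintype ι] (L : ℝ) (φ ψ : ι → ℝ → ℂ) (t : Finset ℕ) (ρ : t → ι) : ℂ :=
  ∫ x : ι → ℝ × ℝ, PH φ ψ x * ∏ p : t, bb L p (x (ρ p))

/-- a family of functions with transforms and supports -/
structure Fam {ι : Type*} [Fintype ι] (f g : ι → ℝ → ℝ) (φ ψ : ι → ℝ → ℂ) : Prop where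
  hf : ∀ i, LapRep (f i) (φ i)
  hg : ∀ i, LapRep (g i) (ψ i)

section
variable {ι : Type*} [Fintype ι] {f g : ι → ℝ → ℝ} {φ ψ : ι → ℝ → ℂ}

lemma Fam.contPH (H : Fam f g φ ψ) : Continuous (PH φ ψ) := by
  unfold PH
  refine continuous_finsetProd _ fun i _ => ?_
  have h1 := (H.hf i).cont
  have h2 := (H.hg i).cont
  fun_prop

lemma Fam.intPH (H : Fam f g φ ψ) : Integrable (PH φ ψ) := by
  unfold PH
  exact Integrable.fintype_prod_dep (f := fun i (y : ℝ × ℝ) => φ i y.1 * ψ i y.2)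
    fun i => (H.hf i).integrable.mul_prod (H.hg i).integrable

lemma Fam.int_bdd (H : Fam f g φ ψ) {F : (ι → ℝ × ℝ) → ℂ} {c : ℝ} (hF : Continuous F)
    (hc : ∀ x, ‖F x‖ ≤ c) : Integrable (fun x => PH φ ψ x * F x) :=
  H.intPH.mul_bdd (c := c) hF.aestronglyMeasurable (ae_of_all _ hc)

lemma LapRep.eq_ee {f : ℝ → ℝ} {φ : ℝ → ℂ} (h : LapRep f φ) (L : ℝ) (n : ℕ) :
    ∫ ξ, φ ξ * ee L n ξ = (f (Real.log n / L) : ℂ) := by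
  rw [h.eq]; rfl

lemma LapRep.int_ee {f : ℝ → ℝ} {φ : ℝ → ℂ} (h : LapRep f φ) (L : ℝ) (n : ℕ) :
    Integrable (fun ξ => φ ξ * ee L n ξ) := by
  have := h.integrable_pow_exp 0 (Real.log n / L)
  simp only [pow_zero, mul_one] at this
  exact this

lemma Fam.int_ee (H : Fam f g φ ψ) (L : ℝ) (d e : ι → ℕ) :
    ∫ x, PH φ ψ x * ∏ i, (ee L (d i) (x i).1 * ee L (e i) (x i).2)
      = ∏ i, ((f i (Real.log (d i) / L) : ℂ) * (g i (Real.log (e i) / L) : ℂ)) := by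
  have h1 : ∀ x : ι → ℝ × ℝ, PH φ ψ x * ∏ i, (ee L (d i) (x i).1 * ee L (e i) (x i).2)
      = ∏ i, (fun (i : ι) (y : ℝ × ℝ) => (φ i y.1 * ee L (d i) y.1) * (ψ i y.2 * ee L (e i) y.2)) i (x i) := by
    intro x
    unfold PH
    rw [← Finset.prod_mul_distrib]
    exact Finset.prod_congr rfl fun i _ => by ring
  rw [integral_congr_ae (ae_of_all _ h1)]
  refine (integral_fintype_prod_volume_eq_prod (fun (i : ι) (y : ℝ × ℝ) =>
    (φ i y.1 * ee L (d i) y.1) * (ψ i y.2 * ee L (e i) y.2))).trans ?_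
  refine Finset.prod_congr rfl fun i _ => ?_
  rw [← (H.hf i).eq_ee, ← (H.hg i).eq_ee]
  exact integral_prod_mul (fun ξ => φ i ξ * ee L (d i) ξ) (fun ξ => ψ i ξ * ee L (e i) ξ)

lemma ee_prod {L : ℝ} {κ : Type*} (s : Finset κ) (m : κ → ℕ) (hm : ∀ k ∈ s, m k ≠ 0) (ξ : ℝ) :
    ee L (∏ k ∈ s, m k) ξ = ∏ k ∈ s, ee L (m k) ξ := by
  classical
  induction s using Finset.induction_on with
  | empty => simp [ee_one]
  | insert j s hj ih =>
    rw [Finset.prod_insert hj, Finset.prod_insert hj, ee_mul (hm j (by simp)), ih]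
    · intro k hk; exact hm k (by simp [hk])
    · exact Finset.prod_ne_zero_iff.2 fun k hk => hm k (by simp [hk])

lemma ee_pow {L : ℝ} {n : ℕ} (hn : n ≠ 0) (u : ℕ) (ξ : ℝ) : ee L (n ^ u) ξ = ee L n ξ ^ u := by
  have := ee_prod (L := L) (Finset.range u) (fun _ => n) (fun _ _ => hn) ξ
  simpa using this

def sg : Fin 3 → ℤ := ![-1, -1, 1]
def ug : Fin 3 → ℕ := ![1, 0, 1]
def vg : Fin 3 → ℕ := ![0, 1, 1]

lemma bb_expand (L : ℝ) (p : ℕ) (x : ℝ × ℝ) :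
    bb L p x = ∑ c : Fin 3, (sg c : ℂ) * (ee L p x.1 ^ ug c * ee L p x.2 ^ vg c) := by
  simp [Fin.sum_univ_three, sg, ug, vg, bb, bq]
  ring

variable [DecidableEq ι]

/-- product of `p^{u}` over the fibre -/
def dd (t : Finset ℕ) (ρ : t → ι) (u : t → ℕ) (i : ι) : ℕ := ∏ p : t with ρ p = i, (p:ℕ) ^ u p

lemma prod_ee_fiber {L : ℝ} {t : Finset ℕ} (ht : ∀ p ∈ t, p ≠ 0) (ρ : t → ι) (u : t → ℕ)
    (y : ι → ℝ) : ∏ p : t, ee L p (y (ρ p)) ^ u p = ∏ i, ee L (dd t ρ u i) (y i) := by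
  rw [← Finset.prod_fiberwise _ ρ]
  refine Finset.prod_congr rfl fun i _ => ?_
  unfold dd
  rw [ee_prod _ (fun p : t => (p:ℕ) ^ u p) (fun k _ => pow_ne_zero _ (ht k k.2))]
  refine Finset.prod_congr rfl fun p hp => ?_
  rw [Finset.mem_filter] at hp
  rw [ee_pow (ht p p.2), hp.2]

lemma prod_dd (t : Finset ℕ) (ρ : t → ι) (u : t → ℕ) : ∏ i, dd t ρ u i = ∏ p : t, (p:ℕ) ^ u p := by
  unfold dd
  rw [Finset.prod_fiberwise]

lemma GR_eq (H : Fam f g φ ψ) {L : ℝ} (hL : 0 < L) {t : Finset ℕ} (ht : ∀ p ∈ t, p ≠ 0) (ρ : t → ι) :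
    GR L φ ψ t ρ = ∑ γ : t → Fin 3, (∏ p, (sg (γ p) : ℂ)) *
      ∏ i, ((f i (Real.log (dd t ρ (fun p => ug (γ p)) i) / L) : ℂ)
        * (g i (Real.log (dd t ρ (fun p => vg (γ p)) i) / L) : ℂ)) := by
  have h1 : ∀ x : ι → ℝ × ℝ, PH φ ψ x * ∏ p : t, bb L p (x (ρ p))
      = ∑ γ : t → Fin 3, (∏ p, (sg (γ p) : ℂ)) * (PH φ ψ x *
        ∏ i, (ee L (dd t ρ (fun p => ug (γ p)) i) (x i).1 *
          ee L (dd t ρ (fun p => vg (γ p)) i) (x i).2)) := by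
    intro x
    simp_rw [bb_expand]
    rw [Fintype.prod_sum, Finset.mul_sum]
    refine Finset.sum_congr rfl fun γ _ => ?_
    rw [Finset.prod_mul_distrib, Finset.prod_mul_distrib, Finset.prod_mul_distrib,
      prod_ee_fiber ht ρ (fun p => ug (γ p)) (fun i => (x i).1),
      prod_ee_fiber ht ρ (fun p => vg (γ p)) (fun i => (x i).2)]
    ring
  unfold GR
  simp_rw [h1]
  rw [integral_finsetSum]
  · refine Finset.sum_congr rfl fun γ _ => ?_
    rw [integral_const_mul, H.int_ee]
  · intro γ _
    refine Integrable.const_mul (H.int_bdd (c := 1) ?_ ?_) _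
    · fun_prop
    · intro x
      rw [norm_prod]
      refine Finset.prod_le_one (fun _ _ => norm_nonneg _) fun i _ => ?_
      rw [norm_mul]
      exact mul_le_one₀ (norm_ee_le hL _ _) (norm_nonneg _) (norm_ee_le hL _ _)

/-- boundedness and supports -/
structure Supp (f g : ι → ℝ → ℝ) : Prop where
  bf : ∀ i t, |f i t| ≤ 1
  bg : ∀ i t, |g i t| ≤ 1
  sp : ∃ c c' : ι → ℝ, (∀ i t, f i t ≠ 0 → t ≤ c i) ∧ (∀ i t, g i t ≠ 0 → t ≤ c' i) ∧
    ∑ i, (c i + c' i) ≤ 2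

lemma norm_sg (c : Fin 3) : ‖((sg c : ℤ) : ℂ)‖ = 1 := by
  fin_cases c <;> simp [sg]

lemma ug_add_vg (c : Fin 3) : 1 ≤ ug c + vg c := by
  fin_cases c <;> simp [ug, vg]

lemma GR_bound (H : Fam f g φ ψ) (S : Supp f g) {L : ℝ} (hL : 0 < L) {t : Finset ℕ}
    (ht : ∀ p ∈ t, p ≠ 0) (ρ : t → ι) : ‖GR L φ ψ t ρ‖ ≤ 3 ^ t.card := by
  rw [GR_eq H hL ht]
  refine (norm_sum_le _ _).trans ((Finset.sum_le_card_nsmul _ _ 1 fun γ _ => ?_).trans ?_)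
  · rw [norm_mul, norm_prod, Finset.prod_congr rfl (fun p _ => norm_sg (γ p)), Finset.prod_const_one,
      one_mul, norm_prod]
    refine Finset.prod_le_one (fun _ _ => norm_nonneg _) fun i _ => ?_
    rw [norm_mul, Complex.norm_real, Complex.norm_real]
    exact mul_le_one₀ (S.bf _ _) (norm_nonneg _) (S.bg _ _)
  · rw [Finset.card_univ, nsmul_eq_mul, mul_one, Fintype.card_fun]; simp

lemma GR_zero (H : Fam f g φ ψ) (S : Supp f g) {L : ℝ} (hL : 0 < L) {t : Finset ℕ}
    (ht : ∀ p ∈ t, p ≠ 0) (ρ : t → ι) (hbig : Real.exp (2 * L) < ((∏ p ∈ t, p : ℕ) : ℝ)) :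
    GR L φ ψ t ρ = 0 := by
  rw [GR_eq H hL ht]
  refine Finset.sum_eq_zero fun γ _ => ?_
  by_contra hne
  rw [mul_eq_zero, not_or] at hne
  have h1 := hne.2
  rw [← ne_eq, Finset.prod_ne_zero_iff] at h1
  obtain ⟨c, c', hc, hc', hs⟩ := S.sp
  have pos : ∀ u : t → ℕ, ∀ i, dd t ρ u i ≠ 0 := fun u i =>
    Finset.prod_ne_zero_iff.2 fun p _ => pow_ne_zero _ (ht p p.2)
  have h2 : ∀ i, Real.log (dd t ρ (fun p => ug (γ p)) i) + Real.log (dd t ρ (fun p => vg (γ p)) i)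
      ≤ (c i + c' i) * L := fun i => by
    have h3 := h1 i (Finset.mem_univ i)
    rw [mul_ne_zero_iff] at h3
    have a1 := hc i _ (by exact_mod_cast h3.1)
    have a2 := hc' i _ (by exact_mod_cast h3.2)
    rw [div_le_iff₀ hL] at a1 a2
    linarith
  have h4 := Finset.sum_le_sum fun i (_ : i ∈ Finset.univ) => h2 i
  rw [← Finset.sum_mul, Finset.sum_add_distrib, ← Real.log_prod, ← Real.log_prod] at h4
  · have e : ∀ u : t → ℕ, (∏ i, (dd t ρ u i : ℝ)) = ((∏ p : t, (p:ℕ) ^ u p : ℕ) : ℝ) := fun u => by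
      rw [← prod_dd t ρ u, Nat.cast_prod]
    rw [e, e, ← Real.log_mul, ← Nat.cast_mul, ← Finset.prod_mul_distrib] at h4
    · have h5 : ∏ p ∈ t, p ≤ ∏ p : t, ((p:ℕ) ^ ug (γ p) * (p:ℕ) ^ vg (γ p)) := by
        rw [← Finset.prod_coe_sort]
        refine Finset.prod_le_prod' fun p _ => ?_
        rw [← pow_add]
        exact Nat.le_self_pow (by have := ug_add_vg (γ p); omega) _
      have h6 : (2 * L) < Real.log ((∏ p ∈ t, p : ℕ) : ℝ) := by
        rw [Real.lt_log_iff_exp_lt ((Real.exp_pos _).trans hbig)]; exact hbig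
      have h7 := Real.log_le_log ((Real.exp_pos _).trans hbig) (Nat.cast_le (α := ℝ).2 h5)
      have h8 : (∑ i, (c i + c' i)) * L ≤ 2 * L := by gcongr
      linarith
    · rw [Nat.cast_ne_zero]
      exact Finset.prod_ne_zero_iff.2 fun p _ => pow_ne_zero _ (ht p p.2)
    · rw [Nat.cast_ne_zero]
      exact Finset.prod_ne_zero_iff.2 fun p _ => pow_ne_zero _ (ht p p.2)
  · intro i _; exact_mod_cast pos _ i
  · intro i _; exact_mod_cast pos _ i

end

end

section

open Filter Topology MeasureTheory

lemma sum_powerset_QQ {W y : ℕ} {S : Finset ℕ} (hS : ∀ p ∈ S, p.Prime ∧ ¬ p ∣ W)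
    (F : Finset ℕ → ℂ) (hF : ∀ t ⊆ S, y < ∏ p ∈ t, p → F t = 0) :
    ∑ t ∈ S.powerset, F t = ∑ q ∈ QQ W y with q.primeFactors ⊆ S, F q.primeFactors := by
  symm
  have hp : ∀ t ⊆ S, ∀ p ∈ t, p.Prime := fun t ht p hpt => (hS p (ht hpt)).1
  refine Finset.sum_of_injOn Nat.primeFactors ?_ ?_ ?_ ?_
  · intro q hq r hr h
    simp only [QQ, Finset.coe_filter, Finset.mem_filter, Set.mem_ofPred_eq] at hq hr
    rw [← Nat.prod_primeFactors_of_squarefree hq.1.2.1, ← Nat.prod_primeFactors_of_squarefree hr.1.2.1, h]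
  · intro q hq
    simp only [Finset.coe_filter, Set.mem_ofPred_eq] at hq
    simpa using hq.2
  · intro t ht hn
    rw [Finset.mem_powerset] at ht
    refine hF t ht ?_
    by_contra hle
    rw [not_lt] at hle
    refine hn ⟨∏ p ∈ t, p, ?_, Nat.primeFactors_prod (hp t ht)⟩
    simp only [QQ, Finset.coe_filter, Finset.mem_filter, Set.mem_ofPred_eq, Finset.mem_Icc]
    refine ⟨⟨⟨Nat.one_le_iff_ne_zero.2 (Finset.prod_ne_zero_iff.2 fun p h => (hp t ht p h).ne_zero), hle⟩,
      ?_, ?_⟩, ?_⟩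
    · refine Finset.squarefree_prod_of_pairwise_isCoprime ?_ (fun p h => (hp t ht p h).squarefree)
      intro p hpt r hrt hne
      exact Nat.coprime_iff_isRelPrime.1 ((Nat.coprime_primes (hp t ht p hpt) (hp t ht r hrt)).2 hne)
    · refine Nat.Coprime.prod_left fun p h => ?_
      exact (Nat.Prime.coprime_iff_not_dvd (hp t ht p h)).2 (hS p (ht h)).2
    · rw [Nat.primeFactors_prod (hp t ht)]; exact ht
  · intro q _; rfl

lemma prod_one_add_single {ι : Type*} [Fintype ι] [DecidableEq ι] (w : ι → ℂ)
    (h : ∀ i j, w i ≠ 0 → w j ≠ 0 → i = j) : ∏ i, (1 + w i) = 1 + ∑ i, w i := by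
  by_cases hz : ∃ i, w i ≠ 0
  · obtain ⟨i, hi⟩ := hz
    have h0 : ∀ j, j ≠ i → w j = 0 := fun j hj => by
      by_contra hc; exact hj (h j i hc hi)
    rw [Finset.prod_eq_single i (fun j _ hj => by rw [h0 j hj, add_zero]) (by simp),
      Finset.sum_eq_single i (fun j _ hj => h0 j hj) (by simp)]
  · push Not at hz
    simp [hz]

/-- sieving primes of `n` -/
def PS (W n : ℕ) : Finset ℕ := n.primeFactors.filter fun p => ¬ p ∣ W

/-- Selberg type weight -/
noncomputable def vv (L : ℝ) (W : ℕ) (f : ℝ → ℝ) (n : ℕ) : ℝ :=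
  ∑ t ∈ (PS W n).powerset, (-1) ^ t.card * f (Real.log (∏ p ∈ t, p : ℕ) / L)

lemma PS_prime {W n p : ℕ} (h : p ∈ PS W n) : p.Prime ∧ ¬ p ∣ W := by
  simp only [PS, Finset.mem_filter, Nat.mem_primeFactors] at h
  exact ⟨h.1.1, h.2⟩

lemma vv_eq {f : ℝ → ℝ} {φ : ℝ → ℂ} (h : LapRep f φ) (L : ℝ) (W n : ℕ) :
    ((vv L W f n : ℝ) : ℂ) = ∫ ξ, φ ξ * ∏ p ∈ PS W n, (1 - ee L p ξ) := by
  have h1 : ∀ ξ, φ ξ * ∏ p ∈ PS W n, (1 - ee L p ξ)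
      = ∑ t ∈ (PS W n).powerset, (-1) ^ t.card * (φ ξ * ee L (∏ p ∈ t, p) ξ) := fun ξ => by
    simp_rw [sub_eq_add_neg]
    rw [Finset.prod_one_add, Finset.mul_sum]
    refine Finset.sum_congr rfl fun t ht => ?_
    rw [Finset.mem_powerset] at ht
    rw [ee_prod t (fun p => p) (fun p hp => (PS_prime (ht hp)).1.ne_zero), Finset.prod_neg]
    ring
  rw [integral_congr_ae (ae_of_all _ h1), integral_finsetSum _ fun t _ => (h.int_ee L _).const_mul _]
  unfold vv
  push_cast
  refine Finset.sum_congr rfl fun t _ => ?_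
  rw [integral_const_mul, h.eq_ee]
  push_cast
  rfl

section
variable {ι : Type*} [Fintype ι] [DecidableEq ι] {f g : ι → ℝ → ℝ} {φ ψ : ι → ℝ → ℂ}

lemma bb_norm {L : ℝ} (hL : 0 < L) (p : ℕ) (x : ℝ × ℝ) : ‖bb L p x‖ ≤ 3 := by
  have := bq_bound le_rfl (norm_ee_le hL p x.1) (norm_ee_le hL p x.2)
  unfold bb; linarith

@[fun_prop] lemma continuous_bb (L : ℝ) (p : ℕ) : Continuous (bb L p) := by
  unfold bb bq; fun_prop

lemma GR_int (H : Fam f g φ ψ) {L : ℝ} (hL : 0 < L) (t : Finset ℕ) (ρ : t → ι) :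
    Integrable fun x : ι → ℝ × ℝ => PH φ ψ x * ∏ p : t, bb L p (x (ρ p)) := by
  refine H.int_bdd (c := ∏ p : t, 3) (by fun_prop) fun x => ?_
  rw [norm_prod]
  exact Finset.prod_le_prod (fun _ _ => norm_nonneg _) fun p _ => bb_norm hL _ _

/-- weighted sums over `ρ` as an integral -/
lemma sum_GR (H : Fam f g φ ψ) {L : ℝ} (hL : 0 < L) (t : Finset ℕ) (c : ℕ → ι → ℂ) :
    ∑ ρ : t → ι, (∏ p : t, c p (ρ p)) * GR L φ ψ t ρ
      = ∫ x : ι → ℝ × ℝ, PH φ ψ x * ∏ p ∈ t, ∑ i, c p i * bb L p (x i) := by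
  unfold GR
  simp_rw [← integral_const_mul]
  rw [← integral_finsetSum _ fun ρ _ => (GR_int H hL t ρ).const_mul _]
  refine integral_congr_ae (ae_of_all _ fun x => ?_)
  show _ = PH φ ψ x * ∏ p ∈ t, ∑ i, c p i * bb L p (x i)
  rw [← Finset.prod_coe_sort, Fintype.prod_sum, Finset.mul_sum]
  refine Finset.sum_congr rfl fun ρ _ => ?_
  rw [Finset.prod_mul_distrib]; ring

lemma sum_GR_int (H : Fam f g φ ψ) {L : ℝ} (hL : 0 < L) (t : Finset ℕ) (c : ℕ → ι → ℂ) :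
    Integrable fun x : ι → ℝ × ℝ => PH φ ψ x * ∏ p ∈ t, ∑ i, c p i * bb L p (x i) := by
  refine H.int_bdd (c := ∏ p ∈ t, ∑ i, ‖c p i‖ * 3) (by fun_prop) fun x => ?_
  rw [norm_prod]
  refine Finset.prod_le_prod (fun _ _ => norm_nonneg _) fun p _ => ?_
  refine (norm_sum_le _ _).trans (Finset.sum_le_sum fun i _ => ?_)
  rw [norm_mul]
  gcongr
  exact bb_norm hL _ _

/-- master expansion -/
lemma master (H : Fam f g φ ψ) (Sp : Supp f g) {L : ℝ} (hL : 0 < L) {W : ℕ} {S : Finset ℕ}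
    (hS : ∀ p ∈ S, p.Prime ∧ ¬ p ∣ W) (c : ℕ → ι → ℂ) :
    ∫ x : ι → ℝ × ℝ, PH φ ψ x * ∏ p ∈ S, (1 + ∑ i, c p i * bb L p (x i))
      = ∑ q ∈ QQ W ⌊Real.exp (2 * L)⌋₊ with q.primeFactors ⊆ S,
        ∑ ρ : q.primeFactors → ι, (∏ p : q.primeFactors, c p (ρ p)) * GR L φ ψ q.primeFactors ρ := by
  rw [← sum_powerset_QQ hS (fun t => ∑ ρ : t → ι, (∏ p : t, c p (ρ p)) * GR L φ ψ t ρ)]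
  · simp_rw [Finset.prod_one_add, Finset.mul_sum]
    rw [integral_finsetSum _ fun t _ => sum_GR_int H hL t c]
    exact Finset.sum_congr rfl fun t _ => (sum_GR H hL t c).symm
  · intro t ht hlt
    refine Finset.sum_eq_zero fun ρ _ => ?_
    rw [GR_zero H Sp hL (fun p hp => (hS p (ht hp)).1.ne_zero), mul_zero]
    exact Nat.lt_of_floor_lt hlt

lemma vident (H : Fam f g φ ψ) (Sp : Supp f g) {L : ℝ} (hL : 0 < L) {W : ℕ} (n : ι → ℕ)
    (hn : ∀ i, n i ≠ 0)
    (hd : ∀ p : ℕ, p.Prime → ¬ p ∣ W → ∀ i j, p ∣ n i → p ∣ n j → i = j) :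
    ((∏ i, (vv L W (f i) (n i) * vv L W (g i) (n i)) : ℝ) : ℂ)
      = ∑ q ∈ QQ W ⌊Real.exp (2 * L)⌋₊, ∑ ρ : q.primeFactors → ι,
        if (∀ p : q.primeFactors, (p:ℕ) ∣ n (ρ p)) then GR L φ ψ q.primeFactors ρ else 0 := by
  set S : Finset ℕ := Finset.univ.biUnion fun i => PS W (n i) with hSd
  have hS : ∀ p ∈ S, p.Prime ∧ ¬ p ∣ W := fun p hp => by
    rw [hSd, Finset.mem_biUnion] at hp
    obtain ⟨i, _, hi⟩ := hp
    exact PS_prime hi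
  set c : ℕ → ι → ℂ := fun p i => if p ∣ n i then 1 else 0 with hc
  have h1 : ((∏ i, (vv L W (f i) (n i) * vv L W (g i) (n i)) : ℝ) : ℂ)
      = ∫ x : ι → ℝ × ℝ, PH φ ψ x * ∏ p ∈ S, (1 + ∑ i, c p i * bb L p (x i)) := by
    have e1 : ∀ x : ι → ℝ × ℝ, PH φ ψ x * ∏ p ∈ S, (1 + ∑ i, c p i * bb L p (x i))
        = ∏ i, (fun (i : ι) (y : ℝ × ℝ) => (φ i y.1 * ∏ p ∈ PS W (n i), (1 - ee L p y.1)) *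
          (ψ i y.2 * ∏ p ∈ PS W (n i), (1 - ee L p y.2))) i (x i) := fun x => by
      have e2 : ∀ p ∈ S, (1 + ∑ i, c p i * bb L p (x i)) = ∏ i, (1 + c p i * bb L p (x i)) :=
        fun p hp => by
          rw [prod_one_add_single]
          intro i j hi hj
          have hi' := left_ne_zero_of_mul hi
          have hj' := left_ne_zero_of_mul hj
          simp only [hc, ne_eq, ite_eq_right_iff, one_ne_zero, imp_false, not_not] at hi' hj'
          exact hd p (hS p hp).1 (hS p hp).2 i j hi' hj'
      rw [Finset.prod_congr rfl e2, Finset.prod_comm]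
      unfold PH
      rw [← Finset.prod_mul_distrib]
      refine Finset.prod_congr rfl fun i _ => ?_
      have e3 : ∏ p ∈ S, (1 + c p i * bb L p (x i))
          = ∏ p ∈ PS W (n i), ((1 - ee L p (x i).1) * (1 - ee L p (x i).2)) := by
        have hsub : PS W (n i) ⊆ S := Finset.subset_biUnion_of_mem (fun i => PS W (n i)) (Finset.mem_univ i)
        rw [← Finset.prod_subset hsub]
        · refine Finset.prod_congr rfl fun p hp => ?_
          have hp' : p ∣ n i := by
            simp only [PS, Finset.mem_filter, Nat.mem_primeFactors] at hp
            exact hp.1.2.1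
          simp only [hc, if_pos hp', bb, bq]; ring
        · intro p hp hnp
          have : ¬ p ∣ n i := fun hdv => hnp (by
            simp only [PS, Finset.mem_filter, Nat.mem_primeFactors]
            exact ⟨⟨(hS p hp).1, hdv, hn i⟩, (hS p hp).2⟩)
          simp [hc, this]
      rw [e3, Finset.prod_mul_distrib]; ring
    rw [integral_congr_ae (ae_of_all _ e1)]
    refine Eq.trans ?_ (integral_fintype_prod_volume_eq_prod (fun (i : ι) (y : ℝ × ℝ) =>
      (φ i y.1 * ∏ p ∈ PS W (n i), (1 - ee L p y.1)) *
          (ψ i y.2 * ∏ p ∈ PS W (n i), (1 - ee L p y.2)))).symm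
    push_cast
    refine Finset.prod_congr rfl fun i _ => ?_
    rw [vv_eq (H.hf i), vv_eq (H.hg i)]
    exact (integral_prod_mul (fun ξ => φ i ξ * ∏ p ∈ PS W (n i), (1 - ee L p ξ))
      (fun ξ => ψ i ξ * ∏ p ∈ PS W (n i), (1 - ee L p ξ))).symm
  rw [h1, master H Sp hL hS]
  have hcp : ∀ (q : ℕ) (ρ : q.primeFactors → ι), (∏ p : q.primeFactors, c p (ρ p))
      * GR L φ ψ q.primeFactors ρ
      = if (∀ p : q.primeFactors, (p:ℕ) ∣ n (ρ p)) then GR L φ ψ q.primeFactors ρ else 0 := by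
    intro q ρ
    split_ifs with hall
    · rw [Finset.prod_eq_one, one_mul]
      intro p _; simp only [hc, if_pos (hall p)]
    · push Not at hall
      obtain ⟨p, hp⟩ := hall
      rw [Finset.prod_eq_zero (Finset.mem_univ p), zero_mul]
      simp only [hc, if_neg hp]
  simp_rw [hcp]
  rw [Finset.sum_filter]
  refine Finset.sum_congr rfl fun q hq => ?_
  split_ifs with hsub
  · rfl
  · symm
    refine Finset.sum_eq_zero fun ρ _ => ?_
    rw [if_neg]
    intro hall
    refine hsub fun p hp => ?_
    have hpp := Nat.prime_of_mem_primeFactors hp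
    rw [hSd, Finset.mem_biUnion]
    refine ⟨ρ ⟨p, hp⟩, Finset.mem_univ _, ?_⟩
    simp only [PS, Finset.mem_filter, Nat.mem_primeFactors]
    refine ⟨⟨hpp, hall ⟨p, hp⟩, hn _⟩, fun hpW => ?_⟩
    simp only [QQ, Finset.mem_filter] at hq
    exact hpp.one_lt.ne' (Nat.eq_one_of_dvd_coprimes hq.2.2 (Nat.dvd_of_mem_primeFactors hp) hpW)

end

end

section

open Filter Topology MeasureTheory

lemma fubini_om {f g : ℝ → ℝ} {φ ψ : ℝ → ℂ} (hf : LapRep f φ) (hg : LapRep g ψ)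
    (df : Differentiable ℝ f) (dg : Differentiable ℝ g) :
    ∫ y : ℝ × ℝ, (φ y.1 * ψ y.2) * (om y.1 * om y.2 / (om y.1 + om y.2))
      = ((∫ t in Set.Ioi (0:ℝ), deriv f t * deriv g t : ℝ) : ℂ) := by
  have h1 : ∀ t : ℝ, ((deriv f t * deriv g t : ℝ) : ℂ)
      = ∫ y : ℝ × ℝ, (φ y.1 * om y.1 * Complex.exp (-(t * om y.1))) *
        (ψ y.2 * om y.2 * Complex.exp (-(t * om y.2))) := fun t => by
    push_cast
    rw [hf.deriv_eq df, hg.deriv_eq dg, neg_mul_neg]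
    exact (integral_prod_mul (fun ξ => φ ξ * om ξ * Complex.exp (-(t * om ξ)))
      (fun ξ => ψ ξ * om ξ * Complex.exp (-(t * om ξ)))).symm
  rw [← integral_complex_ofReal]
  simp_rw [h1]
  have hφc := hf.cont
  have hψc := hg.cont
  rw [integral_integral_swap]
  · refine integral_congr_ae (ae_of_all _ fun y => ?_)
    have e : ∀ t : ℝ, (φ y.1 * om y.1 * Complex.exp (-(t * om y.1))) *
        (ψ y.2 * om y.2 * Complex.exp (-(t * om y.2)))
        = (φ y.1 * om y.1 * (ψ y.2 * om y.2)) * Complex.exp (-(om y.1 + om y.2) * t) := fun t => by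
      have : Complex.exp (-(om y.1 + om y.2) * t)
          = Complex.exp (-(t * om y.1)) * Complex.exp (-(t * om y.2)) := by
        rw [← Complex.exp_add]; congr 1; ring
      rw [this]; ring
    show _ = ∫ t in Set.Ioi (0:ℝ), (φ y.1 * om y.1 * Complex.exp (-(t * om y.1))) *
        (ψ y.2 * om y.2 * Complex.exp (-(t * om y.2)))
    simp_rw [e]
    rw [integral_const_mul, integral_exp_mul_complex_Ioi]
    · simp only [Complex.ofReal_zero, mul_zero, Complex.exp_zero, neg_div_neg_eq]
      ring
    · rw [Complex.neg_re, Complex.add_re, om_re, om_re]; norm_num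
  · have b1 : Integrable (fun t : ℝ => Real.exp (-2 * t)) (volume.restrict (Set.Ioi 0)) :=
      integrableOn_exp_mul_Ioi (by norm_num) 0
    have i1 := hf.int 1
    have i2 := hg.int 1
    simp only [pow_one] at i1 i2
    have b3 := b1.mul_prod (i1.mul_prod i2)
    refine b3.mono' ?_ (ae_of_all _ fun z => ?_)
    · apply Continuous.aestronglyMeasurable
      unfold Function.uncurry
      fun_prop
    · simp only [Function.uncurry, norm_mul, Complex.norm_exp, Complex.neg_re, Complex.re_ofReal_mul,
        om_re, mul_one]
      have : Real.exp (-2 * z.1) = Real.exp (-z.1) * Real.exp (-z.1) := by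
        rw [← Real.exp_add]; congr 1; ring
      rw [this]
      apply le_of_eq; ring

section
variable {ι : Type*} [Fintype ι] [DecidableEq ι] {f g : ι → ℝ → ℝ} {φ ψ : ι → ℝ → ℂ}

noncomputable def mainSum (L : ℝ) (W : ℕ) (a : ℕ → ℝ) (φ ψ : ι → ℝ → ℂ) : ℂ :=
  ∑ q ∈ QQ W ⌊Real.exp (2 * L)⌋₊, (∏ p ∈ q.primeFactors, (a p : ℂ)) *
    ∑ ρ : q.primeFactors → ι, GR L φ ψ q.primeFactors ρ

lemma mainSum_eq_n (H : Fam f g φ ψ) (Sp : Supp f g) {L : ℝ} (hL : 0 < L) {W : ℕ} (a : ℕ → ℝ)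
    {n : ℕ} (hn : ⌊Real.exp (2 * L)⌋₊ < n) :
    mainSum L W a φ ψ = ∫ x : ι → ℝ × ℝ, PH φ ψ x * ∏ p ∈ n.primesBelow, Fac W a L p x := by
  set S : Finset ℕ := n.primesBelow.filter fun p => ¬ p ∣ W with hSd
  have hS : ∀ p ∈ S, p.Prime ∧ ¬ p ∣ W := fun p hp => by
    rw [hSd, Finset.mem_filter] at hp
    exact ⟨Nat.prime_of_mem_primesBelow hp.1, hp.2⟩
  have h1 := master H Sp hL hS (fun p _ => (a p : ℂ))
  have h2 : ∀ x : ι → ℝ × ℝ, PH φ ψ x * ∏ p ∈ n.primesBelow, Fac W a L p x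
      = PH φ ψ x * ∏ p ∈ S, (1 + ∑ i, (a p : ℂ) * bb L p (x i)) := fun x => by
    congr 1
    rw [hSd, Finset.prod_filter]
    refine Finset.prod_congr rfl fun p _ => ?_
    unfold Fac
    split_ifs <;> simp_all [Finset.mul_sum]
  rw [integral_congr_ae (ae_of_all _ h2), h1, mainSum, Finset.sum_filter]
  refine Finset.sum_congr rfl fun q hq => ?_
  simp only [QQ, Finset.mem_filter, Finset.mem_Icc] at hq
  rw [if_pos, Finset.mul_sum]
  · refine Finset.sum_congr rfl fun ρ _ => ?_
    congr 1
    exact (Finset.prod_coe_sort q.primeFactors (fun p => (a p : ℂ))).symm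
  · intro p hp
    have hpp := Nat.prime_of_mem_primeFactors hp
    rw [hSd, Finset.mem_filter, Nat.mem_primesBelow]
    refine ⟨⟨?_, hpp⟩, fun hpW => ?_⟩
    · exact lt_of_le_of_lt ((Nat.le_of_mem_primeFactors hp).trans hq.1.2) hn
    · exact hpp.one_lt.ne' (Nat.eq_one_of_dvd_coprimes hq.2.2 (Nat.dvd_of_mem_primeFactors hp) hpW)

lemma continuous_Fac_prod (W : ℕ) (a : ℕ → ℝ) (L : ℝ) (n : ℕ) :
    Continuous fun x : ι → ℝ × ℝ => ∏ p ∈ n.primesBelow, Fac W a L p x := by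
  unfold Fac; fun_prop

lemma mainSum_eq (H : Fam f g φ ψ) (Sp : Supp f g) {L : ℝ} (hL : 1 ≤ L) {W : ℕ} (hW : W ≠ 0)
    {a : ℕ → ℝ} (ha : AOk W a) :
    mainSum L W a φ ψ = ∫ x : ι → ℝ × ℝ, PH φ ψ x * KK W a L x := by
  have h0 : 0 < L := by linarith
  have h1 : Tendsto (fun n : ℕ => ∫ x : ι → ℝ × ℝ, PH φ ψ x * ∏ p ∈ n.primesBelow, Fac W a L p x)
      atTop (𝓝 (∫ x : ι → ℝ × ℝ, PH φ ψ x * KK W a L x)) := by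
    refine tendsto_integral_of_dominated_convergence
      (fun x => ‖PH φ ψ x‖ * Real.exp (6 * Fintype.card ι * (2 * L))) ?_ ?_ ?_ ?_
    · exact fun n => (H.contPH.mul (continuous_Fac_prod W a L n)).aestronglyMeasurable
    · exact H.intPH.norm.mul_const _
    · refine fun n => ae_of_all _ fun x => ?_
      rw [norm_mul]
      gcongr
      exact Fac_prod_bound ha hL x n
    · exact ae_of_all _ fun x => (KK_tendsto_n hW ha h0 x).const_mul _
  refine tendsto_nhds_unique (tendsto_const_nhds.congr' ?_) h1
  filter_upwards [eventually_gt_atTop ⌊Real.exp (2 * L)⌋₊] with n hn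
  exact mainSum_eq_n H Sp h0 a hn

lemma KK_meas (H : Fam f g φ ψ) {L : ℝ} (hL : 0 < L) {W : ℕ} (hW : W ≠ 0)
    {a : ℕ → ℝ} (ha : AOk W a) : AEStronglyMeasurable (fun x : ι → ℝ × ℝ => KK W a L x) volume :=
  aestronglyMeasurable_of_tendsto_ae atTop
    (fun n : ℕ => (continuous_Fac_prod W a L n).aestronglyMeasurable)
    (ae_of_all _ fun x => KK_tendsto_n hW ha hL x)

theorem mainSum_tendsto (H : Fam f g φ ψ) (Sp : Supp f g) (df : ∀ i, Differentiable ℝ (f i))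
    (dg : ∀ i, Differentiable ℝ (g i)) {W : ℕ} (hW : W ≠ 0) {a : ℕ → ℝ} (ha : AOk W a) :
    Tendsto (fun L : ℝ => (L:ℂ) ^ (Fintype.card ι) * mainSum L W a φ ψ) atTop
      (𝓝 (SSer ι W a * ∏ i, ((∫ t in Set.Ioi (0:ℝ), deriv (f i) t * deriv (g i) t : ℝ) : ℂ))) := by
  obtain ⟨C, hC, hb⟩ := KK_bound (ι := ι) hW ha
  have h1 : Tendsto (fun L : ℝ => ∫ x : ι → ℝ × ℝ, PH φ ψ x * ((L:ℂ) ^ (Fintype.card ι) * KK W a L x))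
      atTop (𝓝 (∫ x : ι → ℝ × ℝ, PH φ ψ x * (SSer ι W a *
        ∏ i, (om (x i).1 * om (x i).2 / (om (x i).1 + om (x i).2))))) := by
    refine tendsto_integral_filter_of_dominated_convergence
      (fun x => C * ∏ i, ((‖φ i (x i).1‖ * ‖om (x i).1‖^3) * (‖ψ i (x i).2‖ * ‖om (x i).2‖^3))) ?_ ?_ ?_ ?_
    · filter_upwards [eventually_ge_atTop 1] with L hL
      exact H.contPH.aestronglyMeasurable.mul ((KK_meas H (by linarith) hW ha).const_mul _)
    · filter_upwards [eventually_ge_atTop 1] with L hL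
      refine ae_of_all _ fun x => ?_
      rw [norm_mul]
      have e : ∏ i, ((‖φ i (x i).1‖ * ‖om (x i).1‖^3) * (‖ψ i (x i).2‖ * ‖om (x i).2‖^3))
          = ‖PH φ ψ x‖ * ∏ i, (‖om (x i).1‖^3 * ‖om (x i).2‖^3) := by
        unfold PH
        rw [norm_prod, ← Finset.prod_mul_distrib]
        refine Finset.prod_congr rfl fun i _ => ?_
        rw [norm_mul]; ring
      rw [e, mul_left_comm]
      gcongr
      exact hb L x hL
    · refine Integrable.const_mul ?_ C
      exact Integrable.fintype_prod_dep (f := fun i (y : ℝ × ℝ) =>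
        (‖φ i y.1‖ * ‖om y.1‖^3) * (‖ψ i y.2‖ * ‖om y.2‖^3))
        fun i => ((H.hf i).int 3).mul_prod ((H.hg i).int 3)
    · exact ae_of_all _ fun x => (KK_tendsto_L hW ha x).const_mul _
  have e2 : ∫ x : ι → ℝ × ℝ, PH φ ψ x * (SSer ι W a *
        ∏ i, (om (x i).1 * om (x i).2 / (om (x i).1 + om (x i).2)))
      = SSer ι W a * ∏ i, ((∫ t in Set.Ioi (0:ℝ), deriv (f i) t * deriv (g i) t : ℝ) : ℂ) := by
    simp_rw [mul_left_comm (PH φ ψ _)]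
    rw [integral_const_mul]
    congr 1
    have e3 : ∀ x : ι → ℝ × ℝ, PH φ ψ x * ∏ i, (om (x i).1 * om (x i).2 / (om (x i).1 + om (x i).2))
        = ∏ i, (fun (i : ι) (y : ℝ × ℝ) => (φ i y.1 * ψ i y.2) *
          (om y.1 * om y.2 / (om y.1 + om y.2))) i (x i) := fun x => by
      unfold PH
      rw [← Finset.prod_mul_distrib]
    rw [integral_congr_ae (ae_of_all _ e3)]
    refine (integral_fintype_prod_volume_eq_prod (fun (i : ι) (y : ℝ × ℝ) => (φ i y.1 * ψ i y.2) *
          (om y.1 * om y.2 / (om y.1 + om y.2)))).trans ?_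
    exact Finset.prod_congr rfl fun i _ => fubini_om (H.hf i) (H.hg i) (df i) (dg i)
  rw [e2] at h1
  refine h1.congr' ?_
  filter_upwards [eventually_ge_atTop 1] with L hL
  rw [mainSum_eq H Sp hL hW ha, ← integral_const_mul]
  refine integral_congr_ae (ae_of_all _ fun x => ?_)
  show PH φ ψ x * ((L:ℂ) ^ (Fintype.card ι) * KK W a L x) = (L:ℂ) ^ (Fintype.card ι) * (PH φ ψ x * KK W a L x)
  ring

end

end

section

open Filter Topology

noncomputable def ER (W : ℕ) (a : ℕ → ℝ) (k p : ℕ) : ℝ :=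
  (1 - (if p ∣ W then 0 else a p) * k) * ((1 - (p:ℝ)⁻¹)⁻¹)^k

lemma EE_one {ι : Type*} [Fintype ι] (W : ℕ) (a : ℕ → ℝ) {p : ℕ} (hp : p.Prime) :
    EE W a p (fun _ : ι => 1) (fun _ => 1) = (ER W a (Fintype.card ι) p : ℂ) := by
  have h2 : (2:ℝ) ≤ p := by exact_mod_cast hp.two_le
  have h3 : (1 - (p:ℝ)⁻¹) ≠ 0 := by
    have : (p:ℝ)⁻¹ ≤ 2⁻¹ := inv_anti₀ (by norm_num) h2
    have : (p:ℝ)⁻¹ ≤ 1/2 := by linarith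
    intro h; linarith
  have h4 : (1 - ((p:ℝ)⁻¹ : ℝ) : ℂ) ≠ 0 := by exact_mod_cast h3
  have h5 : rr (p:ℝ)⁻¹ 1 1 = (((1 - (p:ℝ)⁻¹)⁻¹ : ℝ) : ℂ) := by
    unfold rr
    push_cast at h4 ⊢
    simp only [mul_one]
    field_simp
  unfold EE ER
  rw [Finset.prod_const, Finset.card_univ, h5, Finset.sum_const, Finset.card_univ]
  unfold bq
  push_cast
  congr 1
  simp only [nsmul_eq_mul]
  split_ifs <;> ring

lemma SSer_lim (ι : Type*) [Fintype ι] [DecidableEq ι] {W : ℕ} (hW : W ≠ 0) {a : ℕ → ℝ}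
    (ha : AOk W a) :
    Tendsto (fun n => ((∏ p ∈ Nat.primesBelow n, ER W a (Fintype.card ι) p : ℝ) : ℂ)) atTop
      (𝓝 (SSer ι W a)) := by
  have := eN_hasProd (ι := ι) hW ha (fun _ _ => 1) (fun _ _ => 1) (by simp) (by simp)
  refine this.congr fun n => ?_
  push_cast
  exact Finset.prod_congr rfl fun p hp => EE_one W a (Nat.prime_of_mem_primesBelow hp)

lemma AOk_one (W : ℕ) : AOk W (fun p => (p:ℝ)⁻¹) := fun p _ _ => by simp

lemma AOk_two (W : ℕ) : AOk W (fun p => ((p:ℝ) - 1)⁻¹) := fun p hp _ => by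
  have h2 : (2:ℝ) ≤ p := by exact_mod_cast hp.two_le
  have h3 : ((p:ℝ) - 1)⁻¹ - (p:ℝ)⁻¹ = ((p:ℝ)*(p-1))⁻¹ := by
    have : (p:ℝ) - 1 ≠ 0 := by intro h; linarith
    field_simp
    ring
  rw [h3, abs_of_nonneg (by rw [inv_nonneg]; nlinarith), inv_pow, ← div_eq_mul_inv,
    inv_eq_one_div, div_le_div_iff₀ (by nlinarith) (by positivity)]
  nlinarith

lemma SSer_pos (ι : Type*) [Fintype ι] [DecidableEq ι] {W : ℕ} (hW : W ≠ 0)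
    (hk : ∀ p : ℕ, p.Prime → ¬ p ∣ W → Fintype.card ι < p) :
    ∃ s : ℝ, 0 < s ∧ SSer ι W (fun p => (p:ℝ)⁻¹) = (s : ℂ) := by
  have hl := SSer_lim ι hW (AOk_one W)
  have hp : ∀ p : ℕ, p.Prime → 0 < ER W (fun p => (p:ℝ)⁻¹) (Fintype.card ι) p := fun p hp => by
    have h2 : (2:ℝ) ≤ p := by exact_mod_cast hp.two_le
    have h3 : 0 < (1 - (p:ℝ)⁻¹) := by
      have : (p:ℝ)⁻¹ ≤ 2⁻¹ := inv_anti₀ (by norm_num) h2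
      have : (p:ℝ)⁻¹ ≤ 1/2 := by linarith
      linarith
    unfold ER
    refine mul_pos ?_ (by positivity)
    split_ifs with h
    · simp
    · have : (Fintype.card ι : ℝ) < p := by exact_mod_cast hk p hp h
      rw [sub_pos, inv_mul_lt_iff₀ (by linarith)]
      linarith
  have hre : Tendsto (fun n => (∏ p ∈ Nat.primesBelow n, ER W (fun p => (p:ℝ)⁻¹) (Fintype.card ι) p : ℝ))
      atTop (𝓝 (SSer ι W (fun p => (p:ℝ)⁻¹)).re) := by
    have := (Complex.continuous_re.tendsto _).comp hl
    exact this.congr fun n => by simp only [Function.comp_apply, Complex.ofReal_re]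
  have heq : SSer ι W (fun p => (p:ℝ)⁻¹) = ((SSer ι W (fun p => (p:ℝ)⁻¹)).re : ℂ) :=
    tendsto_nhds_unique hl ((Complex.continuous_ofReal.tendsto _).comp hre)
  have hne : SSer ι W (fun p => (p:ℝ)⁻¹) ≠ 0 := by
    obtain ⟨C, hC, h⟩ := eN_bound (ι := ι) hW (AOk_one W)
    unfold SSer
    refine tprod_one_add_ne_zero_of_summable (fun n => ?_)
      ((summable_inv_sq C).of_nonneg_of_le (fun _ => norm_nonneg _)
        (h (fun _ _ => 1) (fun _ _ => 1) (by simp) (by simp)))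
    unfold eN
    split_ifs with hn
    · rw [EE_one W _ hn]
      have := (hp n hn).ne'
      rw [add_sub_cancel]
      exact_mod_cast this
    · simp
  refine ⟨_, lt_of_le_of_ne ?_ fun h => hne ?_, heq⟩
  · exact ge_of_tendsto' hre fun n => Finset.prod_nonneg fun p h =>
      (hp p (Nat.prime_of_mem_primesBelow h)).le
  · rw [heq, ← h]; simp

lemma ER_rel (W k p : ℕ) (hp : p.Prime) :
    ER W (fun p => ((p:ℝ)-1)⁻¹) k p
      = ER W (fun p => (p:ℝ)⁻¹) (k+1) p * (if p ∣ W then (1 - (p:ℝ)⁻¹) else 1) := by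
  have h2 : (2:ℝ) ≤ p := by exact_mod_cast hp.two_le
  have h1 : (p:ℝ) - 1 ≠ 0 := by intro h; linarith
  have h0 : (p:ℝ) ≠ 0 := by intro h; linarith
  have h3 : 1 - (p:ℝ)⁻¹ = (p-1)/p := by field_simp
  unfold ER
  rw [h3]
  have h4 : ((p:ℝ)-1)/p ≠ 0 := by positivity
  split_ifs
  · rw [pow_succ]; field_simp; simp
  · rw [pow_succ, mul_one, mul_comm (((((p:ℝ)-1)/p)⁻¹)^k), ← mul_assoc]
    congr 1
    push_cast
    field_simp
    ring

lemma SSer_rel (ι ι' : Type*) [Fintype ι] [DecidableEq ι] [Fintype ι'] [DecidableEq ι'] {W : ℕ}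
    (hW : W ≠ 0) (hc : Fintype.card ι = Fintype.card ι' + 1) :
    SSer ι' W (fun p => ((p:ℝ)-1)⁻¹) = SSer ι W (fun p => (p:ℝ)⁻¹) * ((W.totient : ℂ) / W) := by
  have h1 := SSer_lim ι hW (AOk_one W)
  have h2 := SSer_lim ι' hW (AOk_two W)
  refine tendsto_nhds_unique h2 ((h1.mul_const _).congr' ?_)
  filter_upwards [eventually_gt_atTop W] with n hn
  have hW0 : (W:ℝ) ≠ 0 := by exact_mod_cast hW
  have h3 : ∏ p ∈ Nat.primesBelow n, (if p ∣ W then (1 - (p:ℝ)⁻¹) else 1)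
      = (W.totient:ℝ) / W := by
    rw [← Finset.prod_filter, eq_div_iff hW0]
    have h4 : (Nat.primesBelow n).filter (· ∣ W) = W.primeFactors := by
      ext p
      simp only [Finset.mem_filter, Nat.mem_primesBelow, Nat.mem_primeFactors]
      constructor
      · rintro ⟨⟨a, b⟩, c⟩; exact ⟨b, c, hW⟩
      · rintro ⟨a, b, c⟩
        exact ⟨⟨(Nat.le_of_dvd (Nat.pos_of_ne_zero hW) b).trans_lt hn, a⟩, b⟩
    rw [h4]
    have := Nat.totient_eq_mul_prod_factors W
    have h5 : (W.totient:ℝ) = W * ∏ p ∈ W.primeFactors, (1 - (p:ℝ)⁻¹) := by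
      have h7 := congrArg (Rat.cast : ℚ → ℝ) this
      push_cast at h7
      exact h7
    rw [h5, mul_comm]
  have h6 : ((W.totient : ℂ) / W) = (((W.totient:ℝ) / W : ℝ) : ℂ) := by push_cast; rfl
  rw [h6, ← h3, ← Complex.ofReal_mul, ← Finset.prod_mul_distrib, hc]
  congr 1
  exact Finset.prod_congr rfl fun p hp => (ER_rel W _ p (Nat.prime_of_mem_primesBelow hp)).symm

end

section

open Filter Topology

lemma dvd_add_iff_modEq {p e m : ℕ} (hp : 0 < p) : p ∣ m + e ↔ m ≡ e * (p - 1) [MOD p] := by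
  have h1 : e * (p-1) + e = e * p := by
    obtain ⟨r, rfl⟩ := Nat.exists_eq_succ_of_ne_zero hp.ne'
    simp [Nat.mul_succ]
  constructor
  · intro h
    refine Nat.ModEq.add_right_cancel' e ?_
    rw [h1]
    exact ((Nat.modEq_zero_iff_dvd.2 h).trans (Nat.modEq_zero_iff_dvd.2 (dvd_mul_left p e)).symm)
  · intro h
    have := h.add_right e
    rw [h1] at this
    exact Nat.modEq_zero_iff_dvd.1 (this.trans (Nat.modEq_zero_iff_dvd.2 (dvd_mul_left p e)))

lemma crt_set (W v0 : ℕ) (e : ℕ → ℕ) (t : Finset ℕ) (ht : ∀ p ∈ t, p.Prime ∧ ¬ p ∣ W) :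
    ∃ r, ∀ m, (m ≡ v0 [MOD W] ∧ ∀ p ∈ t, p ∣ m + e p) ↔ m ≡ r [MOD W * ∏ p ∈ t, p] := by
  induction t using Finset.induction_on with
  | empty => exact ⟨v0, fun m => by simp⟩
  | insert p t hp ih =>
    obtain ⟨r, hr⟩ := ih fun q hq => ht q (Finset.mem_insert_of_mem hq)
    have hpp := (ht p (Finset.mem_insert_self _ _)).1
    have hpW := (ht p (Finset.mem_insert_self _ _)).2
    have co : Nat.Coprime (W * ∏ p ∈ t, p) p := by
      refine Nat.Coprime.mul_left ((Nat.Prime.coprime_iff_not_dvd hpp).2 hpW).symm ?_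
      refine Nat.Coprime.prod_left fun q hq => ?_
      refine (Nat.coprime_primes (ht q (Finset.mem_insert_of_mem hq)).1 hpp).2 ?_
      rintro rfl; exact hp hq
    obtain ⟨k, hk1, hk2⟩ := Nat.chineseRemainder co r (e p * (p-1))
    refine ⟨k, fun m => ?_⟩
    rw [Finset.prod_insert hp, mul_comm p, ← mul_assoc, ← Nat.modEq_and_modEq_iff_modEq_mul co,
      Finset.forall_mem_insert]
    have h1 : m ≡ k [MOD W * ∏ p ∈ t, p] ↔ (m ≡ v0 [MOD W] ∧ ∀ p ∈ t, p ∣ m + e p) := by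
      rw [hr]; exact ⟨fun h => h.trans hk1, fun h => h.trans hk1.symm⟩
    have h2 : m ≡ k [MOD p] ↔ p ∣ m + e p := by
      rw [dvd_add_iff_modEq hpp.pos]; exact ⟨fun h => h.trans hk2, fun h => h.trans hk2.symm⟩
    rw [h1, h2]
    tauto

lemma QQ_prime {W y q p : ℕ} (hq : q ∈ QQ W y) (hp : p ∈ q.primeFactors) : p.Prime ∧ ¬ p ∣ W := by
  simp only [QQ, Finset.mem_filter] at hq
  have hpp := Nat.prime_of_mem_primeFactors hp
  refine ⟨hpp, fun hd => ?_⟩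
  have := Nat.dvd_gcd (Nat.dvd_of_mem_primeFactors hp) hd
  rw [hq.2.2] at this
  exact hpp.one_lt.ne' (Nat.dvd_one.1 this)

lemma crt_q {ι : Type*} {W v0 y q : ℕ} (hq : q ∈ QQ W y) (h : ι → ℕ) (ρ : q.primeFactors → ι) :
    ∃ r, ∀ m, (m ≡ v0 [MOD W] ∧ ∀ p : q.primeFactors, (p:ℕ) ∣ m + h (ρ p)) ↔
      m ≡ r [MOD W * q] := by
  classical
  obtain ⟨r, hr⟩ := crt_set W v0 (fun p => if hp : p ∈ q.primeFactors then h (ρ ⟨p, hp⟩) else 0)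
    q.primeFactors fun p hp => QQ_prime hq hp
  have hs : ∏ p ∈ q.primeFactors, p = q :=
    Nat.prod_primeFactors_of_squarefree (by simp only [QQ, Finset.mem_filter] at hq; exact hq.2.1)
  rw [hs] at hr
  refine ⟨r, fun m => ?_⟩
  rw [← hr]
  refine and_congr_right fun _ => ?_
  constructor
  · intro h' p hp
    rw [dif_pos hp]; exact h' ⟨p, hp⟩
  · intro h' p
    have := h' p.1 p.2
    rwa [dif_pos p.2] at this

variable {ι : Type*} [Fintype ι] [DecidableEq ι] {f g : ι → ℝ → ℝ} {φ ψ : ι → ℝ → ℂ}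

lemma sieve_sum (H : Fam f g φ ψ) (Sp : Supp f g) {L : ℝ} (hL : 0 < L) {W v0 : ℕ} {h : ι → ℕ}
    (R : Finset ℕ) (u : ℕ → ℝ) (hu : ∀ i, u 0 ≠ 0 → h i ≠ 0)
    (hd : ∀ p : ℕ, p.Prime → ¬ p ∣ W → ∀ m i j, p ∣ m + h i → p ∣ m + h j → i = j)
    (a : ℕ → ℝ) (Y : ℝ) (err : ℕ → ℝ)
    (hE : ∀ q ∈ QQ W ⌊Real.exp (2 * L)⌋₊, ∀ r : ℕ,
      (∀ m, m ≡ r [MOD W*q] → m ≡ v0 [MOD W] ∧ ∀ p ∈ q.primeFactors, ∃ i, p ∣ m + h i) →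
      |∑ m ∈ R with m ≡ r [MOD W * q], u m - Y * ∏ p ∈ q.primeFactors, a p| ≤ err q) :
    ‖((∑ m ∈ R with m ≡ v0 [MOD W], u m * ∏ i, (vv L W (f i) (m + h i) * vv L W (g i) (m + h i)) : ℝ) : ℂ)
      - Y * mainSum L W a φ ψ‖
      ≤ ∑ q ∈ QQ W ⌊Real.exp (2 * L)⌋₊, wB (3 * Fintype.card ι) q * err q := by
  have h1 : ((∑ m ∈ R with m ≡ v0 [MOD W],
        u m * ∏ i, (vv L W (f i) (m + h i) * vv L W (g i) (m + h i)) : ℝ) : ℂ)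
      = ∑ q ∈ QQ W ⌊Real.exp (2 * L)⌋₊, ∑ ρ : q.primeFactors → ι,
        ((∑ m ∈ R with (m ≡ v0 [MOD W] ∧ ∀ p : q.primeFactors, (p:ℕ) ∣ m + h (ρ p)), u m : ℝ) : ℂ)
          * GR L φ ψ q.primeFactors ρ := by
    rw [Complex.ofReal_sum]
    have h2 : ∀ m ∈ R.filter (· ≡ v0 [MOD W]),
        ((u m * ∏ i, (vv L W (f i) (m + h i) * vv L W (g i) (m + h i)) : ℝ) : ℂ)
        = ∑ q ∈ QQ W ⌊Real.exp (2 * L)⌋₊, ∑ ρ : q.primeFactors → ι,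
          if (∀ p : q.primeFactors, (p:ℕ) ∣ m + h (ρ p)) then
            (u m : ℂ) * GR L φ ψ q.primeFactors ρ else 0 := fun m _ => by
      by_cases hum : u m = 0
      · simp [hum]
      · rw [Complex.ofReal_mul, vident H Sp hL (fun i => m + h i) (fun i hi => ?_)
          (fun p hp hpW => hd p hp hpW m), Finset.mul_sum]
        · refine Finset.sum_congr rfl fun q _ => ?_
          rw [Finset.mul_sum]
          refine Finset.sum_congr rfl fun ρ _ => ?_
          split_ifs <;> simp
        · have h3 : m = 0 := by omega
          subst h3
          exact hu i hum (by omega)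
    rw [Finset.sum_congr rfl h2, Finset.sum_comm]
    refine Finset.sum_congr rfl fun q _ => ?_
    rw [Finset.sum_comm]
    refine Finset.sum_congr rfl fun ρ _ => ?_
    rw [← Finset.sum_filter, Finset.filter_filter, ← Finset.sum_mul, Complex.ofReal_sum]
  rw [h1, mainSum, Finset.mul_sum, ← Finset.sum_sub_distrib]
  refine (norm_sum_le _ _).trans (Finset.sum_le_sum fun q hq => ?_)
  rw [Finset.mul_sum, Finset.mul_sum, ← Finset.sum_sub_distrib]
  have hw : wB (3 * Fintype.card ι) q * err q
      = (Finset.univ : Finset (q.primeFactors → ι)).card • (err q * 3 ^ q.primeFactors.card) := by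
    rw [Finset.card_univ, Fintype.card_fun, nsmul_eq_mul, wB, ph, Finset.prod_const,
      Fintype.card_coe]
    push_cast
    rw [mul_pow]; ring
  rw [hw]
  refine (norm_sum_le _ _).trans (Finset.sum_le_card_nsmul _ _ _ fun ρ _ => ?_)
  obtain ⟨r, hr⟩ := crt_q (v0 := v0) hq h ρ
  have h4 := hE q hq r fun m hm => by
    have := (hr m).2 hm
    exact ⟨this.1, fun p hp => ⟨_, this.2 ⟨p, hp⟩⟩⟩
  rw [Finset.filter_congr fun m _ => hr m]
  rw [← mul_assoc, ← sub_mul, norm_mul]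
  refine mul_le_mul ?_ (GR_bound H Sp hL (fun p hp => (Nat.prime_of_mem_primeFactors hp).ne_zero) ρ)
    (norm_nonneg _) ((abs_nonneg _).trans h4)
  rw [← Complex.ofReal_prod, ← Complex.ofReal_mul, ← Complex.ofReal_sub, Complex.norm_real]
  exact h4

end

section

open Filter Topology

/-- weight for the unrestricted sum -/
noncomputable def u1 (LL : ℝ) (m : ℕ) : ℝ := if Real.exp LL ≤ m then (m:ℝ)⁻¹ else 0

lemma u1_nonneg (LL : ℝ) (m : ℕ) : 0 ≤ u1 LL m := by unfold u1; split_ifs <;> positivity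

lemma u1_le (LL : ℝ) (m : ℕ) : u1 LL m ≤ Real.exp (-LL) := by
  unfold u1; split_ifs with h
  · rw [Real.exp_neg]; exact inv_anti₀ (Real.exp_pos _) h
  · positivity

noncomputable def UF (LL : ℝ) : ℝ := ∑ m ∈ rg LL, u1 LL m

lemma UF_nonneg (LL : ℝ) : 0 ≤ UF LL := Finset.sum_nonneg fun m _ => u1_nonneg LL m

lemma UF_le {LL : ℝ} (h : 1 ≤ LL) : UF LL ≤ 3 * LL := by
  have h1 : UF LL ≤ (harmonic ⌊Real.exp (2*LL)⌋₊ : ℝ) := by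
    unfold UF rg
    rw [Finset.sum_range_succ']
    have h0 : u1 LL 0 = 0 := by
      unfold u1; rw [if_neg]; simpa using Real.exp_pos LL
    rw [h0, add_zero, harmonic]
    push_cast
    refine Finset.sum_le_sum fun i _ => ?_
    unfold u1
    split_ifs
    · push_cast; exact le_rfl
    · positivity
  have h2 := harmonic_le_one_add_log ⌊Real.exp (2*LL)⌋₊
  have h3 : Real.log ⌊Real.exp (2*LL)⌋₊ ≤ 2*LL := by
    rw [Real.log_le_iff_le_exp]
    · exact Nat.floor_le (Real.exp_pos _).le
    · have : 1 ≤ ⌊Real.exp (2*LL)⌋₊ := Nat.one_le_floor_iff _ |>.2 (Real.one_le_exp (by linarith))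
      exact_mod_cast this
  linarith

lemma u1_var (LL : ℝ) (n : ℕ) :
    ((n:ℝ) < Real.exp LL → ∑ k ∈ Finset.range n, |u1 LL k - u1 LL (k+1)| = 0) ∧
    (Real.exp LL ≤ n → ∑ k ∈ Finset.range n, |u1 LL k - u1 LL (k+1)| + u1 LL n ≤ 2 * Real.exp (-LL)) := by
  induction n with
  | zero =>
    refine ⟨fun _ => by simp, fun h => ?_⟩
    have := Real.exp_pos LL
    simp at h; linarith
  | succ n ih =>
    have hz : ∀ m : ℕ, (m:ℝ) < Real.exp LL → u1 LL m = 0 := fun m hm => by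
      unfold u1; rw [if_neg (not_le.2 hm)]
    have hlt : (n:ℝ) < ((n+1:ℕ):ℝ) := by push_cast; linarith
    rw [Finset.sum_range_succ]
    constructor
    · intro h
      rw [ih.1 (hlt.trans h), hz n (hlt.trans h), hz _ h]; simp
    · intro h
      by_cases hn : Real.exp LL ≤ n
      · have h1 := ih.2 hn
        have h2 : u1 LL (n+1) ≤ u1 LL n := by
          unfold u1; rw [if_pos hn, if_pos h]
          exact inv_anti₀ ((Real.exp_pos _).trans_le hn) hlt.le
        rw [abs_of_nonneg (by linarith)]; linarith
      · push Not at hn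
        rw [ih.1 hn, hz n hn, zero_sub, abs_neg, abs_of_nonneg (u1_nonneg _ _)]
        have := u1_le LL (n+1)
        linarith

lemma count_bd {M : ℕ} (hM : 0 < M) (r n : ℕ) :
    ‖∑ k ∈ Finset.range n, (((if k ≡ r [MOD M] then 1 else 0) : ℂ) - (M:ℂ)⁻¹)‖ ≤ 1 := by
  have h1 : ∑ k ∈ Finset.range n, (((if k ≡ r [MOD M] then 1 else 0) : ℂ) - (M:ℂ)⁻¹)
      = (((Nat.count (· ≡ r [MOD M]) n : ℝ) - n / M : ℝ) : ℂ) := by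
    rw [Finset.sum_sub_distrib, Nat.count_eq_card_filter_range, Finset.sum_boole]
    simp [div_eq_mul_inv]
  rw [h1, Complex.norm_real, Real.norm_eq_abs, Nat.count_modEq_card n hM]
  have hMr : (0:ℝ) < M := by exact_mod_cast hM
  have h2 : (n:ℝ) / M = (n / M : ℕ) + ((n % M : ℕ):ℝ) / M := by
    rw [div_eq_iff hMr.ne', add_mul, div_mul_cancel₀ _ hMr.ne']
    have := Nat.div_add_mod n M
    have h3 : ((M * (n/M) + n % M : ℕ):ℝ) = n := by rw [this]
    push_cast at h3 ⊢
    linarith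
  have h3 : ((n % M : ℕ):ℝ) / M ≤ 1 := by
    rw [div_le_one hMr]; exact_mod_cast (Nat.mod_lt n hM).le
  have h4 : 0 ≤ ((n % M : ℕ):ℝ) / M := by positivity
  rw [h2, abs_le]
  push_cast
  split_ifs <;> constructor <;> linarith

lemma u1_ap (LL : ℝ) {M : ℕ} (hM : 0 < M) (r : ℕ) :
    |∑ m ∈ rg LL with m ≡ r [MOD M], u1 LL m - UF LL / M| ≤ 3 * Real.exp (-LL) := by
  have h1 := abel_bound (fun k => ((if k ≡ r [MOD M] then 1 else 0) : ℂ) - (M:ℂ)⁻¹) (u1 LL) 1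
    (count_bd hM r) (⌊Real.exp (2*LL)⌋₊ + 1)
  have h2 : ∑ k ∈ Finset.range (⌊Real.exp (2*LL)⌋₊ + 1),
      (((if k ≡ r [MOD M] then 1 else 0) : ℂ) - (M:ℂ)⁻¹) * (u1 LL k : ℂ)
      = ((∑ m ∈ rg LL with m ≡ r [MOD M], u1 LL m - UF LL / M : ℝ) : ℂ) := by
    rw [Finset.sum_filter, UF, Finset.sum_div, ← Finset.sum_sub_distrib]
    push_cast
    refine Finset.sum_congr rfl fun k _ => ?_
    split_ifs <;> push_cast <;> ring
  rw [h2, Complex.norm_real, Real.norm_eq_abs, one_mul] at h1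
  refine h1.trans ?_
  set N := ⌊Real.exp (2*LL)⌋₊ + 1
  obtain ⟨ha, hb⟩ := u1_var LL N
  have h3 := u1_le LL N
  have h4 := u1_nonneg LL N
  rw [abs_of_nonneg h4]
  rcases lt_or_ge (N:ℝ) (Real.exp LL) with h | h
  · rw [ha h]; have := Real.exp_pos (-LL); linarith
  · have := hb h; have := Real.exp_pos (-LL); linarith

lemma QQ_le {W q : ℕ} {y : ℝ} (hy : 0 ≤ y) (hq : q ∈ QQ W ⌊y⌋₊) : (q:ℝ) ≤ y ∧ 0 < q := by
  simp only [QQ, Finset.mem_filter, Finset.mem_Icc] at hq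
  exact ⟨(Nat.le_floor_iff hy).1 hq.1.2, hq.1.1⟩

lemma sum_wB_le {B W : ℕ} (hB : WBig B W) {y : ℝ} (hy : 0 ≤ y) :
    ∑ q ∈ QQ W ⌊y⌋₊, wB B q ≤ y * y := by
  have h1 : ∀ q ∈ QQ W ⌊y⌋₊, wB B q ≤ y := fun q hq => by
    refine le_trans ?_ (QQ_le hy hq).1
    simp only [QQ, Finset.mem_filter] at hq
    exact hB.wB_le hq.2.2 hq.2.1
  refine (Finset.sum_le_card_nsmul _ _ _ h1).trans ?_
  rw [nsmul_eq_mul]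
  refine mul_le_mul_of_nonneg_right ?_ hy
  refine le_trans ?_ (Nat.floor_le hy)
  have : (QQ W ⌊y⌋₊).card ≤ ⌊y⌋₊ := (Finset.card_filter_le _ _).trans (by simp)
  exact_mod_cast this

variable {ι : Type*} [Fintype ι] [DecidableEq ι] {f g : ι → ℝ → ℝ} {φ ψ : ι → ℝ → ℂ}

lemma S1_bound (H : Fam f g φ ψ) (Sp : Supp f g) {LL : ℝ} (hLL : 0 < LL) {W v0 : ℕ} {h : ι → ℕ}
    (hW : W ≠ 0) (hB : WBig (3 * Fintype.card ι) W)
    (hd : ∀ p : ℕ, p.Prime → ¬ p ∣ W → ∀ m i j, p ∣ m + h i → p ∣ m + h j → i = j) :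
    ‖((∑ m ∈ rg LL with m ≡ v0 [MOD W], u1 LL m *
      ∏ i, (vv (LL/200) W (f i) (m + h i) * vv (LL/200) W (g i) (m + h i)) : ℝ) : ℂ)
      - (UF LL / W : ℝ) * mainSum (LL/200) W (fun p => (p:ℝ)⁻¹) φ ψ‖ ≤ 3 * Real.exp (-LL/2) := by
  have hy := (Real.exp_pos (2*(LL/200))).le
  refine (sieve_sum H Sp (by positivity) (rg LL) (u1 LL) (fun i h0 => absurd ?_ h0) hd
    (fun p => (p:ℝ)⁻¹) (UF LL / W) (fun _ => 3 * Real.exp (-LL)) fun q hq r _ => ?_).trans ?_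
  · unfold u1; rw [if_neg]; simpa using Real.exp_pos LL
  · have h1 := u1_ap LL (M := W * q) (Nat.mul_pos (Nat.pos_of_ne_zero hW) (QQ_le hy hq).2) r
    have h2 : UF LL / (W * q : ℕ) = UF LL / W * ∏ p ∈ q.primeFactors, (p:ℝ)⁻¹ := by
      have hs : Squarefree q := by simp only [QQ, Finset.mem_filter] at hq; exact hq.2.1
      rw [Finset.prod_inv_distrib, Nat.cast_mul, ← div_div, div_eq_mul_inv (UF LL / W)]
      congr 2
      exact cast_sqfree hs
    rwa [h2] at h1
  · rw [← Finset.sum_mul]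
    have h1 := sum_wB_le hB hy
    rw [← Real.exp_add] at h1
    refine (mul_le_mul_of_nonneg_right h1 (by positivity)).trans ?_
    rw [mul_left_comm, ← Real.exp_add]
    gcongr
    linarith

lemma gF_shift {F : ℝ → ℝ} (hF : Cut F) {LL : ℝ} (hLL : 0 < LL) {M : ℕ} (r h0 : ℕ)
    (hh : (h0:ℝ) < Real.exp LL) :
    ∑ m ∈ rg LL with m ≡ r [MOD M], gF F LL (m + h0)
      = ∑ n ∈ rg LL with n ≡ r + h0 [MOD M], gF F LL n := by
  refine Finset.sum_bij_ne_zero (fun m _ _ => m + h0) ?_ ?_ ?_ ?_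
  · intro m hm hne
    have h1 : F (Real.log (m+h0 : ℕ) / LL) ≠ 0 := fun h => hne (by simp only [gF, h]; simp)
    have h2 := (hF.supp hLL h1).2
    simp only [Finset.mem_filter, rg, Finset.mem_range] at hm ⊢
    refine ⟨Nat.lt_succ_of_le (Nat.le_floor (h2.trans (Real.exp_le_exp.2 (by linarith)))), 
      hm.2.add_right h0⟩
  · intro a _ _ b _ _ hab
    exact Nat.add_right_cancel hab
  · intro n hn hne
    have h1 : F (Real.log n / LL) ≠ 0 := fun h => hne (by simp [gF, h])
    have h2 := (hF.supp hLL h1).1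
    have h3 : (h0:ℝ) ≤ n := hh.le.trans ((Real.exp_le_exp.2 (by linarith)).trans h2)
    have h4 : h0 ≤ n := by exact_mod_cast h3
    obtain ⟨m, rfl⟩ := Nat.exists_eq_add_of_le' h4
    simp only [Finset.mem_filter, rg, Finset.mem_range] at hn
    refine ⟨m, ?_, hne, rfl⟩
    simp only [Finset.mem_filter, rg, Finset.mem_range]
    exact ⟨by omega, Nat.ModEq.add_right_cancel' h0 hn.2⟩
  · intro m _ _; rfl

lemma S2_bound (H : Fam f g φ ψ) (Sp : Supp f g) {F : ℝ → ℝ} (hF : Cut F) {LL : ℝ} (hLL : 0 < LL)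
    {W v0 h0 : ℕ} {h : ι → ℕ}
    (hW : W ≠ 0) (hWL : (W:ℝ) ≤ Real.exp (LL/2)) (hh : (h0:ℝ) < Real.exp LL)
    (hd : ∀ p : ℕ, p.Prime → ¬ p ∣ W → ∀ m i j, p ∣ m + h i → p ∣ m + h j → i = j)
    (hd0 : ∀ p : ℕ, p.Prime → ¬ p ∣ W → ∀ m i, p ∣ m + h i → ¬ p ∣ m + h0)
    (hv : (v0 + h0).Coprime W) :
    ‖((∑ m ∈ rg LL with m ≡ v0 [MOD W], gF F LL (m + h0) *
      ∏ i, (vv (LL/200) W (f i) (m + h i) * vv (LL/200) W (g i) (m + h i)) : ℝ) : ℂ)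
      - (XF F LL / W.totient : ℝ) * mainSum (LL/200) W (fun p => ((p:ℝ)-1)⁻¹) φ ψ‖
      ≤ ∑ q ∈ QQ W ⌊Real.exp (LL/100)⌋₊, wB (3 * Fintype.card ι) q * ErrF F LL (W * q) := by
  have hy := (Real.exp_pos (2*(LL/200))).le
  have he : LL/100 = 2*(LL/200) := by ring
  rw [he]
  refine sieve_sum H Sp (by positivity) (rg LL) (fun m => gF F LL (m + h0))
    (fun i hne => absurd ?_ hne) hd
    (fun p => ((p:ℝ)-1)⁻¹) (XF F LL / W.totient) (fun q => ErrF F LL (W * q)) fun q hq r hr => ?_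
  · by_contra hne
    have h1 : F (Real.log (0+h0 : ℕ) / LL) ≠ 0 := fun h => hne (by simp only [gF, h]; simp)
    have h2 := (hF.supp hLL h1).1
    have h3 : Real.exp LL ≤ Real.exp (5*LL/4) := Real.exp_le_exp.2 (by linarith)
    rw [zero_add] at h2
    linarith
  · rw [gF_shift hF hLL r h0 hh]
    have hq1 := QQ_le hy hq
    have hq' := hq
    simp only [QQ, Finset.mem_filter] at hq'
    have h2 : XF F LL / (W * q : ℕ).totient
        = XF F LL / W.totient * ∏ p ∈ q.primeFactors, ((p:ℝ)-1)⁻¹ := by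
      rw [Finset.prod_inv_distrib, Nat.totient_mul hq'.2.2.symm, Nat.cast_mul, ← div_div,
        div_eq_mul_inv (XF F LL / _)]
      congr 2
      exact totient_sqfree hq'.2.1
    rw [← h2]
    refine ap_error hF hLL (Nat.mul_ne_zero hW hq1.2.ne') ?_ ?_
    · push_cast
      calc (W:ℝ) * q ≤ Real.exp (LL/2) * Real.exp (2*(LL/200)) := by gcongr; exact hq1.1
        _ ≤ Real.exp LL := by rw [← Real.exp_add]; exact Real.exp_le_exp.2 (by linarith)
    · obtain ⟨hr1, hr2⟩ := hr r rfl
      refine Nat.Coprime.mul_right ?_ ?_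
      · have := (hr1.add_right h0).gcd_eq
        rw [Nat.Coprime, this]; exact hv
      · refine Nat.Coprime.symm (Nat.coprime_of_dvd fun p hp hpq hpr => ?_)
        have hpm : p ∈ q.primeFactors := Nat.mem_primeFactors.2 ⟨hp, hpq, hq1.2.ne'⟩
        obtain ⟨i, hi⟩ := hr2 p hpm
        exact hd0 p hp (QQ_prime hq hpm).2 r i hi hpr

end

section

open Filter Topology MeasureTheory

lemma vv_prime {L : ℝ} (hL : 0 < L) {W n : ℕ} (hn : n.Prime) (hW : ¬ n ∣ W) {f : ℝ → ℝ}
    (h0 : f 0 = 1) (h1 : f (Real.log n / L) = 0) : vv L W f n = 1 := by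
  have h2 : PS W n = {n} := by
    unfold PS
    rw [hn.primeFactors, Finset.filter_singleton, if_pos hW]
  unfold vv
  rw [h2, ← insert_empty_eq, Finset.sum_powerset_insert (Finset.notMem_empty n)]
  simp [h0, h1]

/-- A finite family of smooth weights. -/
structure Setup {k : ℕ} {ν : Type*} (G : ν → ℝ → ℝ) (Φ : ν → ℝ → ℂ) (c : ν → ℝ)
    (J : Finset (Fin k → ν)) : Prop where
  rep : ∀ a, LapRep (G a) (Φ a)
  diff : ∀ a, Differentiable ℝ (G a)
  bd : ∀ a t, |G a t| ≤ 1
  one : ∀ a, G a 0 = 1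
  supp : ∀ a t, G a t ≠ 0 → t ≤ c a
  cpos : ∀ a, 0 ≤ c a
  sum : ∀ j ∈ J, ∑ i, c (j i) ≤ 1

noncomputable def DD {ν : Type*} (G : ν → ℝ → ℝ) (a b : ν) : ℝ :=
  ∫ t in Set.Ioi (0:ℝ), deriv (G a) t * deriv (G b) t

noncomputable def wS {k : ℕ} {ν : Type*} (L : ℝ) (W : ℕ) (G : ν → ℝ → ℝ) (J : Finset (Fin k → ν))
    (h : Fin k → ℕ) (m : ℕ) : ℝ := (∑ j ∈ J, ∏ i, vv L W (G (j i)) (m + h i))^2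

/-- conditions on the shifts, the modulus and the residue class -/
structure WOk {k : ℕ} (h : Fin k → ℕ) (W v0 : ℕ) : Prop where
  inj : Function.Injective h
  ne : W ≠ 0
  big : WBig (3 * k) W
  hlt : ∀ p : ℕ, p.Prime → ¬ p ∣ W → ∀ i, h i < p
  cop : ∀ i, (v0 + h i).Coprime W

lemma WOk.hd {k : ℕ} {h : Fin k → ℕ} {W v0 : ℕ} (H : WOk h W v0) (p : ℕ) (hp : p.Prime)
    (hpW : ¬ p ∣ W) (m : ℕ) (i j : Fin k) (h1 : p ∣ m + h i) (h2 : p ∣ m + h j) : i = j := by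
  refine H.inj ?_
  have h3 : h i ≡ h j [MOD p] := Nat.ModEq.add_left_cancel' m
    ((Nat.modEq_zero_iff_dvd.2 h1).trans (Nat.modEq_zero_iff_dvd.2 h2).symm)
  exact h3.eq_of_lt_of_lt (H.hlt p hp hpW i) (H.hlt p hp hpW j)

section
variable {k : ℕ} {ν : Type*} {G : ν → ℝ → ℝ} {Φ : ν → ℝ → ℂ} {c : ν → ℝ} {J : Finset (Fin k → ν)}

lemma Setup.fam {ι : Type*} [Fintype ι] (S : Setup G Φ c J) (j j' : Fin k → ν) (e : ι → Fin k) :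
    Fam (fun i => G (j (e i))) (fun i => G (j' (e i))) (fun i => Φ (j (e i))) (fun i => Φ (j' (e i))) :=
  ⟨fun _ => S.rep _, fun _ => S.rep _⟩

lemma sum_inj_le {ι : Type*} [Fintype ι] {e : ι → Fin k} (he : Function.Injective e) {F : Fin k → ℝ}
    (hF : ∀ i, 0 ≤ F i) : ∑ i, F (e i) ≤ ∑ i, F i := by
  classical
  rw [← Finset.sum_image (s := Finset.univ) (g := e) (f := F) (fun a _ b _ h => he h)]
  exact Finset.sum_le_sum_of_subset_of_nonneg (Finset.subset_univ _) fun i _ _ => hF i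

lemma Setup.su {ι : Type*} [Fintype ι] (S : Setup G Φ c J) {j j' : Fin k → ν} (hj : j ∈ J)
    (hj' : j' ∈ J) {e : ι → Fin k} (he : Function.Injective e) :
    Supp (fun i => G (j (e i))) (fun i => G (j' (e i))) := by
  refine ⟨fun i t => S.bd _ _, fun i t => S.bd _ _, fun i => c (j (e i)), fun i => c (j' (e i)),
    fun i t => S.supp _ t, fun i t => S.supp _ t, ?_⟩
  rw [Finset.sum_add_distrib]
  have h1 := sum_inj_le he (F := fun i => c (j i)) fun i => S.cpos _
  have h2 := sum_inj_le he (F := fun i => c (j' i)) fun i => S.cpos _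
  have h3 := S.sum j hj
  have h4 := S.sum j' hj'
  linarith

noncomputable def MS {ι : Type*} [Fintype ι] [DecidableEq ι] (Φ : ν → ℝ → ℂ) (J : Finset (Fin k → ν))
    (e : ι → Fin k) (W : ℕ) (a : ℕ → ℝ) (L : ℝ) : ℂ :=
  ∑ j ∈ J, ∑ j' ∈ J, mainSum L W a (fun i => Φ (j (e i))) (fun i => Φ (j' (e i)))

noncomputable def DS {ι : Type*} [Fintype ι] (G : ν → ℝ → ℝ) (J : Finset (Fin k → ν))
    (e : ι → Fin k) : ℝ := ∑ j ∈ J, ∑ j' ∈ J, ∏ i, DD G (j (e i)) (j' (e i))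

lemma MS_tendsto {ι : Type*} [Fintype ι] [DecidableEq ι] (S : Setup G Φ c J) 
    {e : ι → Fin k} (he : Function.Injective e) {W : ℕ} (hW : W ≠ 0) {a : ℕ → ℝ} (ha : AOk W a) :
    Tendsto (fun L : ℝ => (L:ℂ)^(Fintype.card ι) * MS Φ J e W a L) atTop
      (𝓝 (SSer ι W a * (DS G J e : ℂ))) := by
  have h1 : SSer ι W a * (DS G J e : ℂ) = ∑ j ∈ J, ∑ j' ∈ J, SSer ι W a *
      ∏ i, ((∫ t in Set.Ioi (0:ℝ), deriv (G (j (e i))) t * deriv (G (j' (e i))) t : ℝ):ℂ) := by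
    unfold DS DD
    push_cast
    rw [Finset.mul_sum]
    refine Finset.sum_congr rfl fun j _ => ?_
    rw [Finset.mul_sum]
  rw [h1]
  have h2 : ∀ L : ℝ, (L:ℂ)^(Fintype.card ι) * MS Φ J e W a L = ∑ j ∈ J, ∑ j' ∈ J,
      (L:ℂ)^(Fintype.card ι) * mainSum L W a (fun i => Φ (j (e i))) (fun i => Φ (j' (e i))) := 
    fun L => by
    unfold MS
    rw [Finset.mul_sum]
    refine Finset.sum_congr rfl fun j _ => ?_
    rw [Finset.mul_sum]
  simp_rw [h2]
  refine tendsto_finsetSum _ fun j hj => tendsto_finsetSum _ fun j' hj' => ?_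
  exact mainSum_tendsto (S.fam j j' e) (S.su hj hj' he) (fun i => S.diff _) (fun i => S.diff _) hW ha

lemma wS_eq (L : ℝ) (W : ℕ) (h : Fin k → ℕ) (m : ℕ) :
    wS L W G J h m = ∑ j ∈ J, ∑ j' ∈ J, ∏ i,
      (vv L W (G (j i)) (m + h i) * vv L W (G (j' i)) (m + h i)) := by
  unfold wS
  rw [sq, Finset.sum_mul_sum]
  refine Finset.sum_congr rfl fun j _ => Finset.sum_congr rfl fun j' _ => ?_
  rw [Finset.prod_mul_distrib]

lemma wS_nonneg (L : ℝ) (W : ℕ) (h : Fin k → ℕ) (m : ℕ) : 0 ≤ wS L W G J h m := sq_nonneg _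

lemma S1_tot (S : Setup G Φ c J) {h : Fin k → ℕ} {W v0 : ℕ} (H : WOk h W v0) {LL : ℝ}
    (hLL : 0 < LL) :
    ‖((∑ m ∈ rg LL with m ≡ v0 [MOD W], u1 LL m * wS (LL/200) W G J h m : ℝ) : ℂ)
      - (UF LL / W : ℝ) * MS Φ J (id : Fin k → Fin k) W (fun p => (p:ℝ)⁻¹) (LL/200)‖
      ≤ (J.card:ℝ)^2 * (3 * Real.exp (-LL/2)) := by
  have h1 : ∑ m ∈ rg LL with m ≡ v0 [MOD W], u1 LL m * wS (LL/200) W G J h m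
      = ∑ j ∈ J, ∑ j' ∈ J, ∑ m ∈ rg LL with m ≡ v0 [MOD W], u1 LL m * ∏ i,
      (vv (LL/200) W (G (j i)) (m + h i) * vv (LL/200) W (G (j' i)) (m + h i)) := by
    simp_rw [wS_eq, Finset.mul_sum]
    rw [Finset.sum_comm]
    refine Finset.sum_congr rfl fun j _ => ?_
    rw [Finset.sum_comm]
  rw [h1, MS, Complex.ofReal_sum, Finset.mul_sum, ← Finset.sum_sub_distrib]
  have h2 : (J.card:ℝ)^2 * (3 * Real.exp (-LL/2)) = J.card • (J.card • (3 * Real.exp (-LL/2))) := by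
    simp only [nsmul_eq_mul]; ring
  rw [h2]
  refine (norm_sum_le _ _).trans (Finset.sum_le_card_nsmul _ _ _ fun j hj => ?_)
  rw [Complex.ofReal_sum, Finset.mul_sum, ← Finset.sum_sub_distrib]
  refine (norm_sum_le _ _).trans (Finset.sum_le_card_nsmul _ _ _ fun j' hj' => ?_)
  exact S1_bound (S.fam j j' id) (S.su hj hj' Function.injective_id) hLL H.ne
    (by rw [Fintype.card_fin]; exact H.big) H.hd

lemma WOk.gF_prime {h : Fin k → ℕ} {W v0 : ℕ} (H : WOk h W v0) {F : ℝ → ℝ} (hF : Cut F) {LL : ℝ} (hLL : 0 < LL)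
    (hWL : (W:ℝ) ≤ Real.exp (LL/2)) {n : ℕ} (hne : gF F LL n ≠ 0) :
    n.Prime ∧ ¬ n ∣ W ∧ Real.exp (5*LL/4) ≤ n ∧ (n:ℝ) ≤ Real.exp (7*LL/4) := by
  have hp : n.Prime := by
    by_contra hp; exact hne (by simp [gF, thF, hp])
  have h1 : F (Real.log n / LL) ≠ 0 := fun h => hne (by simp only [gF, h]; simp)
  have h2 := hF.supp hLL h1
  refine ⟨hp, fun hd => ?_, h2⟩
  have h3 : (n:ℝ) ≤ W := by exact_mod_cast Nat.le_of_dvd (Nat.pos_of_ne_zero H.ne) hd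
  have h4 : Real.exp (LL/2) < Real.exp (5*LL/4) := Real.exp_lt_exp.2 (by linarith)
  linarith [h2.1]

lemma S2_tot (S : Setup G Φ c J) {h : Fin k → ℕ} {W v0 : ℕ} (H : WOk h W v0) 
    {F : ℝ → ℝ} (hF : Cut F) {LL : ℝ} (hLL : 0 < LL)
    (hWL : (W:ℝ) ≤ Real.exp (LL/2)) (hh : ∀ i, (h i:ℝ) < Real.exp LL) (i0 : Fin k) :
    ‖((∑ m ∈ rg LL with m ≡ v0 [MOD W], gF F LL (m + h i0) * wS (LL/200) W G J h m : ℝ) : ℂ)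
      - (XF F LL / W.totient : ℝ) * MS Φ J (Subtype.val : {i : Fin k // i ≠ i0} → Fin k) W
        (fun p => ((p:ℝ)-1)⁻¹) (LL/200)‖
      ≤ (J.card:ℝ)^2 * ∑ q ∈ QQ W ⌊Real.exp (LL/100)⌋₊, wB (3 * (k-1)) q * ErrF F LL (W * q) := by
  have h1 : ∑ m ∈ rg LL with m ≡ v0 [MOD W], gF F LL (m + h i0) * wS (LL/200) W G J h m
      = ∑ j ∈ J, ∑ j' ∈ J, ∑ m ∈ rg LL with m ≡ v0 [MOD W], gF F LL (m + h i0) *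
        ∏ i : {i : Fin k // i ≠ i0},
      (vv (LL/200) W (G (j i)) (m + h i) * vv (LL/200) W (G (j' i)) (m + h i)) := by
    have h2 : ∀ m, gF F LL (m + h i0) * wS (LL/200) W G J h m = ∑ j ∈ J, ∑ j' ∈ J,
        gF F LL (m + h i0) * ∏ i : {i : Fin k // i ≠ i0},
      (vv (LL/200) W (G (j i)) (m + h i) * vv (LL/200) W (G (j' i)) (m + h i)) := fun m => by
      by_cases hne : gF F LL (m + h i0) = 0
      · simp [hne]
      rw [wS_eq, Finset.mul_sum]
      refine Finset.sum_congr rfl fun j hj => ?_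
      rw [Finset.mul_sum]
      refine Finset.sum_congr rfl fun j' hj' => ?_
      congr 1
      obtain ⟨hp, hpW, hlo, -⟩ := H.gF_prime hF hLL hWL hne
      have key : ∀ a ∈ J, vv (LL/200) W (G (a i0)) (m + h i0) = 1 := fun a ha => by
        refine vv_prime (by positivity) hp hpW (S.one _) ?_
        by_contra h3
        have h4 := S.supp _ _ h3
        have h5 : c (a i0) ≤ 1 := (Finset.single_le_sum (f := fun i => c (a i))
          (fun i _ => S.cpos _) (Finset.mem_univ i0)).trans (S.sum a ha)
        have h6 : 5*LL/4 ≤ Real.log (m + h i0 : ℕ) := by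
          rw [Real.le_log_iff_exp_le]
          · exact hlo
          · exact_mod_cast hp.pos
        have h7 := h4.trans h5
        rw [div_le_one (by positivity)] at h7
        linarith
      rw [Fintype.prod_eq_mul_prod_subtype_ne _ i0, key j hj, key j' hj', one_mul, one_mul]
    simp_rw [h2]
    rw [Finset.sum_comm]
    refine Finset.sum_congr rfl fun j _ => ?_
    rw [Finset.sum_comm]
  rw [h1, MS, Complex.ofReal_sum, Finset.mul_sum, ← Finset.sum_sub_distrib]
  set EEE := ∑ q ∈ QQ W ⌊Real.exp (LL/100)⌋₊, wB (3 * (k-1)) q * ErrF F LL (W * q) with hEEE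
  have h2 : (J.card:ℝ)^2 * EEE = J.card • (J.card • EEE) := by
    simp only [nsmul_eq_mul]; ring
  rw [h2]
  refine (norm_sum_le _ _).trans (Finset.sum_le_card_nsmul _ _ _ fun j hj => ?_)
  rw [Complex.ofReal_sum, Finset.mul_sum, ← Finset.sum_sub_distrib]
  refine (norm_sum_le _ _).trans (Finset.sum_le_card_nsmul _ _ _ fun j' hj' => ?_)
  have h3 := S2_bound (ι := {i : Fin k // i ≠ i0}) (v0 := v0) (h := fun i => h i)
    (S.fam j j' Subtype.val) (S.su hj hj' Subtype.val_injective) hF hLL H.ne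
    hWL (hh i0) (fun p hp hpW m i i' h1 h2 => Subtype.ext (H.hd p hp hpW m _ _ h1 h2))
    (fun p hp hpW m i h1 h2 => i.2 (H.hd p hp hpW m _ _ h1 h2)) (H.cop i0)
  have h4 : Fintype.card {i : Fin k // i ≠ i0} = k - 1 := by simp
  rw [h4] at h3
  exact h3

end

end

section

open Filter Topology MeasureTheory

section
variable {k : ℕ} {ν : Type*} {G : ν → ℝ → ℝ} {Φ : ν → ℝ → ℂ} {c : ν → ℝ} {J : Finset (Fin k → ν)}

lemma extract {h : Fin k → ℕ} {W v0 : ℕ} (H : WOk h W v0) {F : ℝ → ℝ} (hF : Cut F) {LL : ℝ}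
    (hLL : 4 ≤ LL) (hWL : (W:ℝ) ≤ Real.exp (LL/2)) (hh : ∀ i, (h i:ℝ) < Real.exp LL)
    (mm : ℕ) {m : ℕ} (hm : 2 * LL * mm * u1 LL m < ∑ i, gF F LL (m + h i)) :
    LL ≤ m ∧ mm < (Finset.univ.filter fun i => (m + h i).Prime).card := by
  have hLL0 : 0 < LL := by linarith
  have hpos : 0 ≤ 2 * LL * mm * u1 LL m := by have := u1_nonneg LL m; positivity
  obtain ⟨i, -, hi⟩ : ∃ i ∈ Finset.univ, gF F LL (m + h i) ≠ 0 := by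
    refine Finset.exists_ne_zero_of_sum_ne_zero (s := Finset.univ) (f := fun i => gF F LL (m + h i)) ?_
    linarith
  have hme : Real.exp LL ≤ m := by
    have h1 := (H.gF_prime hF hLL0 hWL hi).2.2.1
    have h2 := hh i
    have h3 : Real.exp (5*LL/4) = Real.exp LL * Real.exp (LL/4) := by
      rw [← Real.exp_add]; congr 1; ring
    have h4 : 2 ≤ Real.exp (LL/4) := by
      have := Real.add_one_le_exp (LL/4); linarith
    have h5 := Real.exp_pos LL
    push_cast at h1
    nlinarith
  have hm0 : (0:ℝ) < m := (Real.exp_pos _).trans_le hme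
  refine ⟨by have := Real.add_one_le_exp LL; linarith, ?_⟩
  have hb : ∀ i, gF F LL (m + h i) ≤ if (m + h i).Prime then 2 * LL / m else 0 := fun i => by
    by_cases hne : gF F LL (m + h i) = 0
    · rw [hne]; split_ifs <;> positivity
    obtain ⟨hp, -, -, hhi⟩ := H.gF_prime hF hLL0 hWL hne
    rw [if_pos hp]
    have hn0 : (0:ℝ) < (m + h i : ℕ) := by exact_mod_cast hp.pos
    have h1 : Real.log (m + h i : ℕ) ≤ 7*LL/4 := (Real.log_le_iff_le_exp hn0).2 hhi
    have h2 : 0 ≤ Real.log (m + h i : ℕ) := Real.log_natCast_nonneg _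
    have hmn : (m:ℝ) ≤ (m + h i : ℕ) := by push_cast; have : (0:ℝ) ≤ h i := by positivity
                                           linarith
    unfold gF thF
    rw [if_pos hp, mul_div_assoc']
    refine div_le_div₀ (by positivity) ?_ hm0 hmn
    have h3 := hF.nonneg (Real.log (m + h i : ℕ) / LL)
    have h4 := hF.le_one (Real.log (m + h i : ℕ) / LL)
    nlinarith
  have h1 : ∑ i, gF F LL (m + h i)
      ≤ (Finset.univ.filter fun i => (m + h i).Prime).card * (2 * LL / m) := by
    refine (Finset.sum_le_sum fun i _ => hb i).trans ?_
    rw [← Finset.sum_filter, Finset.sum_const, nsmul_eq_mul]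
  have h2 := hm.trans_le h1
  unfold u1 at h2
  rw [if_pos hme] at h2
  have h3 : (mm:ℝ) * (2*LL/m) < (Finset.univ.filter fun i => (m + h i).Prime).card * (2 * LL / m) := by
    refine lt_of_eq_of_lt ?_ h2
    field_simp
  exact_mod_cast lt_of_mul_lt_mul_right h3 (by positivity)

lemma re_tend {a : ℝ → ℂ} {s : ℝ} {K : ℕ}
    (h : Tendsto (fun L : ℝ => (L:ℂ)^K * a L) atTop (𝓝 (s:ℂ))) :
    Tendsto (fun LL : ℝ => (LL/200)^K * (a (LL/200)).re) atTop (𝓝 s) := by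
  have h1 := (Complex.continuous_re.tendsto _).comp h
  have h2 : Tendsto (fun LL : ℝ => LL/200) atTop atTop := tendsto_id.atTop_div_const (by norm_num)
  have h3 := h1.comp h2
  rw [Complex.ofReal_re] at h3
  refine h3.congr fun LL => ?_
  simp only [Function.comp_apply]
  rw [← Complex.ofReal_pow, Complex.re_ofReal_mul]

theorem core (S : Setup G Φ c J) {h : Fin k → ℕ} {W v0 : ℕ} (H : WOk h W v0) (hk : 0 < k)
    (mm : ℕ) (hI : 0 < DS G J (id : Fin k → Fin k))
    (hJ : ∀ i0, 0 < DS G J (Subtype.val : {i : Fin k // i ≠ i0} → Fin k))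
    (hineq : 240000 * mm * DS G J (id : Fin k → Fin k)
      < ∑ i0, DS G J (Subtype.val : {i : Fin k // i ≠ i0} → Fin k)) (N0 : ℕ) :
    ∃ m, N0 ≤ m ∧ mm < (Finset.univ.filter fun i => (m + h i).Prime).card := by
  obtain ⟨F, hF, hFs, hFc⟩ := exists_cut
  obtain ⟨φF, hφF⟩ := exists_rep F hFs hFc
  obtain ⟨K, hlipK⟩ := ContDiff.lipschitzWith_of_hasCompactSupport hFc hFs (by simp)
  have hlip : ∀ s t, |F s - F t| ≤ K * |s - t| := fun s t => by
    have := hlipK.dist_le_mul s t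
    rwa [Real.dist_eq, Real.dist_eq] at this
  have hkW : ∀ p : ℕ, p.Prime → ¬ p ∣ W → Fintype.card (Fin k) < p := fun p hp hpW => by
    have := H.big p hp hpW
    rw [Fintype.card_fin]; nlinarith
  obtain ⟨s, hs, hsS⟩ := SSer_pos (Fin k) H.ne hkW
  have hW0 : (0:ℝ) < W := by exact_mod_cast Nat.pos_of_ne_zero H.ne
  have hφ0 : (0:ℝ) < W.totient := by exact_mod_cast Nat.totient_pos.2 (Nat.pos_of_ne_zero H.ne)
  set r1 : ℝ → ℝ := fun LL =>
    (MS Φ J (id : Fin k → Fin k) W (fun p => (p:ℝ)⁻¹) (LL/200)).re with hr1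
  set r2 : Fin k → ℝ → ℝ := fun i0 LL =>
    (MS Φ J (Subtype.val : {i : Fin k // i ≠ i0} → Fin k) W (fun p => ((p:ℝ)-1)⁻¹) (LL/200)).re with hr2
  have t1 : Tendsto (fun LL => (LL/200)^k * r1 LL) atTop (𝓝 (s * DS G J (id : Fin k → Fin k))) := by
    have := MS_tendsto S (Function.injective_id (α := Fin k)) H.ne (AOk_one W)
    rw [hsS, ← Complex.ofReal_mul, Fintype.card_fin] at this
    exact re_tend this
  have t2 : ∀ i0, Tendsto (fun LL => (LL/200)^(k-1) * r2 i0 LL) atTop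
      (𝓝 (s * (W.totient / W) * DS G J (Subtype.val : {i : Fin k // i ≠ i0} → Fin k))) := fun i0 => by
    have hc : Fintype.card {i : Fin k // i ≠ i0} = k - 1 := by simp
    have := MS_tendsto S (Subtype.val_injective (p := fun i : Fin k => i ≠ i0)) H.ne (AOk_two W)
    rw [SSer_rel (Fin k) _ H.ne (by rw [hc, Fintype.card_fin]; omega), hsS, hc] at this
    refine re_tend ?_
    convert this using 2
    push_cast
    rfl
  set KK0 : ℝ := k * (J.card:ℝ)^2 + 1200 * mm * (J.card:ℝ)^2 with hKK0
  have tQ : Tendsto (fun LL : ℝ => ∑ i0, (W.totient:ℝ)⁻¹ * ((LL/200)^(k-1) * r2 i0 LL)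
      - 240000 * mm * (W:ℝ)⁻¹ * ((LL/200)^k * r1 LL) - KK0 / (LL/200)) atTop
      (𝓝 (∑ i0, (W.totient:ℝ)⁻¹ * (s * (W.totient / W) *
          DS G J (Subtype.val : {i : Fin k // i ≠ i0} → Fin k))
        - 240000 * mm * (W:ℝ)⁻¹ * (s * DS G J (id : Fin k → Fin k)) - 0)) := by
    refine Tendsto.sub (Tendsto.sub (tendsto_finsetSum _ fun i0 _ => (t2 i0).const_mul _)
      (t1.const_mul _)) ?_
    exact tendsto_const_nhds.div_atTop (tendsto_id.atTop_div_const (by norm_num))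
  have hQpos : 0 < ∑ i0, (W.totient:ℝ)⁻¹ * (s * (W.totient / W) *
          DS G J (Subtype.val : {i : Fin k // i ≠ i0} → Fin k))
        - 240000 * mm * (W:ℝ)⁻¹ * (s * DS G J (id : Fin k → Fin k)) - 0 := by
    rw [← Finset.mul_sum, ← Finset.mul_sum]
    have : (W.totient:ℝ)⁻¹ * (s * (W.totient / W) *
          ∑ i0, DS G J (Subtype.val : {i : Fin k // i ≠ i0} → Fin k))
        - 240000 * mm * (W:ℝ)⁻¹ * (s * DS G J (id : Fin k → Fin k)) - 0
        = s / W * (∑ i0, DS G J (Subtype.val : {i : Fin k // i ≠ i0} → Fin k)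
          - 240000 * mm * DS G J (id : Fin k → Fin k)) := by
      field_simp
      ring
    rw [this]
    exact mul_pos (by positivity) (by linarith)
  have eQ := tQ.eventually_const_lt hQpos
  have e1 := t1.eventually_const_lt (mul_pos hs hI)
  have e2 : ∀ᶠ LL in atTop, ∀ i0, 0 < (LL/200)^(k-1) * r2 i0 LL :=
    eventually_all.2 fun i0 => (t2 i0).eventually_const_lt (by have := hJ i0; positivity)
  have eX := XF_ge hF
  have eexp : ∀ᶠ LL : ℝ in atTop, (LL/200)^k * Real.exp (-LL/2) ≤ 1 := by
    have h1 := (Real.tendsto_pow_mul_exp_neg_atTop_nhds_zero k).comp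
      (tendsto_id.atTop_div_const (show (0:ℝ) < 200 by norm_num))
    filter_upwards [h1.eventually_le_const one_pos, eventually_gt_atTop 0] with LL h2 h3
    refine le_trans ?_ h2
    simp only [Function.comp_apply, id]
    gcongr
    linarith
  have eW : ∀ᶠ LL : ℝ in atTop, (W:ℝ) ≤ Real.exp (LL/2) :=
    (Real.tendsto_exp_atTop.comp (tendsto_id.atTop_div_const (by norm_num))).eventually_ge_atTop _
  have eh : ∀ᶠ LL : ℝ in atTop, ∀ i, (h i:ℝ) < Real.exp LL :=
    eventually_all.2 fun i => Real.tendsto_exp_atTop.eventually_gt_atTop _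
  obtain ⟨LL0, hLL0⟩ := eventually_atTop.1 (eQ.and (e1.and (e2.and (eX.and (eexp.and (eW.and
    (eh.and ((eventually_ge_atTop 4).and (eventually_ge_atTop (N0:ℝ))))))))))
  have hB' : WBig (3*(k-1)) W := fun p hp hpW => by
    refine le_trans ?_ (H.big p hp hpW)
    gcongr
    omega
  obtain ⟨LL, hge, hbv⟩ := bv hF hφF K.2 hlip (3*(k-1)) W (k-1) hB' H.ne LL0
  obtain ⟨hQ, h1, h2, hX, hexp, hWL, hh, h4, hN⟩ := hLL0 LL hge
  have hLpos : 0 < LL := by linarith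
  set L := LL/200 with hL
  have hL0 : 0 < L := by positivity
  set S1 : ℝ := ∑ m ∈ rg LL with m ≡ v0 [MOD W], u1 LL m * wS L W G J h m with hS1
  set S2 : Fin k → ℝ := fun i0 =>
    ∑ m ∈ rg LL with m ≡ v0 [MOD W], gF F LL (m + h i0) * wS L W G J h m with hS2
  have b1 : S1 ≤ UF LL / W * r1 LL + (J.card:ℝ)^2 * (3 * Real.exp (-LL/2)) := by
    have := (Complex.abs_re_le_norm _).trans (S1_tot S H hLpos)
    rw [Complex.sub_re, Complex.ofReal_re, Complex.re_ofReal_mul] at this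
    have := (abs_le.1 this).2
    linarith
  set E := ∑ q ∈ QQ W ⌊Real.exp (LL/100)⌋₊, wB (3 * (k-1)) q * ErrF F LL (W * q) with hE
  have b2 : ∀ i0, XF F LL / W.totient * r2 i0 LL - (J.card:ℝ)^2 * E ≤ S2 i0 := fun i0 => by
    have := (Complex.abs_re_le_norm _).trans (S2_tot S H hF hLpos hWL hh i0)
    rw [Complex.sub_re, Complex.ofReal_re, Complex.re_ofReal_mul] at this
    have := (abs_le.1 this).1
    linarith
  have hE1 : L^(k-1) * E ≤ 1 := by
    calc L^(k-1) * E ≤ LL^(k-1) * (1/LL^(k-1)) := by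
          refine mul_le_mul ?_ hbv ?_ (by positivity)
          · gcongr; rw [hL]; linarith
          · exact Finset.sum_nonneg fun q _ => mul_nonneg (wB_nonneg _ _) (ErrF_nonneg hF _ _)
      _ = 1 := by field_simp
  have c1 : L^k * S1 ≤ 600 * L / W * (L^k * r1 LL) + 3 * (J.card:ℝ)^2 := by
    have hU := UF_le (LL := LL) (by linarith)
    have hU' : UF LL ≤ 600 * L := by rw [hL]; linarith
    calc L^k * S1 ≤ L^k * (UF LL / W * r1 LL + (J.card:ℝ)^2 * (3 * Real.exp (-LL/2))) := by gcongr
      _ = UF LL / W * (L^k * r1 LL) + 3 * (J.card:ℝ)^2 * (L^k * Real.exp (-LL/2)) := by ring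
      _ ≤ 600 * L / W * (L^k * r1 LL) + 3 * (J.card:ℝ)^2 * 1 := by gcongr
      _ = _ := by ring
  have c2 : ∀ i0, L * ((W.totient:ℝ)⁻¹ * (L^(k-1) * r2 i0 LL)) - (J.card:ℝ)^2 ≤ L^(k-1) * S2 i0 :=
    fun i0 => by
    have hp := h2 i0
    calc L * ((W.totient:ℝ)⁻¹ * (L^(k-1) * r2 i0 LL)) - (J.card:ℝ)^2
        ≤ XF F LL * ((W.totient:ℝ)⁻¹ * (L^(k-1) * r2 i0 LL)) - (J.card:ℝ)^2 * (L^(k-1) * E) := by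
          have : (J.card:ℝ)^2 * (L^(k-1) * E) ≤ (J.card:ℝ)^2 := mul_le_of_le_one_right (by positivity) hE1
          have : L * ((W.totient:ℝ)⁻¹ * (L^(k-1) * r2 i0 LL))
            ≤ XF F LL * ((W.totient:ℝ)⁻¹ * (L^(k-1) * r2 i0 LL)) := by gcongr
          linarith
      _ = L^(k-1) * (XF F LL / W.totient * r2 i0 LL - (J.card:ℝ)^2 * E) := by ring
      _ ≤ L^(k-1) * S2 i0 := by gcongr; exact b2 i0
  have hmain : 2 * LL * mm * S1 < ∑ i0, S2 i0 := by
    have d1 : ∑ i0, (L * ((W.totient:ℝ)⁻¹ * (L^(k-1) * r2 i0 LL)) - (J.card:ℝ)^2)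
        ≤ L^(k-1) * ∑ i0, S2 i0 := by
      rw [Finset.mul_sum]; exact Finset.sum_le_sum fun i0 _ => c2 i0
    rw [Finset.sum_sub_distrib, Finset.sum_const, Finset.card_univ, Fintype.card_fin, nsmul_eq_mul,
      ← Finset.mul_sum] at d1
    have d2 := mul_pos hL0 hQ
    rw [mul_sub, mul_sub, mul_div_cancel₀ _ hL0.ne', hKK0] at d2
    have d3 : 400 * mm * (L^k * S1) ≤ 400 * mm * (600 * L / W * (L^k * r1 LL) + 3 * (J.card:ℝ)^2) := by
      gcongr
    have d4 : L^k = L^(k-1) * L := by rw [← pow_succ]; congr 1; omega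
    have d5 : 400 * mm * (600 * L / W * (L^k * r1 LL) + 3 * (J.card:ℝ)^2)
      = L * (240000 * mm * (W:ℝ)⁻¹ * (L^k * r1 LL)) + 1200 * mm * (J.card:ℝ)^2 := by
      ring
    have d6 : L^(k-1) * (2 * LL * mm * S1) = 400 * mm * (L^k * S1) := by
      rw [d4, hL]; ring
    have d7 : L^(k-1) * (2 * LL * mm * S1) < L^(k-1) * ∑ i0, S2 i0 := by
      rw [d6]; linarith
    exact lt_of_mul_lt_mul_left d7 (by positivity)
  have hex : ∃ m ∈ (rg LL).filter (· ≡ v0 [MOD W]),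
      2 * LL * mm * (u1 LL m * wS L W G J h m) < ∑ i0, gF F LL (m + h i0) * wS L W G J h m := by
    refine Finset.exists_lt_of_sum_lt ?_
    rw [← Finset.mul_sum, Finset.sum_comm]
    exact hmain
  obtain ⟨m, -, hm⟩ := hex
  rw [← Finset.sum_mul, ← mul_assoc] at hm
  obtain ⟨q1, q2⟩ := extract H hF h4 hWL hh mm (lt_of_mul_lt_mul_right hm (wS_nonneg _ _ _ _))
  exact ⟨m, by exact_mod_cast hN.trans q1, q2⟩

end

end

section

open Filter Topology MeasureTheory

/-- A smooth bump equal to one on `[-1,1]`, supported in `[-2,2]`. -/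
lemma exists_bump : ∃ Ψ : ℝ → ℝ, ContDiff ℝ (⊤:ℕ∞) Ψ ∧ HasCompactSupport Ψ ∧ (∀ t, 0 ≤ Ψ t) ∧
    (∀ t, Ψ t ≤ 1) ∧ (∀ t, |t| ≤ 1 → Ψ t = 1) ∧ (∀ t, 2 ≤ |t| → Ψ t = 0) := by
  let b : ContDiffBump (0:ℝ) := ⟨1, 2, by norm_num, by norm_num⟩
  refine ⟨b, b.contDiff, b.hasCompactSupport, fun t => b.nonneg, fun t => b.le_one,
    fun t ht => b.one_of_mem_closedBall ?_, fun t ht => b.zero_of_le_dist ?_⟩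
  · simpa [Real.norm_eq_abs] using ht
  · simpa [Real.dist_eq] using ht

lemma deriv_supp {Ψ : ℝ → ℝ} (h0 : ∀ t, 0 ≤ Ψ t) (h1 : ∀ t, Ψ t ≤ 1)
    (ho : ∀ t, |t| ≤ 1 → Ψ t = 1) (hz : ∀ t, 2 ≤ |t| → Ψ t = 0) {t : ℝ} (ht : 0 < t)
    (hne : deriv Ψ t ≠ 0) : 1 < t ∧ t < 2 := by
  constructor
  · by_contra h
    push Not at h
    refine hne (IsLocalMax.deriv_eq_zero (Filter.Eventually.of_forall fun x => ?_))
    rw [ho t (by rw [abs_of_pos ht]; exact h)]; exact h1 x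
  · by_contra h
    push Not at h
    refine hne (IsLocalMin.deriv_eq_zero (Filter.Eventually.of_forall fun x => ?_))
    rw [hz t (by rw [abs_of_pos ht]; exact h)]; exact h0 x

lemma kappa_pos {Ψ : ℝ → ℝ} (hs : ContDiff ℝ (⊤:ℕ∞) Ψ) (hc : HasCompactSupport Ψ)
    (ho : ∀ t, |t| ≤ 1 → Ψ t = 1) (hz : ∀ t, 2 ≤ |t| → Ψ t = 0) :
    0 < ∫ t in Set.Ioi (0:ℝ), deriv Ψ t * deriv Ψ t := by
  have hcd : Continuous (deriv Ψ) := hs.continuous_deriv (by simp)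
  have hcont : Continuous fun t => deriv Ψ t * deriv Ψ t := hcd.mul hcd
  have hcs : HasCompactSupport fun t => deriv Ψ t * deriv Ψ t := hc.deriv.mul_right
  rw [setIntegral_pos_iff_support_of_nonneg_ae
    (Filter.Eventually.of_forall fun t => mul_self_nonneg _)
    (hcont.integrable_of_hasCompactSupport hcs).integrableOn]
  refine IsOpen.measure_pos _ (hcont.isOpen_support.inter isOpen_Ioi) ?_
  obtain ⟨x, hx, hd⟩ := exists_deriv_eq_slope Ψ (show (1:ℝ) < 2 by norm_num)
    hs.continuous.continuousOn (hs.differentiable (by simp)).differentiableOn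
  rw [ho 1 (by simp), hz 2 (by simp)] at hd
  refine ⟨x, ?_, by have := hx.1; simp; linarith⟩
  simp only [Function.mem_support]
  rw [hd]; norm_num

section
variable {k N : ℕ}

lemma prod_sum_fin (D : Fin k → Fin N → ℝ) :
    ∑ j : Fin k → Fin N, ∏ i, D i (j i) = ∏ i, ∑ a, D i a := by
  rw [Finset.prod_univ_sum, Fintype.piFinset_univ]

lemma markov (D : Fin k → Fin N → ℝ) (hD : ∀ i a, 0 ≤ D i a) (c : Fin N → ℝ) (hc : ∀ a, 0 ≤ c a)
    (s : Finset (Fin k)) {ε : ℝ} (hε : 0 ≤ ε) (h : ∀ i ∈ s, ∑ a, c a * D i a ≤ ε * ∑ a, D i a) :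
    (1 - 2 * k * ε) * ∏ i, ∑ a, D i a
      ≤ ∑ j : Fin k → Fin N with ∑ i ∈ s, c (j i) ≤ 1/2, ∏ i, D i (j i) := by
  have h1 : ∀ i1 ∈ s, ∑ j : Fin k → Fin N, c (j i1) * ∏ i, D i (j i) ≤ ε * ∏ i, ∑ a, D i a := by
    intro i1 hi1
    have e1 : ∀ j : Fin k → Fin N, c (j i1) * ∏ i, D i (j i)
        = ∏ i, ((if i = i1 then c (j i) else 1) * D i (j i)) := fun j => by
      rw [Finset.prod_mul_distrib, Finset.prod_ite_eq' Finset.univ i1 fun i => c (j i)]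
      simp
    simp_rw [e1]
    rw [prod_sum_fin (fun i a => (if i = i1 then c a else 1) * D i a)]
    have e2 : ε * ∏ i, ∑ a, D i a = ∏ i, ((if i = i1 then ε else 1) * ∑ a, D i a) := by
      rw [Finset.prod_mul_distrib, Finset.prod_ite_eq' Finset.univ i1 fun _ => ε]
      simp
    rw [e2]
    refine Finset.prod_le_prod (fun i _ => Finset.sum_nonneg fun a _ => mul_nonneg ?_ (hD _ _))
      fun i _ => ?_
    · split_ifs
      · exact hc a
      · exact zero_le_one
    · split_ifs with hi
      · subst hi; exact h i hi1
      · simp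
  have h2 : ∑ j : Fin k → Fin N, (1 - 2 * ∑ i ∈ s, c (j i)) * ∏ i, D i (j i)
      ≤ ∑ j : Fin k → Fin N with ∑ i ∈ s, c (j i) ≤ 1/2, ∏ i, D i (j i) := by
    rw [Finset.sum_filter]
    refine Finset.sum_le_sum fun j _ => ?_
    have hp : 0 ≤ ∏ i, D i (j i) := Finset.prod_nonneg fun i _ => hD _ _
    have hs : 0 ≤ ∑ i ∈ s, c (j i) := Finset.sum_nonneg fun i _ => hc _
    split_ifs with hj
    · nlinarith
    · push Not at hj
      nlinarith
  refine le_trans ?_ h2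
  have h3 : ∑ j : Fin k → Fin N, (1 - 2 * ∑ i ∈ s, c (j i)) * ∏ i, D i (j i)
      = ∏ i, ∑ a, D i a - 2 * ∑ i1 ∈ s, ∑ j : Fin k → Fin N, c (j i1) * ∏ i, D i (j i) := by
    rw [Finset.sum_comm, Finset.mul_sum, ← prod_sum_fin, ← Finset.sum_sub_distrib]
    refine Finset.sum_congr rfl fun j _ => ?_
    rw [← Finset.sum_mul]; ring
  have h4 := Finset.sum_le_card_nsmul s _ _ h1
  have hE : 0 ≤ ∏ i, ∑ a, D i a := Finset.prod_nonneg fun i _ => Finset.sum_nonneg fun a _ => hD _ _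
  have h5 : s.card • (ε * ∏ i, ∑ a, D i a) ≤ k * (ε * ∏ i, ∑ a, D i a) := by
    rw [nsmul_eq_mul]
    have : s.card ≤ k := by simpa using Finset.card_le_univ s
    gcongr
  rw [h3]
  linarith

lemma DS_id_eq {G : Fin N → ℝ → ℝ} {d : Fin N → ℝ} (hd : ∀ a b, DD G a b = if a = b then d a else 0)
    (J : Finset (Fin k → Fin N)) :
    DS G J (id : Fin k → Fin k) = ∑ j ∈ J, ∏ i, d (j i) := by
  unfold DS
  refine Finset.sum_congr rfl fun j hj => ?_
  rw [Finset.sum_eq_single_of_mem j hj]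
  · refine Finset.prod_congr rfl fun i _ => ?_
    rw [hd]; simp
  · intro j' _ hne
    obtain ⟨i, hi⟩ := Function.ne_iff.1 hne
    refine Finset.prod_eq_zero (Finset.mem_univ i) ?_
    rw [hd, if_neg]; exact fun h => hi h.symm

lemma DS_sub_ge {G : Fin N → ℝ → ℝ} {d : Fin N → ℝ} (hd : ∀ a b, DD G a b = if a = b then d a else 0)
    (hd0 : ∀ a, 0 < d a) (c : Fin N → ℝ) (hc : ∀ a, 0 ≤ c a) (hc2 : ∀ a, c a ≤ 1/2)
    (hcd : ∑ a, c a * d a ≤ 1/(4*k) * ∑ a, d a) (i0 : Fin k) :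
    (N:ℝ)^2 * (∑ a, d a)^(k-1) / 2 ≤
      DS G (Finset.univ.filter fun j : Fin k → Fin N => ∑ i, c (j i) ≤ 1)
        (Subtype.val : {i : Fin k // i ≠ i0} → Fin k) := by
  have hk : (0:ℝ) < k := by exact_mod_cast i0.pos
  set D : Fin k → Fin N → ℝ := fun i a => if i = i0 then 1 else d a with hD
  have hD0 : ∀ i a, 0 ≤ D i a := fun i a => by
    simp only [hD]; split_ifs
    · exact zero_le_one
    · exact (hd0 a).le
  have hm := markov D hD0 c hc (Finset.univ.erase i0) (ε := 1/(4*k)) (by positivity) (fun i hi => by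
    simp only [hD, if_neg (Finset.ne_of_mem_erase hi)]; exact hcd)
  have h1 : ∏ i, ∑ a, D i a = N * (∑ a, d a)^(k-1) := by
    rw [Fintype.prod_eq_mul_prod_subtype_ne _ i0]
    have e1 : ∑ a, D i0 a = N := by simp [hD]
    have e2 : ∀ i : {i : Fin k // i ≠ i0}, ∑ a, D i a = ∑ a, d a := fun i => by
      simp only [hD, if_neg i.2]
    rw [e1, Finset.prod_congr rfl fun i _ => e2 i, Finset.prod_const, Finset.card_univ]
    simp
  have h2 : ∀ j : Fin k → Fin N, ∏ i, D i (j i) = ∏ i : {i : Fin k // i ≠ i0}, d (j i) := fun j => by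
    rw [Fintype.prod_eq_mul_prod_subtype_ne _ i0]
    have e1 : D i0 (j i0) = 1 := by simp [hD]
    rw [e1, one_mul]
    refine Finset.prod_congr rfl fun i _ => ?_
    simp only [hD, if_neg i.2]
  have h3 : 1 - 2 * (k:ℝ) * (1/(4*k)) = 1/2 := by field_simp; norm_num
  rw [h3, h1] at hm
  have h4 : N * ∑ j : Fin k → Fin N with ∑ i ∈ Finset.univ.erase i0, c (j i) ≤ 1/2, ∏ i, D i (j i)
      ≤ DS G (Finset.univ.filter fun j : Fin k → Fin N => ∑ i, c (j i) ≤ 1)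
        (Subtype.val : {i : Fin k // i ≠ i0} → Fin k) := by
    unfold DS
    have hnn : ∀ j j' : Fin k → Fin N, 0 ≤ ∏ i : {i : Fin k // i ≠ i0}, DD G (j i) (j' i) :=
      fun j j' => Finset.prod_nonneg fun i _ => by
        rw [hd]; split_ifs
        · exact (hd0 _).le
        · exact le_rfl
    have hsum : ∀ j : Fin k → Fin N, ∑ i, c (j i) = c (j i0) + ∑ i ∈ Finset.univ.erase i0, c (j i) :=
      fun j => (Finset.add_sum_erase _ _ (Finset.mem_univ i0)).symm
    rw [Finset.mul_sum]
    refine le_trans ?_ (Finset.sum_le_sum_of_subset_of_nonneg (s := Finset.univ.filter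
      fun j : Fin k → Fin N => ∑ i ∈ Finset.univ.erase i0, c (j i) ≤ 1/2) ?_ 
      fun j _ _ => Finset.sum_nonneg fun j' _ => hnn j j')
    · refine Finset.sum_le_sum fun j hj => ?_
      rw [Finset.mem_filter] at hj
      have hinj : Function.Injective fun a => Function.update j i0 a := Function.update_injective j i0
      refine le_trans ?_ (Finset.sum_le_sum_of_subset_of_nonneg
        (s := Finset.univ.image fun a => Function.update j i0 a) ?_ fun j' _ _ => hnn j j')
      · rw [Finset.sum_image fun a _ b _ hab => hinj hab]
        rw [h2]
        refine le_of_eq ?_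
        rw [Finset.sum_congr rfl (g := fun _ => ∏ i : {i : Fin k // i ≠ i0}, d (j i)), Finset.sum_const]
        · simp
        · intro a _
          refine Finset.prod_congr rfl fun i _ => ?_
          rw [hd, Function.update_of_ne i.2, if_pos rfl]
      · intro j' hj'
        obtain ⟨a, -, rfl⟩ := Finset.mem_image.1 hj'
        rw [Finset.mem_filter, hsum]
        refine ⟨Finset.mem_univ _, ?_⟩
        rw [Function.update_self]
        have : ∑ i ∈ Finset.univ.erase i0, c (Function.update j i0 a i)
            = ∑ i ∈ Finset.univ.erase i0, c (j i) :=
          Finset.sum_congr rfl fun i hi => by rw [Function.update_of_ne (Finset.ne_of_mem_erase hi)]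
        rw [this]
        have := hc2 a
        linarith [hj.2]
    · intro j hj
      rw [Finset.mem_filter] at hj ⊢
      refine ⟨Finset.mem_univ _, ?_⟩
      rw [hsum]
      have := hc2 (j i0)
      linarith [hj.2]
  refine le_trans ?_ h4
  have := mul_le_mul_of_nonneg_left hm (Nat.cast_nonneg (α := ℝ) N)
  refine le_trans (le_of_eq ?_) this
  ring

end

end

section

open Filter Topology MeasureTheory

theorem opt (mm : ℕ) : ∃ (k N : ℕ) (G : Fin N → ℝ → ℝ) (Φ : Fin N → ℝ → ℂ) (c : Fin N → ℝ)
    (J : Finset (Fin k → Fin N)), 0 < k ∧ Setup G Φ c J ∧ 0 < DS G J (id : Fin k → Fin k) ∧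
    (∀ i0, 0 < DS G J (Subtype.val : {i : Fin k // i ≠ i0} → Fin k)) ∧
    240000 * mm * DS G J (id : Fin k → Fin k)
      < ∑ i0, DS G J (Subtype.val : {i : Fin k // i ≠ i0} → Fin k) := by
  obtain ⟨Ψ, hs, hcs, h0, h1, ho, hz⟩ := exists_bump
  have hκ := kappa_pos hs hcs ho hz
  set κ := ∫ t in Set.Ioi (0:ℝ), deriv Ψ t * deriv Ψ t with hκd
  obtain ⟨N, hN⟩ := exists_nat_gt (7680000 * κ * mm + 1)
  have hN1 : (1:ℝ) < N := lt_of_le_of_lt (by have : 0 ≤ 7680000 * κ * mm := by positivity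
                                             linarith) hN
  have hN1' : 1 < N := by exact_mod_cast hN1
  set k : ℕ := 2^N with hk
  have hk0 : (0:ℝ) < k := by rw [hk]; positivity
  have hkR : (k:ℝ) = 2^N := by rw [hk]; push_cast; rfl
  set T : ℝ := 8 * k * N with hT
  have hT0 : 0 < T := by positivity
  set l : Fin N → ℝ := fun a => 2^(a:ℕ) / T with hl
  have hl0 : ∀ a, 0 < l a := fun a => by simp only [hl]; positivity
  set G : Fin N → ℝ → ℝ := fun a t => Ψ ((l a)⁻¹ * t) with hG
  have hGs : ∀ a, ContDiff ℝ (⊤:ℕ∞) (G a) := fun a => hs.comp (contDiff_const.mul contDiff_id)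
  have hGc : ∀ a, HasCompactSupport (G a) := fun a => by
    have := hcs.comp_smul (inv_ne_zero (hl0 a).ne')
    exact this
  have hrep : ∀ a, ∃ φ, LapRep (G a) φ := fun a => exists_rep _ (hGs a) (hGc a)
  choose Φ hΦ using hrep
  set c : Fin N → ℝ := fun a => 2 * l a with hc
  have hc0 : ∀ a, 0 ≤ c a := fun a => by have := hl0 a; simp only [hc]; positivity
  set d : Fin N → ℝ := fun a => κ / l a with hd
  have hd0 : ∀ a, 0 < d a := fun a => by have := hl0 a; simp only [hd]; positivity
  have hder : ∀ a t, deriv (G a) t = (l a)⁻¹ * deriv Ψ ((l a)⁻¹ * t) := fun a t => by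
    simp only [hG]
    rw [deriv_comp_mul_left, smul_eq_mul]
  have hDD : ∀ a b, DD G a b = if a = b then d a else 0 := fun a b => by
    unfold DD
    split_ifs with hab
    · subst hab
      simp_rw [hder]
      have e1 : ∀ t, (l a)⁻¹ * deriv Ψ ((l a)⁻¹ * t) * ((l a)⁻¹ * deriv Ψ ((l a)⁻¹ * t))
          = ((l a)⁻¹)^2 * (fun x => deriv Ψ x * deriv Ψ x) ((l a)⁻¹ * t) := fun t => by ring
      have e2 := integral_comp_mul_left_Ioi (fun x => deriv Ψ x * deriv Ψ x) 0 (inv_pos.2 (hl0 a))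
      simp only [mul_zero, smul_eq_mul, inv_inv] at e2
      rw [MeasureTheory.integral_congr_ae (Filter.Eventually.of_forall e1)]
      rw [integral_const_mul]
      simp only []
      rw [e2, ← hκd]
      simp only [hd]
      have := (hl0 a).ne'
      field_simp
    · have key : ∀ a b : Fin N, a < b → ∀ t, 0 < t → deriv (G a) t ≠ 0 → deriv (G b) t ≠ 0 → False := by
        intro a b hab t ht ha hb
        rw [hder] at ha hb
        have ha' := deriv_supp h0 h1 ho hz (by have := hl0 a; positivity) (right_ne_zero_of_mul ha)
        have hb' := deriv_supp h0 h1 ho hz (by have := hl0 b; positivity) (right_ne_zero_of_mul hb)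
        have q1 : t < 2 * l a := by
          have := ha'.2; rw [inv_mul_lt_iff₀ (hl0 a)] at this; linarith
        have q2 : l b < t := by
          have := hb'.1; rw [lt_inv_mul_iff₀ (hl0 b)] at this; linarith
        have q3 : 2 * l a ≤ l b := by
          simp only [hl]
          rw [mul_div_assoc']
          gcongr
          rw [← pow_succ']
          exact pow_le_pow_right₀ (by norm_num) hab
        linarith
      refine setIntegral_eq_zero_of_forall_eq_zero fun t ht => ?_
      by_contra hne
      rcases lt_or_gt_of_ne hab with h | h
      · exact key a b h t ht (left_ne_zero_of_mul hne) (right_ne_zero_of_mul hne)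
      · exact key b a h t ht (right_ne_zero_of_mul hne) (left_ne_zero_of_mul hne)
  have hPlo : κ * T ≤ ∑ a, d a := by
    have e1 : d ⟨0, by omega⟩ = κ * T := by
      simp only [hd, hl]; simp
    rw [← e1]
    exact Finset.single_le_sum (f := d) (fun a _ => (hd0 a).le) (Finset.mem_univ _)
  have hPhi : ∑ a, d a ≤ 2 * κ * T := by
    have e1 : ∀ a : Fin N, d a = κ * T * (1/2:ℝ)^(a:ℕ) := fun a => by
      simp only [hd, hl]; rw [one_div, inv_pow]; field_simp
    rw [Finset.sum_congr rfl fun a _ => e1 a, ← Finset.mul_sum,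
      Fin.sum_univ_eq_sum_range (fun i => (1/2:ℝ)^i) N]
    have := sum_geometric_two_le N
    calc κ * T * ∑ i ∈ Finset.range N, (1/2:ℝ)^i ≤ κ * T * 2 := by gcongr
      _ = _ := by ring
  have hP0 : 0 < ∑ a, d a := lt_of_lt_of_le (by positivity) hPlo
  have hc2 : ∀ a, c a ≤ 1/2 := fun a => by
    simp only [hc, hl]
    have e1 : (2:ℝ) * 2^(a:ℕ) ≤ k := by
      rw [hkR, ← pow_succ']; exact pow_le_pow_right₀ (by norm_num) a.2
    rw [mul_div_assoc', div_le_iff₀ hT0, hT]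
    nlinarith
  have hcd : ∑ a, c a * d a ≤ 1/(4*k) * ∑ a, d a := by
    have e1 : ∀ a, c a * d a = 2 * κ := fun a => by
      have := (hl0 a).ne'
      simp only [hc, hd]; field_simp
    rw [Finset.sum_congr rfl fun a _ => e1 a, Finset.sum_const, Finset.card_univ, Fintype.card_fin,
      nsmul_eq_mul]
    calc (N:ℝ) * (2 * κ) = 1/(4*k) * (κ * T) := by rw [hT]; field_simp; ring
      _ ≤ _ := by gcongr
  set J : Finset (Fin k → Fin N) := Finset.univ.filter fun j => ∑ i, c (j i) ≤ 1 with hJ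
  have hsub := fun i0 : Fin k => DS_sub_ge (k := k) hDD hd0 c hc0 hc2 hcd i0
  have hk' : 0 < k := by exact_mod_cast hk0
  refine ⟨k, N, G, Φ, c, J, hk', ⟨hΦ, fun a => (hGs a).differentiable (by simp), fun a t => ?_, fun a => ?_,
    fun a t ht => ?_, hc0, fun j hj => ?_⟩, ?_, fun i0 => ?_, ?_⟩
  · rw [abs_le]; exact ⟨by have := h0 ((l a)⁻¹ * t); simp only [hG]; linarith, h1 _⟩
  · simp only [hG]; rw [mul_zero]; exact ho 0 (by simp)
  · by_contra hlt
    push Not at hlt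
    refine ht (hz _ ?_)
    have h2 : 2 ≤ (l a)⁻¹ * t := by
      rw [le_inv_mul_iff₀ (hl0 a)]; simp only [hc] at hlt; linarith
    exact h2.trans (le_abs_self _)
  · exact (Finset.mem_filter.1 hj).2
  · rw [DS_id_eq hDD]
    refine Finset.sum_pos (fun j _ => Finset.prod_pos fun i _ => hd0 _) ⟨fun _ => ⟨0, by omega⟩, ?_⟩
    rw [hJ, Finset.mem_filter]
    refine ⟨Finset.mem_univ _, ?_⟩
    simp only [hc, hl, Finset.sum_const, Finset.card_univ, Fintype.card_fin, nsmul_eq_mul, pow_zero]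
    rw [hT]
    have : (k:ℝ) * (2 * (1 / (8 * k * N))) = 1/(4*N) := by field_simp; norm_num
    rw [this, div_le_one (by positivity)]
    linarith
  · refine lt_of_lt_of_le ?_ (hsub i0)
    positivity
  · have hIle : DS G J (id : Fin k → Fin k) ≤ (∑ a, d a)^k := by
      rw [DS_id_eq hDD]
      refine (Finset.sum_le_sum_of_subset_of_nonneg (Finset.subset_univ _)
        fun j _ _ => Finset.prod_nonneg fun i _ => (hd0 _).le).trans (le_of_eq ?_)
      rw [prod_sum_fin (fun _ => d), Finset.prod_const, Finset.card_univ, Fintype.card_fin]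
    have hsum : (k:ℝ) * ((N:ℝ)^2 * (∑ a, d a)^(k-1) / 2)
        ≤ ∑ i0, DS G J (Subtype.val : {i : Fin k // i ≠ i0} → Fin k) := by
      have := Finset.card_nsmul_le_sum (Finset.univ : Finset (Fin k)) _ _ fun i0 _ => hsub i0
      rwa [Finset.card_univ, Fintype.card_fin, nsmul_eq_mul] at this
    refine lt_of_lt_of_le ?_ hsum
    calc 240000 * mm * DS G J (id : Fin k → Fin k) ≤ 240000 * mm * (∑ a, d a)^k := by gcongr
      _ = 240000 * mm * (∑ a, d a) * (∑ a, d a)^(k-1) := by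
        rw [mul_assoc _ (∑ a, d a), ← pow_succ']; congr 2; omega
      _ ≤ 240000 * mm * (2 * κ * T) * (∑ a, d a)^(k-1) := by gcongr
      _ < (k * N^2 / 2) * (∑ a, d a)^(k-1) := by
        refine mul_lt_mul_of_pos_right ?_ (by positivity)
        rw [hT]
        have : 7680000 * κ * mm < N := by linarith
        have h5 : (7680000 * κ * mm) * (k * N / 2) < N * (k * N / 2) :=
          mul_lt_mul_of_pos_right this (by positivity)
        nlinarith
      _ = _ := by ring

lemma avoid {k : ℕ} (hk : 0 < k) (h : Fin k → ℕ) (hcong : ∀ i j, h i ≡ h j [MOD k.factorial])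
    (p : ℕ) (hp : p.Prime) : ∃ e, ∀ i, ¬ h i ≡ e [MOD p] := by
  by_cases hpk : p ≤ k
  · refine ⟨h ⟨0, hk⟩ + 1, fun i hi => ?_⟩
    have h1 := (hcong i ⟨0, hk⟩).of_dvd ((Nat.Prime.dvd_factorial hp).2 hpk)
    have h2 : h ⟨0, hk⟩ + 0 ≡ h ⟨0, hk⟩ + 1 [MOD p] := h1.symm.trans hi
    have h3 := Nat.ModEq.add_left_cancel' _ h2
    have h4 := (Nat.modEq_iff_dvd' (Nat.zero_le 1)).1 h3
    exact hp.one_lt.ne' (Nat.dvd_one.1 h4)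
  · push Not at hpk
    have hcard : (Finset.univ.image fun i => h i % p).card < (Finset.range p).card := by
      refine lt_of_le_of_lt Finset.card_image_le ?_
      simpa using hpk
    obtain ⟨e, he, hne⟩ := Finset.exists_mem_notMem_of_card_lt_card hcard
    refine ⟨e, fun i hi => hne (Finset.mem_image.2 ⟨i, Finset.mem_univ _, ?_⟩)⟩
    have : h i % p = e % p := hi
    rw [this, Nat.mod_eq_of_lt (Finset.mem_range.1 he)]

lemma exists_WOk {k : ℕ} (hk : 0 < k) (h : Fin k → ℕ) (hinj : Function.Injective h)
    (hcong : ∀ i j, h i ≡ h j [MOD k.factorial]) : ∃ W v0, WOk h W v0 := by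
  have hav := avoid hk h hcong
  choose! e he using hav
  set B := 4 * (3*k)^2 + ∑ i, h i + 1 with hB
  set t := Nat.primesBelow B with ht
  have htp : ∀ p ∈ t, p.Prime := fun p hp => Nat.prime_of_mem_primesBelow hp
  obtain ⟨r, hr⟩ := crt_set 1 0 e t fun p hp => ⟨htp p hp, (htp p hp).one_lt.ne' ∘ Nat.dvd_one.1⟩
  have hr2 := ((hr r).2 rfl).2
  have hge : ∀ p : ℕ, p.Prime → ¬ p ∣ ∏ p ∈ t, p → B ≤ p := fun p hp hpd => by
    by_contra hlt
    push Not at hlt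
    exact hpd (Finset.dvd_prod_of_mem _ (Nat.mem_primesBelow.2 ⟨hlt, hp⟩))
  refine ⟨∏ p ∈ t, p, r, hinj, Finset.prod_ne_zero_iff.2 fun p hp => (htp p hp).ne_zero,
    fun p hp hpd => ?_, fun p hp hpd i => ?_, fun i => ?_⟩
  · have := hge p hp hpd
    omega
  · have h1 := hge p hp hpd
    have h2 : h i ≤ ∑ i, h i := Finset.single_le_sum (fun i _ => Nat.zero_le _) (Finset.mem_univ i)
    omega
  · refine Nat.Coprime.prod_right fun p hp => ?_
    refine ((Nat.Prime.coprime_iff_not_dvd (htp p hp)).2 fun hd => ?_).symm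
    refine he p (htp p hp) i (Nat.ModEq.add_left_cancel' r ?_)
    exact (Nat.modEq_zero_iff_dvd.2 hd).trans (Nat.modEq_zero_iff_dvd.2 (hr2 p hp)).symm

theorem final (mm : ℕ) : ∃ km : ℕ, ∀ k : ℕ, km ≤ k → ∀ h : Fin k → ℕ, Function.Injective h →
    {n : ℕ | ∃ s : Finset (Fin k), mm + 1 ≤ s.card ∧ ∀ i ∈ s, Nat.Prime (n + h i)}.Infinite := by
  obtain ⟨k0, N, G, Φ, c, J, hk0, S, hI, hJ, hineq⟩ := opt mm
  refine ⟨k0.factorial * k0, fun k hk h hinj => ?_⟩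
  obtain ⟨y, -, hy⟩ := Finset.exists_le_card_fiber_of_mul_le_card_of_maps_to
    (s := (Finset.univ : Finset (Fin k))) (t := Finset.range k0.factorial) (n := k0)
    (f := fun i => h i % k0.factorial)
    (fun i _ => Finset.mem_range.2 (Nat.mod_lt _ (Nat.factorial_pos _)))
    ⟨0, Finset.mem_range.2 (Nat.factorial_pos _)⟩ (by simpa using hk)
  obtain ⟨s, hs, hcard⟩ := Finset.exists_subset_card_eq hy
  set e : Fin k0 → Fin k := fun i => s.orderEmbOfFin hcard i with he
  have hei : Function.Injective e := (s.orderEmbOfFin hcard).injective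
  have hmod : ∀ i, h (e i) % k0.factorial = y := fun i =>
    (Finset.mem_filter.1 (hs (Finset.orderEmbOfFin_mem s hcard i))).2
  obtain ⟨W, v0, H⟩ := exists_WOk hk0 (fun i => h (e i)) (hinj.comp hei)
    (fun i j => (hmod i).trans (hmod j).symm)
  refine Set.infinite_of_forall_exists_gt fun n0 => ?_
  obtain ⟨m, hm, hc⟩ := core S H hk0 mm hI hJ hineq (n0 + 1)
  refine ⟨m, ⟨(Finset.univ.filter fun i => (m + h (e i)).Prime).image e, ?_, fun i hi => ?_⟩, hm⟩
  · rw [Finset.card_image_of_injective _ hei]; exact hc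
  · obtain ⟨i', hi', rfl⟩ := Finset.mem_image.1 hi
    exact (Finset.mem_filter.1 hi').2

end

/-- Maynard–Tao: for every `m ≥ 2` there is `kₘ` such that every admissible tuple
of length `k ≥ kₘ` produces at least `m` primes among `n + h 1, …, n + h k`
for infinitely many `n`. -/
theorem maynard_tao (m : ℕ) (hm : 2 ≤ m) :
    ∃ km : ℕ, ∀ k : ℕ, km ≤ k → ∀ h : Fin k → ℕ, AdmissibleTuple h →
      {n : ℕ | ∃ s : Finset (Fin k), m ≤ s.card ∧
        ∀ i ∈ s, Nat.Prime (n + h i)}.Infinite := by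
  obtain ⟨km, h⟩ := final (m - 1)
  refine ⟨km, fun k hk t ht => ?_⟩
  have := h k hk t ht.1
  rwa [Nat.sub_add_cancel (by omega)] at this
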